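/- arXiv:2605.25914 — 3 statements merged into one kernel-verified Lean document; each statement's English description precedes it below -/
import Mathlib

section
/- There exist real numbers μ < ν₁ such that the interval [μ, ν₁] is contained in Π^{(3)}_∞, the set of Turán densities of (possibly infinite) families of 3-graphs. -/
open Filter

/-- A finite `r`-graph: a collection of `r`-element subsets (edges) of a finite
vertex set, which we take to be `Fin n`. -/
structure HGraph (r : ℕ) where
  n : ℕ
  edges : Finset (Finset (Fin n))
  card_eq : ∀ e ∈ edges, e.card = r

/-- `H` embeds into `G` as a subgraph (via an injective map on vertices sending
edges to edges). -/
def HGraph.Embeds {r : ℕ} (H G : HGraph r) : Prop :=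
  ∃ f : Fin H.n → Fin G.n, Function.Injective f ∧ ∀ e ∈ H.edges, e.image f ∈ G.edges

/-- `G` is `F`-free: no member of the family `F` embeds into `G`. -/
def IsFree {r : ℕ} (F : Set (HGraph r)) (G : HGraph r) : Prop :=
  ∀ H ∈ F, ¬ H.Embeds G

/-- `ex(n, F)`: the maximum number of edges of an `F`-free `r`-graph on `n` vertices. -/
noncomputable def exNum (r : ℕ) (F : Set (HGraph r)) (n : ℕ) : ℕ :=
  sSup { m : ℕ | ∃ G : HGraph r, G.n = n ∧ IsFree F G ∧ G.edges.card = m }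

/-- The Turán density of the family `F` is `x`. -/
def HasTuranDensity (r : ℕ) (F : Set (HGraph r)) (x : ℝ) : Prop :=
  Tendsto (fun n => (exNum r F n : ℝ) / (n.choose r : ℝ)) atTop (nhds x)

/-- `Π^{(r)}_∞`: the set of Turán densities of (possibly infinite) families of `r`-graphs. -/
def PiInf (r : ℕ) : Set ℝ := { x | ∃ F : Set (HGraph r), HasTuranDensity r F x }

/-- A symmetric `0`/`1`-valued triple system on a finite set of parts (repeated parts allowed),
with a distinguished part `o` for which the triple `o, o, o` is absent. -/
structure Pattern where
  ι : Type
  [fin : Fintype ι]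
  [dec : DecidableEq ι]
  e : ι → ι → ι → ℝ
  zero_or_one : ∀ a b c, e a b c = 0 ∨ e a b c = 1
  swap_left : ∀ a b c, e a b c = e b a c
  swap_right : ∀ a b c, e a b c = e a c b
  o : ι
  e_o : e o o o = 0

namespace Pattern

attribute [instance] Pattern.fin Pattern.dec

variable (P : Pattern)

/-- The Lagrange polynomial of a pattern, normalised so that it is the limiting edge density of
the blow-up with part sizes `ξ`. -/
noncomputable def poly (ξ : P.ι → ℝ) : ℝ := ∑ a, ∑ b, ∑ c, P.e a b c * ξ a * ξ b * ξ c

/-- A `3`-graph is colorable by `P` if it embeds in a blow-up of `P`. -/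
def Colors (P : Pattern) (G : HGraph 3) : Prop :=
  ∃ φ : Fin G.n → P.ι, ∀ a b c, ({a, b, c} : Finset (Fin G.n)) ∈ G.edges →
    P.e (φ a) (φ b) (φ c) = 1

theorem e_nonneg (a b c : P.ι) : 0 ≤ P.e a b c := by
  rcases P.zero_or_one a b c with h | h <;> simp [h]

theorem e_le_one (a b c : P.ι) : P.e a b c ≤ 1 := by
  rcases P.zero_or_one a b c with h | h <;> simp [h]

theorem e_congr {α : Type} [DecidableEq α] (φ : α → P.ι) {a b c a' b' c' : α}
    (hab : a ≠ b) (hac : a ≠ c) (hbc : b ≠ c)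
    (h : ({a, b, c} : Finset α) = {a', b', c'}) :
    P.e (φ a) (φ b) (φ c) = P.e (φ a') (φ b') (φ c') := by
  have s1 := P.swap_left
  have s2 := P.swap_right
  have ha : a ∈ ({a', b', c'} : Finset α) := h ▸ by simp
  have hb : b ∈ ({a', b', c'} : Finset α) := h ▸ by simp
  have hc : c ∈ ({a', b', c'} : Finset α) := h ▸ by simp
  simp only [Finset.mem_insert, Finset.mem_singleton] at ha hb hc
  grind

theorem Colors.of_embeds {P : Pattern} {H G : HGraph 3} (h : H.Embeds G) (hG : P.Colors G) :
    P.Colors H := by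
  obtain ⟨f, -, hf⟩ := h
  obtain ⟨φ, hφ⟩ := hG
  refine ⟨φ ∘ f, fun a b c habc => hφ _ _ _ ?_⟩
  simpa [Finset.image_insert] using hf _ habc

theorem sum_comp_eq_card_mul_poly {n : ℕ} (hn : 0 < n) (φ : Fin n → P.ι) :
    ∑ a, ∑ b, ∑ c, P.e (φ a) (φ b) (φ c) =
      (n : ℝ) ^ 3 * P.poly fun i => (Finset.univ.filter fun v => φ v = i).card / (n : ℝ) := by
  have key : ∀ g : P.ι → ℝ, ∑ v, g (φ v) =
      ∑ i, (n : ℝ) * (g i * ((Finset.univ.filter fun v => φ v = i).card / (n : ℝ))) := by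
    intro g
    have hn' : (n : ℝ) ≠ 0 := by positivity
    rw [← Finset.sum_fiberwise Finset.univ φ]
    refine Finset.sum_congr rfl fun i _ => ?_
    rw [Finset.sum_congr rfl (g := fun _ => g i) (by simp +contextual), Finset.sum_const,
      nsmul_eq_mul]
    field_simp
  rw [key fun i => ∑ b, ∑ c, P.e i (φ b) (φ c), poly, Finset.mul_sum]
  refine Finset.sum_congr rfl fun i _ => ?_
  rw [key fun j => ∑ c, P.e i j (φ c), Finset.sum_mul, Finset.mul_sum, Finset.mul_sum]
  refine Finset.sum_congr rfl fun j _ => ?_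
  rw [key fun k => P.e i j k, Finset.sum_mul, Finset.mul_sum, Finset.sum_mul, Finset.mul_sum,
    Finset.mul_sum]
  refine Finset.sum_congr rfl fun k _ => ?_
  ring

theorem six_le_card_filter {α : Type} [Fintype α] [DecidableEq α] (s : Finset α)
    (hs : s.card = 3) :
    6 ≤ (Finset.univ.filter fun t : α × α × α => ({t.1, t.2.1, t.2.2} : Finset α) = s).card := by
  obtain ⟨a, b, c, hab, hac, hbc, rfl⟩ := Finset.card_eq_three.mp hs
  have : ({(a, b, c), (a, c, b), (b, a, c), (b, c, a), (c, a, b), (c, b, a)} :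
      Finset (α × α × α)).card = 6 := by
    simp [Finset.card_insert_of_notMem, hab, hac, hbc, hab.symm, hac.symm, hbc.symm]
  rw [← this]
  refine Finset.card_le_card fun t ht => ?_
  simp only [Finset.mem_insert, Finset.mem_singleton] at ht
  rw [Finset.mem_filter]
  refine ⟨Finset.mem_univ t, ?_⟩
  rcases ht with rfl | rfl | rfl | rfl | rfl | rfl <;> grind

theorem Colors.card_edges_le {P : Pattern} {G : HGraph 3} (h : P.Colors G) {x : ℝ}
    (hx : ∀ ξ ∈ stdSimplex ℝ P.ι, P.poly ξ ≤ x) (hn : 0 < G.n) :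
    6 * (G.edges.card : ℝ) ≤ x * (G.n : ℝ) ^ 3 := by
  obtain ⟨φ, hφ⟩ := h
  have hn' : (0 : ℝ) < G.n := by exact_mod_cast hn
  have hmem : (fun i => ((Finset.univ.filter fun v => φ v = i).card / (G.n : ℝ))) ∈
      stdSimplex ℝ P.ι := by
    refine ⟨fun i => by positivity, ?_⟩
    rw [← Finset.sum_div, div_eq_one_iff_eq hn'.ne', ← Nat.cast_sum,
      ← Finset.card_eq_sum_card_fiberwise (by simp)]
    simp
  have h1 := hx _ hmem
  have h2 := P.sum_comp_eq_card_mul_poly hn φ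
  let T : Finset (Fin G.n × Fin G.n × Fin G.n) :=
    Finset.univ.filter fun t => ({t.1, t.2.1, t.2.2} : Finset (Fin G.n)) ∈ G.edges
  have h3 : G.edges.card * 6 ≤ T.card := by
    rw [Finset.card_eq_sum_card_fiberwise (s := T) (t := G.edges)
      (f := fun t => ({t.1, t.2.1, t.2.2} : Finset (Fin G.n)))
      (fun t ht => by simpa [T] using ht), ← smul_eq_mul]
    refine Finset.card_nsmul_le_sum _ _ _ fun s hs => ?_
    refine (six_le_card_filter s (G.card_eq s hs)).trans (Finset.card_le_card fun t ht => ?_)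
    have e := (Finset.mem_filter.mp ht).2
    exact Finset.mem_filter.mpr ⟨Finset.mem_filter.mpr ⟨Finset.mem_univ t, e ▸ hs⟩, e⟩
  have h4 : (T.card : ℝ) ≤ ∑ a, ∑ b, ∑ c, P.e (φ a) (φ b) (φ c) := by
    rw [Finset.card_eq_sum_ones, Nat.cast_sum]
    simp only [← Fintype.sum_prod_type']
    refine (Finset.sum_le_sum fun t ht => ?_).trans
      (Finset.sum_le_sum_of_subset_of_nonneg (Finset.subset_univ T)
        fun t _ _ => P.e_nonneg (φ t.1) (φ t.2.1) (φ t.2.2))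
    rw [hφ _ _ _ (Finset.mem_filter.mp ht).2]
    simp
  have h5 : (G.edges.card : ℝ) * 6 ≤ T.card := by exact_mod_cast h3
  have h6 : (G.n : ℝ) ^ 3 * P.poly (fun i => (Finset.univ.filter fun v => φ v = i).card / (G.n : ℝ))
      ≤ (G.n : ℝ) ^ 3 * x := mul_le_mul_of_nonneg_left h1 (by positivity)
  linarith

theorem prod_eq_of_eq_one {α : Type} [Fintype α] [DecidableEq α] {a b c : α} (hab : a ≠ b)
    (hac : a ≠ c) (hbc : b ≠ c) (f : α → ℝ) (hf : ∀ v, v ≠ a → v ≠ b → v ≠ c → f v = 1) :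
    ∏ v, f v = f a * f b * f c := by
  rw [← Finset.prod_subset (Finset.subset_univ {a, b, c})]
  · rw [Finset.prod_insert (by simp [hab, hac]), Finset.prod_insert (by simp [hbc]),
      Finset.prod_singleton, mul_assoc]
  · intro v _ hv
    simp only [Finset.mem_insert, Finset.mem_singleton, not_or] at hv
    exact hf v hv.1 hv.2.1 hv.2.2

theorem sum_prod_mul_e {n : ℕ} {ξ : P.ι → ℝ} (hξ : ∑ i, ξ i = 1) {a b c : Fin n} (hab : a ≠ b)
    (hac : a ≠ c) (hbc : b ≠ c) :
    ∑ φ : Fin n → P.ι, (∏ v, ξ (φ v)) * P.e (φ a) (φ b) (φ c) = P.poly ξ := by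
  let h : P.ι → P.ι → P.ι → Fin n → P.ι → ℝ := fun i j k v t =>
    if v = a then (if t = i then 1 else 0) else if v = b then (if t = j then 1 else 0)
    else if v = c then (if t = k then 1 else 0) else 1
  have h1 : ∀ φ : Fin n → P.ι, (∏ v, ξ (φ v)) * P.e (φ a) (φ b) (φ c) =
      ∑ i, ∑ j, ∑ k, P.e i j k * ∏ v, ξ (φ v) * h i j k v (φ v) := by
    intro φ
    have : ∀ i j k, ∏ v, h i j k v (φ v) = (if φ a = i then 1 else 0) *
        (if φ b = j then 1 else 0) * (if φ c = k then 1 else 0) := by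
      intro i j k
      rw [prod_eq_of_eq_one hab hac hbc _ (by simp +contextual [h])]
      simp [h, hab.symm, hac.symm, hbc.symm]
    simp_rw [Finset.prod_mul_distrib, this]
    rw [Finset.sum_eq_single (φ a) (by simp +contextual [eq_comm]) (by simp),
      Finset.sum_eq_single (φ b) (by simp +contextual [eq_comm]) (by simp),
      Finset.sum_eq_single (φ c) (by simp +contextual [eq_comm]) (by simp)]
    simp [mul_comm]
  have h2 : ∀ i j k, ∑ φ : Fin n → P.ι, ∏ v, ξ (φ v) * h i j k v (φ v) = ξ i * ξ j * ξ k := by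
    intro i j k
    rw [← Fintype.prod_sum (fun v t => ξ t * h i j k v t),
      prod_eq_of_eq_one hab hac hbc _ (by simp +contextual [h, hξ])]
    simp [h, hab.symm, hac.symm, hbc.symm]
  simp_rw [h1]
  rw [Finset.sum_comm, poly]
  refine Finset.sum_congr rfl fun i _ => ?_
  rw [Finset.sum_comm]
  refine Finset.sum_congr rfl fun j _ => ?_
  rw [Finset.sum_comm]
  refine Finset.sum_congr rfl fun k _ => ?_
  rw [← Finset.mul_sum, h2]
  ring

open Classical in
/-- The triples of `Fin n` on which the coloring `φ` is an edge of the pattern. -/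
noncomputable def blowupEdges {n : ℕ} (φ : Fin n → P.ι) : Finset (Finset (Fin n)) :=
  (Finset.powersetCard 3 Finset.univ).filter fun s =>
    ∀ a b c, s = {a, b, c} → P.e (φ a) (φ b) (φ c) = 1

theorem mem_blowupEdges {n : ℕ} {φ : Fin n → P.ι} {s : Finset (Fin n)} :
    s ∈ P.blowupEdges φ ↔ s.card = 3 ∧ ∀ a b c, s = {a, b, c} → P.e (φ a) (φ b) (φ c) = 1 := by
  simp [blowupEdges, Finset.mem_powersetCard]

/-- The largest `3`-graph on `Fin n` colored by `φ`. -/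
noncomputable def blowup {n : ℕ} (φ : Fin n → P.ι) : HGraph 3 where
  n := n
  edges := P.blowupEdges φ
  card_eq _ hs := (P.mem_blowupEdges.mp hs).1

theorem colors_blowup {n : ℕ} (φ : Fin n → P.ι) : P.Colors (P.blowup φ) :=
  ⟨φ, fun a b c h => (P.mem_blowupEdges.mp h).2 a b c rfl⟩

theorem exists_blowup {ξ : P.ι → ℝ} (hξ : ξ ∈ stdSimplex ℝ P.ι) (n : ℕ) :
    ∃ φ : Fin n → P.ι, P.poly ξ * (n.choose 3 : ℝ) ≤ (P.blowup φ).edges.card := by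
  classical
  change ∃ φ : Fin n → P.ι, P.poly ξ * (n.choose 3 : ℝ) ≤ (P.blowupEdges φ).card
  have hW : ∑ φ : Fin n → P.ι, ∏ v, ξ (φ v) = 1 := by
    rw [← Fintype.prod_sum (fun _ t => ξ t)]
    simp [hξ.2]
  have hE : ∀ s ∈ Finset.powersetCard 3 (Finset.univ : Finset (Fin n)),
      ∑ φ : Fin n → P.ι, (∏ v, ξ (φ v)) * (if s ∈ P.blowupEdges φ then 1 else 0) =
        P.poly ξ := by
    intro s hs
    obtain ⟨a, b, c, hab, hac, hbc, rfl⟩ :=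
      Finset.card_eq_three.mp (Finset.mem_powersetCard.mp hs).2
    rw [← P.sum_prod_mul_e hξ.2 hab hac hbc]
    refine Finset.sum_congr rfl fun φ _ => ?_
    congr 1
    have : ({a, b, c} : Finset (Fin n)) ∈ P.blowupEdges φ ↔ P.e (φ a) (φ b) (φ c) = 1 := by
      refine ⟨fun h => (P.mem_blowupEdges.mp h).2 a b c rfl, fun h => ?_⟩
      refine P.mem_blowupEdges.mpr ⟨(Finset.mem_powersetCard.mp hs).2, fun a' b' c' he => ?_⟩
      rw [← P.e_congr φ hab hac hbc he, h]
    rw [if_congr this rfl rfl]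
    rcases P.zero_or_one (φ a) (φ b) (φ c) with h | h <;> simp [h]
  have hsum : ∑ φ : Fin n → P.ι, (∏ v, ξ (φ v)) * ((P.blowupEdges φ).card : ℝ) =
      P.poly ξ * (n.choose 3 : ℝ) := by
    have hc : ∀ φ : Fin n → P.ι, ((P.blowupEdges φ).card : ℝ) =
        ∑ s ∈ Finset.powersetCard 3 (Finset.univ : Finset (Fin n)),
          if s ∈ P.blowupEdges φ then 1 else 0 := by
      intro φ
      rw [Finset.sum_boole, Finset.filter_mem_eq_inter,
        Finset.inter_eq_right.mpr fun s hs => Finset.mem_powersetCard.mpr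
          ⟨Finset.subset_univ s, (P.mem_blowupEdges.mp hs).1⟩]
    simp_rw [hc, Finset.mul_sum]
    rw [Finset.sum_comm, Finset.sum_congr rfl hE]
    simp [mul_comm]
  by_contra! hlt
  have hpos : ∀ φ : Fin n → P.ι, 0 ≤ ∏ v, ξ (φ v) := fun φ =>
    Finset.prod_nonneg fun v _ => hξ.1 _
  have : ∑ φ : Fin n → P.ι, (∏ v, ξ (φ v)) * ((P.blowupEdges φ).card : ℝ) <
      ∑ φ : Fin n → P.ι, (∏ v, ξ (φ v)) * (P.poly ξ * (n.choose 3 : ℝ)) := by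
    obtain ⟨φ, -, hφ⟩ : ∃ φ ∈ (Finset.univ : Finset (Fin n → P.ι)), 0 < ∏ v, ξ (φ v) := by
      by_contra! hcon
      have := Finset.sum_nonpos hcon
      rw [hW] at this
      norm_num at this
    exact Finset.sum_lt_sum (fun φ _ => mul_le_mul_of_nonneg_left (hlt φ).le (hpos φ))
      ⟨φ, Finset.mem_univ _, mul_lt_mul_of_pos_left (hlt φ) hφ⟩
  rw [hsum, ← Finset.sum_mul, hW, one_mul] at this
  exact lt_irrefl _ this

end Pattern

theorem tendsto_choose_three_ratio :
    Tendsto (fun n : ℕ => (n : ℝ) ^ 3 / (6 * (n.choose 3 : ℝ))) atTop (nhds 1) := by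
  have h1 : Tendsto (fun n : ℕ => (1 - (n : ℝ)⁻¹) * (1 - 2 * (n : ℝ)⁻¹)) atTop (nhds 1) := by
    have h0 := tendsto_inv_atTop_nhds_zero_nat (𝕜 := ℝ)
    simpa using (h0.const_sub 1).mul ((h0.const_mul 2).const_sub 1)
  have h2 := h1.inv₀ one_ne_zero
  rw [inv_one] at h2
  refine h2.congr' ?_
  filter_upwards [eventually_ge_atTop 3] with n hn
  obtain ⟨k, rfl⟩ := Nat.exists_eq_add_of_le' hn
  have : ((k + 3).choose 3 : ℝ) = (k + 3) * (k + 2) * (k + 1) / 6 := by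
    rw [Nat.cast_choose_eq_ascPochhammer_div]
    simp [ascPochhammer_succ_left, Nat.factorial]
    ring
  rw [this]
  push_cast
  have : (k : ℝ) + 1 ≠ 0 := by positivity
  have : (k : ℝ) + 2 ≠ 0 := by positivity
  have h3 : (k : ℝ) + 3 ≠ 0 := by positivity
  have e : (1 - ((k : ℝ) + 3)⁻¹) * (1 - 2 * ((k : ℝ) + 3)⁻¹) =
      (k + 2) * (k + 1) / (k + 3) ^ 2 := by
    field_simp
    ring
  rw [e]
  field_simp

/-- Approximating `x` from below by Lagrangians of patterns whose Lagrangian is at most `x` makes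
`x` a Turán density. -/
theorem mem_PiInf_of_patterns {x : ℝ}
    (h : ∀ ε > 0, ∃ P : Pattern, (∀ ξ ∈ stdSimplex ℝ P.ι, P.poly ξ ≤ x) ∧
      ∃ ξ ∈ stdSimplex ℝ P.ι, x - ε ≤ P.poly ξ) : x ∈ PiInf 3 := by
  let F : Set (HGraph 3) :=
    {G | ∀ P : Pattern, (∀ ξ ∈ stdSimplex ℝ P.ι, P.poly ξ ≤ x) → ¬ P.Colors G}
  refine ⟨F, ?_⟩
  have hup : ∀ n : ℕ, 0 < n → ∀ m ∈ {m : ℕ | ∃ G : HGraph 3, G.n = n ∧ IsFree F G ∧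
      G.edges.card = m}, 6 * (m : ℝ) ≤ x * (n : ℝ) ^ 3 := by
    rintro n hn m ⟨G, rfl, hG, rfl⟩
    have : G ∉ F := fun hF => hG G hF ⟨id, Function.injective_id, fun e he => by simpa using he⟩
    simp only [F, Set.mem_ofPred_eq, not_forall, not_not] at this
    obtain ⟨P, hP, hc⟩ := this
    exact hc.card_edges_le hP hn
  have hbdd : ∀ n : ℕ, 0 < n → BddAbove {m : ℕ | ∃ G : HGraph 3, G.n = n ∧ IsFree F G ∧
      G.edges.card = m} := by
    intro n hn
    refine ⟨⌈x * (n : ℝ) ^ 3⌉₊, fun m hm => ?_⟩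
    have h1 := hup n hn m hm
    have h2 := Nat.le_ceil (x * (n : ℝ) ^ 3)
    have h3 : (0 : ℝ) ≤ m := by positivity
    have : (m : ℝ) ≤ ⌈x * (n : ℝ) ^ 3⌉₊ := by linarith
    exact_mod_cast this
  have hmem : ∀ (n : ℕ) (P : Pattern), (∀ ξ ∈ stdSimplex ℝ P.ι, P.poly ξ ≤ x) →
      ∀ φ : Fin n → P.ι, (P.blowup φ).edges.card ∈ {m : ℕ | ∃ G : HGraph 3, G.n = n ∧
        IsFree F G ∧ G.edges.card = m} := fun n P hP φ =>
    ⟨P.blowup φ, rfl, fun H hH he => hH P hP (Pattern.Colors.of_embeds he (P.colors_blowup φ)), rfl⟩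
  have hlow : ∀ n : ℕ, 0 < n → x * (n.choose 3 : ℝ) ≤ exNum 3 F n := by
    intro n hn
    refine le_of_forall_pos_le_add fun δ hδ => ?_
    obtain ⟨P, hP, ξ, hξ, hx⟩ := h (δ / (n.choose 3 + 1)) (by positivity)
    obtain ⟨φ, hφ⟩ := P.exists_blowup hξ n
    have h1 : ((P.blowup φ).edges.card : ℝ) ≤ exNum 3 F n := by
      exact_mod_cast le_csSup (hbdd n hn) (hmem n P hP φ)
    have h2 : (x - δ / (n.choose 3 + 1)) * (n.choose 3 : ℝ) ≤ P.poly ξ * (n.choose 3 : ℝ) :=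
      mul_le_mul_of_nonneg_right hx (by positivity)
    have h3 : δ / (n.choose 3 + 1) * (n.choose 3 : ℝ) ≤ δ := by
      rw [div_mul_eq_mul_div, div_le_iff₀ (by positivity)]
      nlinarith
    linarith
  have hhigh : ∀ n : ℕ, 0 < n → 6 * (exNum 3 F n : ℝ) ≤ x * (n : ℝ) ^ 3 := by
    intro n hn
    obtain ⟨P, hP, ξ, hξ, -⟩ := h 1 one_pos
    obtain ⟨φ, -⟩ := P.exists_blowup hξ n
    exact hup n hn _ (Nat.sSup_mem ⟨_, hmem n P hP φ⟩ (hbdd n hn))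
  have ht := tendsto_choose_three_ratio.const_mul x
  rw [mul_one] at ht
  refine tendsto_of_tendsto_of_tendsto_of_le_of_le' tendsto_const_nhds ht ?_ ?_
  · filter_upwards [eventually_ge_atTop 3] with n hn
    have : (0 : ℝ) < n.choose 3 := by exact_mod_cast Nat.choose_pos hn
    rw [le_div_iff₀ this]
    exact hlow n (by omega)
  · filter_upwards [eventually_ge_atTop 3] with n hn
    have : (0 : ℝ) < n.choose 3 := by exact_mod_cast Nat.choose_pos hn
    rw [← mul_div_assoc, div_le_div_iff₀ this (by positivity)]
    have := hhigh n (by omega)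
    nlinarith

/-- A finite simple graph, presented by its real adjacency matrix. -/
structure AdjGraph (J : Type) where
  adj : J → J → ℝ
  zero_or_one : ∀ i j, adj i j = 0 ∨ adj i j = 1
  symm : ∀ i j, adj i j = adj j i
  irrefl : ∀ i, adj i i = 0

namespace AdjGraph

variable {J : Type} (A : AdjGraph J)

theorem nonneg (i j : J) : 0 ≤ A.adj i j := by
  rcases A.zero_or_one i j with h | h <;> simp [h]

theorem le_one (i j : J) : A.adj i j ≤ 1 := by
  rcases A.zero_or_one i j with h | h <;> simp [h]

variable [Fintype J]

/-- The quadratic form of the adjacency matrix. -/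
def quad (v : J → ℝ) : ℝ := ∑ i, ∑ j, A.adj i j * v i * v j

theorem quad_nonneg {v : J → ℝ} (hv : ∀ j, 0 ≤ v j) : 0 ≤ A.quad v :=
  Finset.sum_nonneg fun i _ => Finset.sum_nonneg fun j _ =>
    mul_nonneg (mul_nonneg (A.nonneg i j) (hv i)) (hv j)

theorem quad_le_sq_sum {v : J → ℝ} (hv : ∀ j, 0 ≤ v j) : A.quad v ≤ (∑ j, v j) ^ 2 := by
  rw [sq, Finset.sum_mul_sum]
  refine Finset.sum_le_sum fun i _ => Finset.sum_le_sum fun j _ => ?_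
  exact mul_le_mul_of_nonneg_right (mul_le_of_le_one_left (hv i) (A.le_one i j)) (hv j)

theorem quad_le_mul_sum_sq {D : ℝ} (hD : ∀ i, ∑ j, A.adj i j ≤ D) (v : J → ℝ) :
    A.quad v ≤ D * ∑ j, v j ^ 2 := by
  have h1 : ∑ i, ∑ j, A.adj i j * v i ^ 2 ≤ D * ∑ j, v j ^ 2 := by
    rw [Finset.mul_sum]
    refine Finset.sum_le_sum fun i _ => ?_
    rw [← Finset.sum_mul]
    exact mul_le_mul_of_nonneg_right (hD i) (sq_nonneg _)
  have h2 : ∑ i, ∑ j, A.adj i j * v j ^ 2 = ∑ i, ∑ j, A.adj i j * v i ^ 2 := by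
    rw [Finset.sum_comm]
    simp_rw [A.symm]
  have h3 : 2 * A.quad v ≤ ∑ i, ∑ j, A.adj i j * v i ^ 2 + ∑ i, ∑ j, A.adj i j * v j ^ 2 := by
    simp_rw [quad, Finset.mul_sum, ← Finset.sum_add_distrib]
    refine Finset.sum_le_sum fun i _ => Finset.sum_le_sum fun j _ => ?_
    nlinarith [mul_nonneg (A.nonneg i j) (sq_nonneg (v i - v j))]
  linarith

theorem quad_smul (t : ℝ) (v : J → ℝ) : A.quad (fun j => t * v j) = t ^ 2 * A.quad v := by
  simp_rw [quad, Finset.mul_sum]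
  refine Finset.sum_congr rfl fun i _ => Finset.sum_congr rfl fun j _ => ?_
  ring

end AdjGraph

namespace Pattern

variable (P : Pattern)

/-- The weight of the link of the doubled distinguished part. -/
def link (ξ : P.ι → ℝ) : ℝ := ∑ c, P.e P.o P.o c * ξ c

theorem link_nonneg {ξ : P.ι → ℝ} (hξ : ξ ∈ stdSimplex ℝ P.ι) : 0 ≤ P.link ξ :=
  Finset.sum_nonneg fun c _ => mul_nonneg (P.e_nonneg _ _ c) (hξ.1 c)

theorem add_link_le_one {ξ : P.ι → ℝ} (hξ : ξ ∈ stdSimplex ℝ P.ι) : ξ P.o + P.link ξ ≤ 1 := by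
  rw [← hξ.2, ← Finset.sum_erase_add _ _ (Finset.mem_univ P.o), link,
    ← Finset.sum_erase_add _ _ (Finset.mem_univ P.o), P.e_o, zero_mul, add_zero, add_comm]
  refine add_le_add_left (Finset.sum_le_sum fun c _ => ?_) _
  exact mul_le_of_le_one_left (hξ.1 c) (P.e_le_one _ _ c)

theorem continuous_poly : Continuous P.poly := by
  unfold poly
  fun_prop

variable {J : Type} [Fintype J] (A : AdjGraph J)

/-- The indicator of the diagonal on the new parts. -/
def newDiag [DecidableEq J] : P.ι ⊕ J → P.ι ⊕ J → ℝ
  | .inr i, .inr j => if i = j then 1 else 0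
  | _, _ => 0

/-- The adjacency matrix on the new parts. -/
def newAdj : P.ι ⊕ J → P.ι ⊕ J → ℝ
  | .inr i, .inr j => A.adj i j
  | _, _ => 0

/-- The projection sending every new part to the distinguished part. -/
def proj : P.ι ⊕ J → P.ι := Sum.elim id fun _ => P.o

/-- The indicator of the old distinguished part. -/
def oldPart [DecidableEq J] (x : P.ι ⊕ J) : ℝ := if x = .inl P.o then 1 else 0

/-- Add to `P` new copies of `o` indexed by `J`; triples with a doubled new copy are deleted and
the edges of `A` are joined to `o`. -/
abbrev ext [DecidableEq J] : Pattern where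
  ι := P.ι ⊕ J
  e a b c := P.e (P.proj a) (P.proj b) (P.proj c) -
    P.newDiag a b * P.e P.o P.o (P.proj c) - P.newDiag b c * P.e P.o P.o (P.proj a) -
    P.newDiag a c * P.e P.o P.o (P.proj b) + P.newAdj A a b * P.oldPart c +
    P.newAdj A b c * P.oldPart a + P.newAdj A a c * P.oldPart b
  zero_or_one a b c := by
    have h0 := P.zero_or_one
    have h1 := A.zero_or_one
    have h2 := A.irrefl
    have h3 := P.e_o
    have s1 := P.swap_left
    have s2 := P.swap_right
    rcases a with a | a <;> rcases b with b | b <;> rcases c with c | c <;>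
      simp only [newDiag, newAdj, proj, oldPart, Sum.elim_inl, Sum.elim_inr, id, Sum.inl.injEq,
        reduceCtorEq, if_false] <;> grind
  swap_left a b c := by
    have hd : ∀ x y : P.ι ⊕ J, P.newDiag x y = P.newDiag y x := by
      rintro (x | x) (y | y) <;> simp [newDiag, eq_comm]
    have ha : ∀ x y : P.ι ⊕ J, P.newAdj A x y = P.newAdj A y x := by
      rintro (x | x) (y | y) <;> simp [newAdj, A.symm]
    rw [P.swap_left, hd b a, ha b a]
    ring
  swap_right a b c := by
    have hd : ∀ x y : P.ι ⊕ J, P.newDiag x y = P.newDiag y x := by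
      rintro (x | x) (y | y) <;> simp [newDiag, eq_comm]
    have ha : ∀ x y : P.ι ⊕ J, P.newAdj A x y = P.newAdj A y x := by
      rintro (x | x) (y | y) <;> simp [newAdj, A.symm]
    rw [P.swap_right, hd c b, ha c b]
    ring
  o := .inl P.o
  e_o := by simp [newDiag, newAdj, proj, P.e_o]

/-- Collapse the weight of the new parts onto the distinguished part. -/
def merge (ξ : P.ι ⊕ J → ℝ) (i : P.ι) : ℝ := ξ (.inl i) + if i = P.o then ∑ j, ξ (.inr j) else 0

/-- Split the weight `ξ` by moving weights `v` from the distinguished part to the new parts. -/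
def split (ξ : P.ι → ℝ) (v : J → ℝ) : P.ι ⊕ J → ℝ :=
  Sum.elim (fun i => ξ i - if i = P.o then ∑ j, v j else 0) v

variable {P}

theorem merge_o (ξ : P.ι ⊕ J → ℝ) : P.merge ξ P.o = ξ (.inl P.o) + ∑ j, ξ (.inr j) := by
  simp [merge]

theorem merge_split (ξ : P.ι → ℝ) (v : J → ℝ) : P.merge (P.split ξ v) = ξ := by
  ext i
  simp [merge, split]

theorem split_inl_o (ξ : P.ι → ℝ) (v : J → ℝ) :
    P.split ξ v (.inl P.o) = ξ P.o - ∑ j, v j := by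
  simp [split]

theorem sum_proj_mul (g : P.ι → ℝ) (ξ : P.ι ⊕ J → ℝ) :
    ∑ x, g (P.proj x) * ξ x = ∑ i, g i * P.merge ξ i := by
  simp [Fintype.sum_sum_type, proj, merge, mul_add, Finset.sum_add_distrib, Finset.mul_sum]

theorem merge_mem {ξ : P.ι ⊕ J → ℝ} (hξ : ξ ∈ stdSimplex ℝ (P.ι ⊕ J)) :
    P.merge ξ ∈ stdSimplex ℝ P.ι := by
  refine ⟨fun i => add_nonneg (hξ.1 _) ?_, ?_⟩
  · split_ifs
    · exact Finset.sum_nonneg fun j _ => hξ.1 _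
    · exact le_rfl
  · have := sum_proj_mul (P := P) (fun _ => 1) ξ
    simp only [one_mul] at this
    rw [← this, hξ.2]

theorem split_mem {ξ : P.ι → ℝ} (hξ : ξ ∈ stdSimplex ℝ P.ι) {v : J → ℝ} (hv : ∀ j, 0 ≤ v j)
    (hle : ∑ j, v j ≤ ξ P.o) : P.split ξ v ∈ stdSimplex ℝ (P.ι ⊕ J) := by
  refine ⟨?_, ?_⟩
  · rintro (i | j)
    · by_cases h : i = P.o
      · subst h
        rw [split_inl_o]
        linarith
      · simpa [split, h] using hξ.1 i
    · exact hv j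
  · simp [Fintype.sum_sum_type, split, Finset.sum_sub_distrib, hξ.2]

variable [DecidableEq J]

theorem link_ext (ξ : P.ι ⊕ J → ℝ) : (P.ext A).link ξ = P.link (P.merge ξ) := by
  rw [link, link, ← sum_proj_mul]
  refine Finset.sum_congr rfl fun c _ => ?_
  simp [newDiag, newAdj, proj]

theorem poly_ext (ξ : P.ι ⊕ J → ℝ) : (P.ext A).poly ξ = P.poly (P.merge ξ) +
    3 * (ξ (.inl P.o) * A.quad (fun j => ξ (.inr j)) -
      P.link (P.merge ξ) * ∑ j, ξ (.inr j) ^ 2) := by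
  have t12 : ∀ (f : P.ι ⊕ J → P.ι ⊕ J → ℝ) (g : P.ι ⊕ J → ℝ),
      ∑ a, ∑ b, ∑ c, f a b * g c * ξ a * ξ b * ξ c =
        (∑ a, ∑ b, f a b * ξ a * ξ b) * ∑ c, g c * ξ c := by
    intro f g
    simp_rw [Finset.sum_mul, Finset.mul_sum]
    refine Finset.sum_congr rfl fun a _ => Finset.sum_congr rfl fun b _ =>
      Finset.sum_congr rfl fun c _ => ?_
    ring
  have t23 : ∀ (f : P.ι ⊕ J → P.ι ⊕ J → ℝ) (g : P.ι ⊕ J → ℝ),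
      ∑ a, ∑ b, ∑ c, f b c * g a * ξ a * ξ b * ξ c =
        (∑ a, ∑ b, f a b * ξ a * ξ b) * ∑ c, g c * ξ c := by
    intro f g
    rw [mul_comm]
    simp_rw [Finset.sum_mul, Finset.mul_sum]
    refine Finset.sum_congr rfl fun a _ => Finset.sum_congr rfl fun b _ =>
      Finset.sum_congr rfl fun c _ => ?_
    ring
  have t13 : ∀ (f : P.ι ⊕ J → P.ι ⊕ J → ℝ) (g : P.ι ⊕ J → ℝ),
      ∑ a, ∑ b, ∑ c, f a c * g b * ξ a * ξ b * ξ c =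
        (∑ a, ∑ b, f a b * ξ a * ξ b) * ∑ c, g c * ξ c := by
    intro f g
    rw [← t12]
    refine Finset.sum_congr rfl fun a _ => ?_
    rw [Finset.sum_comm]
    refine Finset.sum_congr rfl fun b _ => Finset.sum_congr rfl fun c _ => ?_
    ring
  have h0 : ∑ a, ∑ b, ∑ c, P.e (P.proj a) (P.proj b) (P.proj c) * ξ a * ξ b * ξ c =
      P.poly (P.merge ξ) := by
    have r1 : ∀ a b : P.ι ⊕ J, ∑ c, P.e (P.proj a) (P.proj b) (P.proj c) * ξ a * ξ b * ξ c =
        (∑ k, P.e (P.proj a) (P.proj b) k * P.merge ξ k) * ξ b * ξ a := by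
      intro a b
      rw [← sum_proj_mul, Finset.sum_mul, Finset.sum_mul]
      exact Finset.sum_congr rfl fun c _ => by ring
    simp_rw [r1, ← Finset.sum_mul]
    have r2 : ∀ a : P.ι ⊕ J, ∑ b, (∑ k, P.e (P.proj a) (P.proj b) k * P.merge ξ k) * ξ b =
        ∑ j, (∑ k, P.e (P.proj a) j k * P.merge ξ k) * P.merge ξ j := fun a =>
      sum_proj_mul (fun j => ∑ k, P.e (P.proj a) j k * P.merge ξ k) ξ
    simp_rw [r2]
    rw [sum_proj_mul (fun i => ∑ j, (∑ k, P.e i j k * P.merge ξ k) * P.merge ξ j) ξ, poly]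
    simp_rw [Finset.sum_mul]
    refine Finset.sum_congr rfl fun a _ => Finset.sum_congr rfl fun b _ =>
      Finset.sum_congr rfl fun c _ => ?_
    ring
  have hd : ∑ a, ∑ b, P.newDiag a b * ξ a * ξ b = ∑ j, ξ (.inr j) ^ 2 := by
    simp [Fintype.sum_sum_type, newDiag, sq]
  have ha : ∑ a, ∑ b, P.newAdj A a b * ξ a * ξ b = A.quad fun j => ξ (.inr j) := by
    simp [Fintype.sum_sum_type, newAdj, AdjGraph.quad]
  have ho : ∑ c : P.ι ⊕ J, P.oldPart c * ξ c = ξ (.inl P.o) := by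
    simp [oldPart]
  have hl : ∑ c : P.ι ⊕ J, P.e P.o P.o (P.proj c) * ξ c = P.link (P.merge ξ) :=
    sum_proj_mul (fun i => P.e P.o P.o i) ξ
  have key : (P.ext A).poly ξ =
      ∑ a, ∑ b, ∑ c, P.e (P.proj a) (P.proj b) (P.proj c) * ξ a * ξ b * ξ c -
      ∑ a, ∑ b, ∑ c, P.newDiag a b * P.e P.o P.o (P.proj c) * ξ a * ξ b * ξ c -
      ∑ a, ∑ b, ∑ c, P.newDiag b c * P.e P.o P.o (P.proj a) * ξ a * ξ b * ξ c -
      ∑ a, ∑ b, ∑ c, P.newDiag a c * P.e P.o P.o (P.proj b) * ξ a * ξ b * ξ c +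
      ∑ a, ∑ b, ∑ c, P.newAdj A a b * P.oldPart c * ξ a * ξ b * ξ c +
      ∑ a, ∑ b, ∑ c, P.newAdj A b c * P.oldPart a * ξ a * ξ b * ξ c +
      ∑ a, ∑ b, ∑ c, P.newAdj A a c * P.oldPart b * ξ a * ξ b * ξ c := by
    simp_rw [← Finset.sum_sub_distrib, ← Finset.sum_add_distrib]
    refine Finset.sum_congr rfl fun a _ => Finset.sum_congr rfl fun b _ =>
      Finset.sum_congr rfl fun c _ => ?_
    ring
  rw [key, h0, t12 P.newDiag fun c => P.e P.o P.o (P.proj c),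
    t23 P.newDiag fun c => P.e P.o P.o (P.proj c), t13 P.newDiag fun c => P.e P.o P.o (P.proj c),
    t12, t23, t13, hd, ha, ho, hl]
  ring

theorem poly_ext_split (ξ : P.ι → ℝ) (v : J → ℝ) : (P.ext A).poly (P.split ξ v) = P.poly ξ +
    3 * ((ξ P.o - ∑ j, v j) * A.quad v - P.link ξ * ∑ j, v j ^ 2) := by
  rw [poly_ext, merge_split, split_inl_o]
  rfl

variable (P) in
/-- The invariant maintained along the construction of patterns. -/
structure Good (L D : ℝ) (m : ℕ) : Prop where
  poly_le : ∀ ξ ∈ stdSimplex ℝ P.ι, P.poly ξ ≤ 1 - (1 - P.link ξ) ^ 3 - P.link ξ ^ 3 / L ^ 2 +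
    ((1 - P.link ξ) ^ 3 - ξ P.o ^ 3) / 2
  slack : ∀ ξ ∈ stdSimplex ℝ P.ι, 0 < P.link ξ → P.link ξ / D < 1 - P.link ξ →
    (∀ ζ ∈ stdSimplex ℝ P.ι, P.link ζ = P.link ξ → ξ P.o ≤ ζ P.o → P.poly ζ ≤ P.poly ξ) →
    1 - P.link ξ - P.link ξ / D ≤ 3 ^ m * (ξ P.o - P.link ξ / D)

theorem le_two_mul_of_forall_scale {f g : ℝ} (hg : 0 ≤ g)
    (h : ∀ ε : ℝ, 0 < ε → ε ≤ 1 → (1 - ε) ^ 2 * (f + ε * g) ≤ f) : g ≤ 2 * f := by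
  by_contra! hlt
  have hf : 0 ≤ f := by simpa using h 1 one_pos le_rfl
  have hg' : 0 < g := by linarith
  have hε : 0 < (g - 2 * f) / (4 * g) := div_pos (by linarith) (by linarith)
  have he : (g - 2 * f) / (4 * g) * (4 * g) = g - 2 * f := div_mul_cancel₀ _ (by linarith)
  have hle : (g - 2 * f) / (4 * g) ≤ 1 := by
    rw [div_le_one (by linarith)]
    linarith
  have h1 := h _ hε hle
  set ε := (g - 2 * f) / (4 * g)
  have h2 : (1 - ε) ^ 2 * g ≤ (2 - ε) * f := by
    refine le_of_mul_le_mul_left ?_ hε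
    nlinarith
  nlinarith [mul_nonneg (sq_nonneg ε) hg, mul_nonneg hε.le hf]

theorem Good.ext {L D : ℝ} (hD : 0 < D) {m : ℕ} (hP : P.Good L D m)
    (hA : ∀ i, ∑ j, A.adj i j ≤ D) : (P.ext A).Good L D (m + 1) := by
  refine ⟨fun ξ hξ => ?_, fun ξ hξ hu huD hmax => ?_⟩
  · have h1 := hP.poly_le _ (merge_mem hξ)
    have hv : ∀ j, 0 ≤ ξ (.inr j) := fun j => hξ.1 _
    have ho : 0 ≤ ξ (.inl P.o) := hξ.1 _
    have hτ : 0 ≤ ∑ j, ξ (.inr j) := Finset.sum_nonneg fun j _ => hv j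
    have hX := mul_le_mul_of_nonneg_left (A.quad_le_sq_sum hv) ho
    have hY : 0 ≤ P.link (P.merge ξ) * ∑ j, ξ (.inr j) ^ 2 :=
      mul_nonneg (P.link_nonneg (merge_mem hξ)) (Finset.sum_nonneg fun j _ => sq_nonneg _)
    rw [poly_ext, link_ext]
    rw [merge_o] at h1
    change _ ≤ 1 - (1 - P.link (P.merge ξ)) ^ 3 - P.link (P.merge ξ) ^ 3 / L ^ 2 +
      ((1 - P.link (P.merge ξ)) ^ 3 - ξ (.inl P.o) ^ 3) / 2
    set o := ξ (.inl P.o)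
    set τ := ∑ j, ξ (.inr j)
    have h2 : 6 * (o * τ ^ 2) ≤ (o + τ) ^ 3 - o ^ 3 := by
      nlinarith [mul_nonneg hτ (sq_nonneg (2 * o - τ)), mul_nonneg hτ (sq_nonneg o),
        mul_nonneg hτ (sq_nonneg (o - τ)), mul_nonneg hτ (sq_nonneg (3 * o - 2 * τ))]
    linarith
  · rw [link_ext] at hu huD ⊢
    have hmem := merge_mem hξ
    have hv : ∀ j, 0 ≤ ξ (.inr j) := fun j => hξ.1 _
    have ho : 0 ≤ ξ (.inl P.o) := hξ.1 _
    have hτ : 0 ≤ ∑ j, ξ (.inr j) := Finset.sum_nonneg fun j _ => hv j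
    have hX0 := A.quad_nonneg hv
    have hXY := A.quad_le_mul_sum_sq hA fun j => ξ (.inr j)
    have hmax' : ∀ (ζ : P.ι → ℝ) (v : J → ℝ), ζ ∈ stdSimplex ℝ P.ι → (∀ j, 0 ≤ v j) →
        P.link ζ = P.link (P.merge ξ) → ξ (.inl P.o) ≤ ζ P.o - ∑ j, v j →
        P.poly ζ + 3 * ((ζ P.o - ∑ j, v j) * A.quad v - P.link ζ * ∑ j, v j ^ 2) ≤
        P.poly (P.merge ξ) + 3 * (ξ (.inl P.o) * A.quad (fun j => ξ (.inr j)) -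
          P.link (P.merge ξ) * ∑ j, ξ (.inr j) ^ 2) := by
      intro ζ v hζ hv' hl hle
      rw [← poly_ext, ← poly_ext_split]
      refine hmax _ (split_mem hζ hv' (by linarith)) ?_ ?_
      · rw [link_ext, link_ext, merge_split, hl]
      · change ξ (.inl P.o) ≤ P.split ζ v (.inl P.o)
        rwa [split_inl_o]
    have hslack := hP.slack _ hmem hu huD ?_
    · rw [merge_o] at hslack
      have hscale := le_two_mul_of_forall_scale
        (f := ξ (.inl P.o) * A.quad (fun j => ξ (.inr j)) -
          P.link (P.merge ξ) * ∑ j, ξ (.inr j) ^ 2)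
        (g := (∑ j, ξ (.inr j)) * A.quad (fun j => ξ (.inr j))) (mul_nonneg hτ hX0) ?_
      · change _ ≤ 3 ^ (m + 1) * (ξ (.inl P.o) - _)
        set o := ξ (.inl P.o)
        set τ := ∑ j, ξ (.inr j) with hτdef
        set X := A.quad fun j => ξ (.inr j)
        set Y := ∑ j, ξ (.inr j) ^ 2 with hYdef
        set u := P.link (P.merge ξ)
        have h3 : (0 : ℝ) < 3 ^ m := by positivity
        have hpos : 0 < o + τ - u / D := by
          by_contra! h
          nlinarith
        have key : τ ≤ 2 * (o - u / D) := by
          rcases hX0.eq_or_lt with hX | hX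
          · have hY : Y = 0 := by
              have h4 : 0 ≤ Y := Finset.sum_nonneg fun j _ => sq_nonneg _
              have h5 : u * Y ≤ 0 := by
                rw [← hX] at hscale
                linarith
              nlinarith
            have hτ0 : τ = 0 := by
              refine Finset.sum_eq_zero fun j hj => ?_
              have := (Finset.sum_eq_zero_iff_of_nonneg fun j _ => sq_nonneg _).mp hY j hj
              exact pow_eq_zero_iff two_ne_zero |>.mp this
            rw [hτ0] at hpos ⊢
            linarith
          · have h4 : u / D * X ≤ u * Y := by
              rw [div_mul_eq_mul_div, div_le_iff₀ hD]
              nlinarith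
            have h5 : τ * X ≤ 2 * (o - u / D) * X := by linarith
            exact le_of_mul_le_mul_right h5 hX
        refine hslack.trans ?_
        rw [pow_succ, mul_assoc]
        exact mul_le_mul_of_nonneg_left (by linarith) h3.le
      · intro ε hε hε1
        have hsum : ∑ j, (1 - ε) * ξ (.inr j) = (1 - ε) * ∑ j, ξ (.inr j) :=
          (Finset.mul_sum _ _ _).symm
        have hsq : ∑ j, ((1 - ε) * ξ (.inr j)) ^ 2 = (1 - ε) ^ 2 * ∑ j, ξ (.inr j) ^ 2 := by
          simp_rw [mul_pow, Finset.mul_sum]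
        have := hmax' (P.merge ξ) (fun j => (1 - ε) * ξ (.inr j)) hmem
          (fun j => mul_nonneg (by linarith) (hv j)) rfl (by
            rw [merge_o, hsum]
            nlinarith)
        rw [A.quad_smul, hsum, hsq, merge_o] at this
        linarith
    · intro ζ hζ hl hle
      rw [merge_o] at hle
      have := hmax' ζ (fun j => ξ (.inr j)) hζ hv hl (by linarith)
      rw [hl] at this
      nlinarith

end Pattern

section SparseGraph

open Equiv

variable {κ : Type} [Fintype κ] [DecidableEq κ] {N : ℕ}

theorem card_perm_filter_le (R : κ → Finset (Fin N)) {s : ℕ} (hR : ∀ k, (R k).card ≤ s)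
    (E : Finset (κ × Fin N)) :
    (Finset.univ.filter fun π : κ → Perm (Fin N) => ∀ t ∈ E, π t.1 t.2 ∈ R t.1).card *
      N ^ E.card ≤ Fintype.card (κ → Perm (Fin N)) * s ^ E.card := by
  induction E using Finset.induction_on with
  | empty => simp
  | insert t E ht ih =>
    obtain ⟨k, x⟩ := t
    have key : (Finset.univ.filter fun π : κ → Perm (Fin N) =>
          ∀ t ∈ insert (k, x) E, π t.1 t.2 ∈ R t.1).card * N ≤
        (Finset.univ.filter fun π : κ → Perm (Fin N) => ∀ t ∈ E, π t.1 t.2 ∈ R t.1).card * s := by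
      refine le_trans ?_ (Nat.mul_le_mul_left _ (hR k))
      refine (Nat.mul_le_mul_left _ (Finset.card_fin N).ge).trans ?_
      rw [← Finset.card_product, ← Finset.card_product]
      refine Finset.card_le_card_of_injOn
        (fun p => (Function.update p.1 k (p.1 k * swap x p.2), p.1 k x)) ?_ ?_
      · rintro ⟨π, y⟩ h
        simp only [Finset.coe_product, Set.mem_prod, Finset.mem_coe, Finset.mem_filter,
          Finset.mem_univ, true_and, and_true, Finset.mem_insert, forall_eq_or_imp] at h ⊢
        refine ⟨?_, h.1⟩
        rintro ⟨k', x'⟩ h'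
        by_cases hk : k' = k
        · subst hk
          have hx : x' ≠ x := fun e => ht (e ▸ h')
          simp only [Function.update_self, Perm.mul_apply]
          by_cases hy : x' = y
          · subst hy
            rw [swap_apply_right]
            exact h.1
          · rw [swap_apply_of_ne_of_ne hx hy]
            exact h.2 _ h'
        · simp only [Function.update_of_ne hk]
          exact h.2 _ h'
      · rintro ⟨π, y⟩ - ⟨π', y'⟩ - h
        simp only [Prod.mk.injEq] at h
        obtain ⟨h1, h2⟩ := h
        have h3 : π k * swap x y = π' k * swap x y' := by
          simpa using congrFun h1 k
        have hy : y = y' := by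
          apply (π' k * swap x y').injective
          rw [← h3]
          conv_rhs => rw [h3]
          simpa [Perm.mul_apply] using h2
        subst hy
        rw [Prod.mk.injEq]
        refine ⟨funext fun k' => ?_, rfl⟩
        by_cases hk : k' = k
        · subst hk
          exact mul_right_cancel h3
        · simpa [hk] using congrFun h1 k'
    rw [Finset.card_insert_of_notMem ht, pow_succ, pow_succ]
    calc _ = (Finset.univ.filter fun π : κ → Perm (Fin N) =>
          ∀ t ∈ insert (k, x) E, π t.1 t.2 ∈ R t.1).card * N * N ^ E.card := by ring
      _ ≤ (Finset.univ.filter fun π : κ → Perm (Fin N) =>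
          ∀ t ∈ E, π t.1 t.2 ∈ R t.1).card * s * N ^ E.card := Nat.mul_le_mul_right _ key
      _ = (Finset.univ.filter fun π : κ → Perm (Fin N) =>
          ∀ t ∈ E, π t.1 t.2 ∈ R t.1).card * N ^ E.card * s := by ring
      _ ≤ Fintype.card (κ → Perm (Fin N)) * s ^ E.card * s := Nat.mul_le_mul_right _ ih
      _ = _ := by ring

variable {q : ℕ}

/-- The edges inside `S` of the lift of the complete graph on `Fin q` given by permutations `π`. -/
def liftEdges (π : Fin q × Fin q → Perm (Fin N)) (S : Finset (Fin q × Fin N)) :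
    Finset ((Fin q × Fin q) × Fin N) :=
  Finset.univ.filter fun t => t.1.1 < t.1.2 ∧ (t.1.1, t.2) ∈ S ∧ (t.1.2, π t.1 t.2) ∈ S

theorem card_dense_lift_le (S : Finset (Fin q × Fin N)) :
    (Finset.univ.filter fun π : Fin q × Fin q → Perm (Fin N) =>
        2 * S.card ≤ (liftEdges π S).card).card * N ^ (2 * S.card) ≤
      2 ^ (q * S.card) *
        (Fintype.card (Fin q × Fin q → Perm (Fin N)) * S.card ^ (2 * S.card)) := by
  let U : Finset ((Fin q × Fin q) × Fin N) := Finset.univ.filter fun t => (t.1.1, t.2) ∈ S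
  let R : Fin q × Fin q → Finset (Fin N) := fun k => Finset.univ.filter fun y => (k.2, y) ∈ S
  have hR : ∀ k, (R k).card ≤ S.card := fun k =>
    Finset.card_le_card_of_injOn (fun y => (k.2, y)) (by intro y; simp [R]) (by
      intro y _ y' _ h
      simpa using h)
  have hU : U.card ≤ q * S.card := by
    refine le_trans ?_ (Nat.mul_le_mul_right _ (Finset.card_fin q).le)
    rw [← Finset.card_product]
    refine Finset.card_le_card_of_injOn (fun t => (t.1.2, (t.1.1, t.2))) ?_ ?_
    · intro t
      simp [U]
    · rintro ⟨⟨a, b⟩, x⟩ _ ⟨⟨a', b'⟩, x'⟩ _ h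
      simp only [Prod.mk.injEq] at h ⊢
      tauto
  have hsub : (Finset.univ.filter fun π : Fin q × Fin q → Perm (Fin N) =>
      2 * S.card ≤ (liftEdges π S).card) ⊆ (U.powersetCard (2 * S.card)).biUnion fun E =>
        Finset.univ.filter fun π : Fin q × Fin q → Perm (Fin N) =>
          ∀ t ∈ E, π t.1 t.2 ∈ R t.1 := by
    intro π hπ
    obtain ⟨E, hE, hc⟩ := Finset.exists_subset_card_eq (Finset.mem_filter.mp hπ).2
    have hE' : ∀ t ∈ E, t ∈ U ∧ π t.1 t.2 ∈ R t.1 := by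
      intro t ht
      have := (Finset.mem_filter.mp (hE ht)).2
      simp [U, R, this]
    rw [Finset.mem_biUnion]
    exact ⟨E, Finset.mem_powersetCard.mpr ⟨fun t ht => (hE' t ht).1, hc⟩,
      Finset.mem_filter.mpr ⟨Finset.mem_univ _, fun t ht => (hE' t ht).2⟩⟩
  calc _ ≤ (∑ E ∈ U.powersetCard (2 * S.card),
        (Finset.univ.filter fun π : Fin q × Fin q → Perm (Fin N) =>
          ∀ t ∈ E, π t.1 t.2 ∈ R t.1).card) * N ^ (2 * S.card) :=
        Nat.mul_le_mul_right _ ((Finset.card_le_card hsub).trans Finset.card_biUnion_le)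
    _ ≤ ∑ E ∈ U.powersetCard (2 * S.card),
        Fintype.card (Fin q × Fin q → Perm (Fin N)) * S.card ^ (2 * S.card) := by
        rw [Finset.sum_mul]
        refine Finset.sum_le_sum fun E hE => ?_
        have := card_perm_filter_le R hR E
        rwa [(Finset.mem_powersetCard.mp hE).2] at this
    _ ≤ _ := by
        rw [Finset.sum_const, smul_eq_mul]
        refine Nat.mul_le_mul_right _ ?_
        refine (Finset.card_le_card fun E hE => Finset.mem_powerset.mpr
          (Finset.mem_powersetCard.mp hE).1).trans ?_
        rw [Finset.card_powerset]
        exact Nat.pow_le_pow_right (by norm_num) hU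

theorem choose_mul_pow_le {s : ℕ} (hN : 0 < N) (hs : 12 * q * 2 ^ q * s ≤ N) :
    ((q * N).choose s : ℝ) * (2 ^ q * (s : ℝ) ^ 2 / (N : ℝ) ^ 2) ^ s ≤ (1 / 4) ^ s := by
  have hN' : (0 : ℝ) < N := by exact_mod_cast hN
  have hs' : 12 * (q : ℝ) * 2 ^ q * s ≤ N := by exact_mod_cast hs
  have h1 : ((q * N).choose s : ℝ) ≤ ((q : ℝ) * N) ^ s / s.factorial := by
    simpa using Nat.choose_le_pow_div (α := ℝ) s (q * N)
  have h2 : (s : ℝ) ^ s / s.factorial ≤ 3 ^ s := by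
    refine (Real.pow_div_factorial_le_exp _ (by positivity) s).trans ?_
    rw [← Real.exp_one_rpow, Real.rpow_natCast]
    exact pow_le_pow_left₀ (Real.exp_pos 1).le (Real.exp_one_lt_d9.le.trans (by norm_num)) s
  calc _ ≤ ((q : ℝ) * N) ^ s / s.factorial * (2 ^ q * (s : ℝ) ^ 2 / (N : ℝ) ^ 2) ^ s :=
        mul_le_mul_of_nonneg_right h1 (by positivity)
    _ = (s : ℝ) ^ s / s.factorial * (q * 2 ^ q * s / N) ^ s := by
        rw [div_mul_eq_mul_div, div_mul_eq_mul_div, ← mul_pow, ← mul_pow]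
        congr 2
        field_simp
    _ ≤ 3 ^ s * (q * 2 ^ q * s / N) ^ s := mul_le_mul_of_nonneg_right h2 (by positivity)
    _ = (3 * (q * 2 ^ q * s / N)) ^ s := (mul_pow _ _ _).symm
    _ ≤ (1 / 4) ^ s := by
        refine pow_le_pow_left₀ (by positivity) ?_ s
        rw [← mul_div_assoc, div_le_iff₀ hN']
        linarith

theorem exists_sparse_lift (hN : 0 < N) :
    ∃ π : Fin q × Fin q → Perm (Fin N), ∀ S : Finset (Fin q × Fin N), S.Nonempty →
      12 * q * 2 ^ q * S.card ≤ N → (liftEdges π S).card < 2 * S.card := by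
  by_contra! hcon
  let f : ℕ → ℝ := fun s => if 1 ≤ s ∧ 12 * q * 2 ^ q * s ≤ N then
    (2 ^ q * (s : ℝ) ^ 2 / (N : ℝ) ^ 2) ^ s else 0
  obtain ⟨T, hTdef⟩ : ∃ T : ℝ, T = Fintype.card (Fin q × Fin q → Perm (Fin N)) := ⟨_, rfl⟩
  have hT : 0 < T := by
    rw [hTdef, Nat.cast_pos]
    exact Fintype.card_pos
  have hN' : (0 : ℝ) < N := by exact_mod_cast hN
  have h1 : T ≤ ∑ S ∈ (Finset.univ : Finset (Fin q × Fin N)).powerset, f S.card * T := by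
    have hcov : (Finset.univ : Finset (Fin q × Fin q → Perm (Fin N))) ⊆
        ((Finset.univ : Finset (Fin q × Fin N)).powerset.filter fun S =>
          1 ≤ S.card ∧ 12 * q * 2 ^ q * S.card ≤ N).biUnion fun S =>
          Finset.univ.filter fun π => 2 * S.card ≤ (liftEdges π S).card := by
      intro π _
      obtain ⟨S, hS, hS1, hS2⟩ := hcon π
      rw [Finset.mem_biUnion]
      exact ⟨S, by simp [hS1, Nat.one_le_iff_ne_zero, hS.ne_empty], by simp [hS2]⟩
    have h2 := (Finset.card_le_card hcov).trans Finset.card_biUnion_le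
    calc T ≤ ∑ S ∈ (Finset.univ : Finset (Fin q × Fin N)).powerset.filter fun S =>
          1 ≤ S.card ∧ 12 * q * 2 ^ q * S.card ≤ N,
          ((Finset.univ.filter fun π : Fin q × Fin q → Perm (Fin N) =>
            2 * S.card ≤ (liftEdges π S).card).card : ℝ) := by
          rw [Finset.card_univ] at h2
          rw [hTdef]
          exact_mod_cast h2
      _ ≤ ∑ S ∈ (Finset.univ : Finset (Fin q × Fin N)).powerset.filter fun S =>
          1 ≤ S.card ∧ 12 * q * 2 ^ q * S.card ≤ N, f S.card * T := by
          refine Finset.sum_le_sum fun S hS => ?_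
          have h3 : ((Finset.univ.filter fun π : Fin q × Fin q → Perm (Fin N) =>
              2 * S.card ≤ (liftEdges π S).card).card : ℝ) * (N : ℝ) ^ (2 * S.card) ≤
              2 ^ (q * S.card) * (T * (S.card : ℝ) ^ (2 * S.card)) := by
            rw [hTdef]
            exact_mod_cast card_dense_lift_le S
          simp only [f, if_pos (Finset.mem_filter.mp hS).2]
          rw [div_pow, div_mul_eq_mul_div, le_div_iff₀ (by positivity), mul_pow, ← pow_mul,
            ← pow_mul, ← pow_mul]
          linarith
      _ ≤ _ := by
          refine Finset.sum_le_sum_of_subset_of_nonneg (Finset.filter_subset _ _) ?_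
          intro S _ _
          refine mul_nonneg ?_ hT.le
          simp only [f]
          split_ifs <;> positivity
  rw [← Finset.sum_mul, Finset.sum_powerset_apply_card, Finset.sum_range_succ'] at h1
  have h2 : ∀ m, (Finset.univ : Finset (Fin q × Fin N)).card.choose (m + 1) • f (m + 1) ≤
      (1 / 4 : ℝ) ^ (m + 1) := by
    intro m
    simp only [f]
    split_ifs with h
    · simpa using choose_mul_pow_le (q := q) hN h.2
    · rw [smul_zero]
      positivity
  have h3 : ∀ M : ℕ, ∑ m ∈ Finset.range M, (1 / 4 : ℝ) ^ (m + 1) = (1 - (1 / 4) ^ M) / 3 := by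
    intro M
    induction M with
    | zero => simp
    | succ M ih =>
      rw [Finset.sum_range_succ, ih]
      ring
  have h4 := Finset.sum_le_sum fun m (_ : m ∈ Finset.range
    (Finset.univ : Finset (Fin q × Fin N)).card) => h2 m
  rw [h3] at h4
  have h5 : (0 : ℝ) < (1 / 4) ^ (Finset.univ : Finset (Fin q × Fin N)).card := by positivity
  have h6 : (Finset.univ : Finset (Fin q × Fin N)).card.choose 0 • f 0 = 0 := by simp [f]
  rw [h6, add_zero] at h1
  nlinarith

theorem quadratic_le_of_sparse {V : Type} [Fintype V] [DecidableEq V] {A : V → V → ℝ}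
    (h0 : ∀ i j, 0 ≤ A i j) (hsymm : ∀ i j, A i j = A j i) (hdiag : ∀ i, A i i = 0)
    {c : ℝ} (hc : 0 < c) (z : V → ℝ) (S : Finset V)
    (hS : ∀ S' ⊆ S, S'.Nonempty → ∑ i ∈ S', ∑ j ∈ S', A i j < 4 * S'.card) :
    ∑ i ∈ S, ∑ j ∈ S, A i j * z i * z j ≤
      4 * c * ∑ i ∈ S, z i ^ 2 + 1 / c * ∑ j ∈ S, (∑ i ∈ S, A i j) * z j ^ 2 := by
  induction S using Finset.strongInduction with
  | H S ih =>
    rcases S.eq_empty_or_nonempty with rfl | hne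
    · simp
    obtain ⟨x, hx, hx4⟩ : ∃ x ∈ S, ∑ j ∈ S, A x j < 4 := by
      by_contra! hcon
      have := Finset.card_nsmul_le_sum S _ 4 hcon
      have h2 := hS S subset_rfl hne
      rw [nsmul_eq_mul] at this
      linarith
    have ih' := ih (S.erase x) (Finset.erase_ssubset hx)
      fun S' h' => hS S' (h'.trans (Finset.erase_subset x S))
    have hS' : ∀ g : V → ℝ, ∑ i ∈ S, g i = ∑ i ∈ S.erase x, g i + g x := fun g =>
      (Finset.sum_erase_add S g hx).symm
    have e1 : ∑ i ∈ S, ∑ j ∈ S, A i j * z i * z j =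
        ∑ i ∈ S.erase x, ∑ j ∈ S.erase x, A i j * z i * z j +
          2 * ∑ j ∈ S.erase x, A x j * z x * z j := by
      rw [hS']
      simp_rw [hS']
      rw [Finset.sum_add_distrib, hdiag, two_mul]
      have : ∑ i ∈ S.erase x, A i x * z i * z x = ∑ j ∈ S.erase x, A x j * z x * z j :=
        Finset.sum_congr rfl fun i _ => by rw [hsymm]; ring
      rw [this]
      ring
    have e2 : ∑ j ∈ S.erase x, (∑ i ∈ S.erase x, A i j) * z j ^ 2 +
        ∑ j ∈ S.erase x, A x j * z j ^ 2 ≤ ∑ j ∈ S, (∑ i ∈ S, A i j) * z j ^ 2 := by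
      rw [hS' fun j => (∑ i ∈ S, A i j) * z j ^ 2]
      simp_rw [hS' fun i => A i _]
      rw [← Finset.sum_add_distrib]
      have : 0 ≤ (∑ i ∈ S.erase x, A i x + A x x) * z x ^ 2 :=
        mul_nonneg (add_nonneg (Finset.sum_nonneg fun i _ => h0 i x) (h0 x x)) (sq_nonneg _)
      simp_rw [add_mul] at this ⊢
      linarith
    have e3 : 2 * ∑ j ∈ S.erase x, A x j * z x * z j ≤
        4 * c * z x ^ 2 + 1 / c * ∑ j ∈ S.erase x, A x j * z j ^ 2 := by
      have : ∀ j ∈ S.erase x, 2 * (A x j * z x * z j) ≤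
          A x j * (c * z x ^ 2) + 1 / c * (A x j * z j ^ 2) := by
        intro j _
        have h1 : 0 ≤ 1 / c * (c * z x - z j) ^ 2 := by positivity
        have h2 : 1 / c * (c * z x - z j) ^ 2 =
            c * z x ^ 2 + 1 / c * z j ^ 2 - 2 * (z x * z j) := by
          field_simp
          ring
        have := mul_nonneg (h0 x j) (h2 ▸ h1)
        linarith
      have h1 := Finset.sum_le_sum this
      rw [← Finset.mul_sum, Finset.sum_add_distrib, ← Finset.sum_mul, ← Finset.mul_sum] at h1
      have h2 : ∑ j ∈ S.erase x, A x j ≤ 4 := by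
        have := hS' (A x)
        rw [hdiag] at this
        linarith
      have h3 := mul_le_mul_of_nonneg_right h2 (by positivity : 0 ≤ c * z x ^ 2)
      linarith
    have e4 := mul_le_mul_of_nonneg_left e2 (by positivity : 0 ≤ 1 / c)
    rw [e1, hS' fun i => z i ^ 2]
    linarith

/-- Regular graphs whose quadratic form is controlled, up to an error which is small for large
graphs, by a multiple of order square root of the degree. -/
theorem exists_regular_graph_quadratic_le {c : ℝ} (hc : 1 ≤ c) {D : ℕ} (hD : (D : ℝ) = 4 * c ^ 2) :
    ∃ C : ℝ, 1 ≤ C ∧ ∀ N : ℕ, 0 < N →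
      ∃ A : Fin (D + 1) × Fin N → Fin (D + 1) × Fin N → ℝ,
        (∀ i j, A i j = 0 ∨ A i j = 1) ∧ (∀ i j, A i j = A j i) ∧ (∀ i, A i i = 0) ∧
        (∀ i, ∑ j, A i j = D) ∧
        ∀ z : Fin (D + 1) × Fin N → ℝ, (∀ i, 0 ≤ z i) →
          ∑ i, ∑ j, A i j * z i * z j ≤ 8 * c * ∑ i, z i ^ 2 + C / N * (∑ i, z i) ^ 2 := by
  set q := D + 1 with hq
  set K : ℕ := 12 * q * 2 ^ q with hK
  have hK1 : 1 ≤ K := Nat.one_le_iff_ne_zero.mpr (by positivity)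
  have hK1' : (1 : ℝ) ≤ K := by exact_mod_cast hK1
  have hD1 : (1 : ℝ) ≤ D := by nlinarith
  refine ⟨2 * K * D, by nlinarith, fun N hN => ?_⟩
  have hN' : (0 : ℝ) < N := by exact_mod_cast hN
  obtain ⟨π, hπ⟩ := exists_sparse_lift (q := q) hN
  let B : Fin q × Fin N → Fin q × Fin N → ℝ := fun i j =>
    if i.1 < j.1 ∧ π (i.1, j.1) i.2 = j.2 then 1 else 0
  let A : Fin q × Fin N → Fin q × Fin N → ℝ := fun i j => B i j + B j i
  have hB0 : ∀ i j, 0 ≤ B i j := by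
    intro i j
    simp only [B]
    split_ifs <;> norm_num
  have hA01 : ∀ i j, A i j = 0 ∨ A i j = 1 := by
    intro i j
    by_cases h : i.1 < j.1
    · have : B j i = 0 := if_neg fun h' => lt_asymm h h'.1
      simp only [A, this, add_zero, B]
      split_ifs <;> simp
    · have : B i j = 0 := if_neg fun h' => h h'.1
      simp only [A, this, zero_add, B]
      split_ifs <;> simp
  have hA0 : ∀ i j, 0 ≤ A i j := fun i j => add_nonneg (hB0 i j) (hB0 j i)
  have hsymm : ∀ i j, A i j = A j i := fun i j => add_comm _ _
  have hdiag : ∀ i, A i i = 0 := by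
    intro i
    simp [A, B]
  have hdeg : ∀ i, ∑ j, A i j = D := by
    rintro ⟨a, x⟩
    have h1 : ∀ b, ∑ y, A (a, x) (b, y) = if b = a then 0 else 1 := by
      intro b
      simp only [A, B, Finset.sum_add_distrib]
      rcases lt_trichotomy a b with h | rfl | h
      · simp [h, h.ne', lt_asymm h]
      · simp
      · simp [h, h.ne, lt_asymm h, ← Equiv.eq_symm_apply]
    rw [Fintype.sum_prod_type]
    simp only [h1]
    have : ∀ b : Fin q, (if b = a then (0 : ℝ) else 1) = 1 - if b = a then 1 else 0 := by
      intro b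
      split_ifs <;> simp
    simp_rw [this]
    rw [Finset.sum_sub_distrib, Finset.sum_ite_eq']
    simp [hq]
  refine ⟨A, hA01, hsymm, hdiag, hdeg, fun z hz => ?_⟩
  have hsparse : ∀ S : Finset (Fin q × Fin N), S.Nonempty → K * S.card ≤ N →
      ∑ i ∈ S, ∑ j ∈ S, A i j < 4 * S.card := by
    intro S hS hSK
    have h1 : ∑ i ∈ S, ∑ j ∈ S, B i j = (liftEdges π S).card := by
      have e1 : (S ×ˢ S).filter (fun p => p.1.1 < p.2.1 ∧ π (p.1.1, p.2.1) p.1.2 = p.2.2) =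
          (liftEdges π S).image fun t => ((t.1.1, t.2), (t.1.2, π t.1 t.2)) := by
        ext ⟨⟨a, x⟩, ⟨b, y⟩⟩
        simp only [liftEdges, Finset.mem_filter, Finset.mem_product, Finset.mem_image,
          Finset.mem_univ, true_and, Prod.mk.injEq, Prod.exists]
        constructor
        · rintro ⟨⟨h1, h2⟩, h3, rfl⟩
          exact ⟨a, b, x, ⟨h3, h1, h2⟩, ⟨rfl, rfl⟩, rfl, rfl⟩
        · rintro ⟨a', b', x', ⟨h3, h1, h2⟩, ⟨rfl, rfl⟩, rfl, rfl⟩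
          exact ⟨⟨h1, h2⟩, h3, rfl⟩
      rw [← Finset.sum_product' S S B]
      simp only [B]
      rw [Finset.sum_boole, e1, Finset.card_image_of_injective]
      rintro ⟨⟨a, b⟩, x⟩ ⟨⟨a', b'⟩, x'⟩ h
      simp only [Prod.mk.injEq] at h ⊢
      tauto
    have h2 : ∑ i ∈ S, ∑ j ∈ S, B j i = (liftEdges π S).card := by rw [Finset.sum_comm, h1]
    have h3 : ((liftEdges π S).card : ℝ) < 2 * S.card := by exact_mod_cast hπ S hS hSK
    simp only [A, Finset.sum_add_distrib]
    rw [h1, h2]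
    linarith
  set τ := ∑ i, z i with hτ
  have hτ0 : 0 ≤ τ := Finset.sum_nonneg fun i _ => hz i
  let S : Finset (Fin q × Fin N) := Finset.univ.filter fun i => K * τ / N < z i
  have hSK : K * S.card ≤ N := by
    rcases S.eq_empty_or_nonempty with he | ⟨i, hi⟩
    · simp [he]
    have hτpos : 0 < τ := by
      have h1 : K * τ / N < z i := (Finset.mem_filter.mp hi).2
      have h2 : (0 : ℝ) ≤ K * τ / N := by positivity
      exact (h2.trans_lt h1).trans_le (Finset.single_le_sum (fun i _ => hz i) (Finset.mem_univ i))
    have h1 : S.card • (K * τ / N) ≤ ∑ i ∈ S, z i :=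
      Finset.card_nsmul_le_sum _ _ _ fun i hi => (Finset.mem_filter.mp hi).2.le
    have h2 : ∑ i ∈ S, z i ≤ τ :=
      Finset.sum_le_sum_of_subset_of_nonneg (Finset.subset_univ S) fun i _ _ => hz i
    have h3 := h1.trans h2
    rw [nsmul_eq_mul, ← mul_div_assoc, div_le_iff₀ hN'] at h3
    have h4 : (K : ℝ) * S.card ≤ N := by
      by_contra! h
      nlinarith
    exact_mod_cast h4
  have hheavy := quadratic_le_of_sparse hA0 hsymm hdiag (by linarith : 0 < c) z S
    fun S' h' hne => hsparse S' hne ((Nat.mul_le_mul_left K (Finset.card_le_card h')).trans hSK)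
  have hsq : ∑ i ∈ S, z i ^ 2 ≤ ∑ i, z i ^ 2 :=
    Finset.sum_le_sum_of_subset_of_nonneg (Finset.subset_univ S) fun i _ _ => sq_nonneg _
  have hdegS : ∑ j ∈ S, (∑ i ∈ S, A i j) * z j ^ 2 ≤ D * ∑ i, z i ^ 2 := by
    refine le_trans ?_ (mul_le_mul_of_nonneg_left hsq (by positivity))
    rw [Finset.mul_sum]
    refine Finset.sum_le_sum fun j _ => mul_le_mul_of_nonneg_right ?_ (sq_nonneg _)
    rw [← hdeg j]
    simp_rw [hsymm j]
    exact Finset.sum_le_sum_of_subset_of_nonneg (Finset.subset_univ S) fun i _ _ => hA0 i j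
  have hlight : ∑ i, ∑ j, A i j * z i * z j ≤ ∑ i ∈ S, ∑ j ∈ S, A i j * z i * z j +
      2 * (K * τ / N * (D * τ)) := by
    have h1 : ∀ i j, A i j * z i * z j ≤
        (if i ∈ S then (if j ∈ S then A i j * z i * z j else 0) else 0) +
          (K * τ / N * (A i j * z i) + K * τ / N * (A j i * z j)) := by
      intro i j
      have ht : (0 : ℝ) ≤ K * τ / N := by positivity
      have hi := mul_nonneg ht (mul_nonneg (hA0 i j) (hz i))
      have hj := mul_nonneg ht (mul_nonneg (hA0 j i) (hz j))
      by_cases hjS : j ∈ S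
      · by_cases hiS : i ∈ S
        · rw [if_pos hiS, if_pos hjS]
          linarith
        · have h2 : z i ≤ K * τ / N := by simpa [S] using hiS
          rw [if_neg hiS]
          have := mul_le_mul_of_nonneg_left h2 (mul_nonneg (hA0 j i) (hz j))
          rw [hsymm i j] at hi ⊢
          linarith
      · have h2 : z j ≤ K * τ / N := by simpa [S] using hjS
        have := mul_le_mul_of_nonneg_left h2 (mul_nonneg (hA0 i j) (hz i))
        rw [if_neg hjS, ite_self]
        linarith
    have h2 : ∑ i, ∑ j, A i j * z i = D * τ := by
      simp_rw [← Finset.sum_mul, hdeg, ← Finset.mul_sum, hτ]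
    have h3 : ∑ i, ∑ j, A j i * z j = D * τ := by rw [Finset.sum_comm, h2]
    refine (Finset.sum_le_sum fun i _ => Finset.sum_le_sum fun j _ => h1 i j).trans (le_of_eq ?_)
    simp_rw [Finset.sum_add_distrib, ← Finset.mul_sum]
    rw [h2, h3, two_mul]
    congr 1
    simp [Finset.sum_ite_mem]
  have h1 : 1 / c * ∑ j ∈ S, (∑ i ∈ S, A i j) * z j ^ 2 ≤ 4 * c * ∑ i, z i ^ 2 := by
    refine (mul_le_mul_of_nonneg_left hdegS (by positivity)).trans (le_of_eq ?_)
    rw [hD]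
    field_simp
  have h2 : 4 * c * ∑ i ∈ S, z i ^ 2 ≤ 4 * c * ∑ i, z i ^ 2 :=
    mul_le_mul_of_nonneg_left hsq (by linarith)
  have h3 : 2 * (K * τ / N * (D * τ)) = 2 * K * D / N * τ ^ 2 := by ring
  linarith

end SparseGraph

namespace Pattern

/-- All triples on `Fin (L + 1)` with repetitions allowed, except the constant ones. -/
abbrev base (L : ℕ) : Pattern where
  ι := Fin (L + 1)
  e a b c := if a = b ∧ b = c then 0 else 1
  zero_or_one a b c := by split_ifs <;> simp
  swap_left a b c := by grind
  swap_right a b c := by grind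
  o := 0
  e_o := by simp

theorem poly_base {L : ℕ} {ξ : Fin (L + 1) → ℝ} (hξ : ξ ∈ stdSimplex ℝ (Fin (L + 1))) :
    (base L).poly ξ = 1 - ∑ i, ξ i ^ 3 := by
  have h1 : (base L).poly ξ = ∑ a, ∑ b, ∑ c, (ξ a * ξ b * ξ c -
      if a = b then (if b = c then ξ a * ξ b * ξ c else 0) else 0) := by
    refine Finset.sum_congr rfl fun a _ => Finset.sum_congr rfl fun b _ =>
      Finset.sum_congr rfl fun c _ => ?_
    split_ifs <;> grind
  rw [h1]
  simp only [Finset.sum_sub_distrib, ← Finset.mul_sum, hξ.2, mul_one]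
  congr 1
  refine Finset.sum_congr rfl fun a _ => ?_
  rw [Finset.sum_eq_single a (by intro b _ hb; simp [hb.symm]) (by simp)]
  simp only [if_true, Finset.sum_ite_eq, Finset.mem_univ]
  ring

theorem link_base {L : ℕ} (ξ : Fin (L + 1) → ℝ) :
    (base L).link ξ = ∑ i : Fin L, ξ i.succ := by
  have h : (base L).link ξ = ∑ c : Fin (L + 1), (if (0 : Fin (L + 1)) = c then 0 else 1) * ξ c := by
    refine Finset.sum_congr rfl fun c _ => ?_
    simp
  rw [h, Fin.sum_univ_succ]
  simp [(Fin.succ_ne_zero _).symm]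

theorem good_base {L : ℕ} (D : ℝ) : (base L).Good L D 0 := by
  have hlink : ∀ ξ ∈ stdSimplex ℝ (Fin (L + 1)), 1 - (base L).link ξ = ξ 0 := by
    intro ξ hξ
    rw [link_base, ← hξ.2, Fin.sum_univ_succ]
    ring
  refine ⟨fun ξ hξ => ?_, fun ξ hξ _ _ _ => ?_⟩
  · rw [hlink ξ hξ, poly_base hξ, link_base, Fin.sum_univ_succ]
    have h1 : (∑ i : Fin L, ξ i.succ) ^ 3 / (L : ℝ) ^ 2 ≤ ∑ i : Fin L, ξ i.succ ^ 3 := by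
      simpa using pow_sum_div_card_le_sum_pow (s := (Finset.univ : Finset (Fin L)))
        (f := fun i => ξ i.succ) (fun i _ => hξ.1 _) 2
    change _ ≤ 1 - ξ 0 ^ 3 - (∑ i : Fin L, ξ i.succ) ^ 3 / (L : ℝ) ^ 2 +
      (ξ 0 ^ 3 - ξ 0 ^ 3) / 2
    linarith
  · rw [hlink ξ hξ, pow_zero, one_mul]

theorem poly_base_le {L : ℕ} {ξ : Fin (L + 1) → ℝ} (hξ : ξ ∈ stdSimplex ℝ (Fin (L + 1))) :
    (base L).poly ξ ≤ 1 - 1 / ((L : ℝ) + 1) ^ 2 := by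
  have h1 : (∑ i, ξ i) ^ 3 / ((L + 1 : ℕ) : ℝ) ^ 2 ≤ ∑ i, ξ i ^ 3 := by
    simpa using pow_sum_div_card_le_sum_pow (s := (Finset.univ : Finset (Fin (L + 1))))
      (f := ξ) (fun i _ => hξ.1 _) 2
  rw [hξ.2, one_pow] at h1
  rw [poly_base hξ]
  push_cast at h1
  linarith

end Pattern

namespace AdjGraph

variable {J : Type} [DecidableEq J] (A : AdjGraph J)

/-- Delete all edges of a graph which are not contained in `S`. -/
def restrict (S : Finset J) : AdjGraph J where
  adj i j := if i ∈ S ∧ j ∈ S then A.adj i j else 0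
  zero_or_one i j := by
    split_ifs
    · exact A.zero_or_one i j
    · exact Or.inl rfl
  symm i j := by simp_rw [A.symm i j, and_comm]
  irrefl i := by simp [A.irrefl]

theorem restrict_adj (S : Finset J) (i j : J) :
    (A.restrict S).adj i j = if i ∈ S ∧ j ∈ S then A.adj i j else 0 := rfl

variable [Fintype J]

theorem restrict_sum_le {D : ℝ} (hD : ∀ i, ∑ j, A.adj i j = D) (S : Finset J) (i : J) :
    ∑ j, (A.restrict S).adj i j ≤ D := by
  rw [← hD i]
  refine Finset.sum_le_sum fun j _ => ?_
  rw [restrict_adj]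
  split_ifs
  · exact le_rfl
  · exact A.nonneg i j

theorem quad_restrict (S : Finset J) (v : J → ℝ) :
    (A.restrict S).quad v = A.quad fun j => if j ∈ S then v j else 0 := by
  refine Finset.sum_congr rfl fun i _ => Finset.sum_congr rfl fun j _ => ?_
  rw [restrict_adj]
  by_cases hi : i ∈ S <;> by_cases hj : j ∈ S <;> simp [hi, hj]

theorem quad_eq_sum_restrict (S : Finset J) (v : J → ℝ) :
    (A.restrict S).quad v = ∑ i ∈ S, v i * ∑ j, (A.restrict S).adj i j * v j := by
  rw [quad, ← Finset.sum_subset (Finset.subset_univ S)]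
  · refine Finset.sum_congr rfl fun i _ => ?_
    rw [Finset.mul_sum]
    exact Finset.sum_congr rfl fun j _ => by ring
  · intro i _ hi
    simp [restrict_adj, hi]

theorem quad_restrict_erase (S : Finset J) (k : J) (v : J → ℝ) :
    (A.restrict (S.erase k)).quad v =
      (A.restrict S).quad v - 2 * (v k * ∑ j, (A.restrict S).adj k j * v j) := by
  have h : ∀ i j, (A.restrict (S.erase k)).adj i j * v i * v j =
      (A.restrict S).adj i j * v i * v j - (if i = k then (A.restrict S).adj k j * v k * v j else 0)
        - (if j = k then (A.restrict S).adj k i * v k * v i else 0) := by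
    intro i j
    have h1 := A.irrefl k
    have h2 := A.symm i k
    simp only [restrict_adj, Finset.mem_erase]
    by_cases hi : i = k <;> by_cases hj : j = k
    · subst hi hj
      simp [h1]
    · subst hi
      simp [hj]
    · subst hj
      simp [hi, h2, and_comm]
      split_ifs <;> ring
    · simp [hi, hj]
  simp_rw [quad, h, Finset.sum_sub_distrib]
  simp only [Finset.sum_ite_eq', Finset.mem_univ, if_true]
  have e : ∑ i, ∑ j, (if i = k then (A.restrict S).adj k j * v k * v j else 0) =
      ∑ j, (A.restrict S).adj k j * v k * v j := by
    rw [Finset.sum_comm]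
    simp
  have e2 : v k * ∑ j, (A.restrict S).adj k j * v j =
      ∑ j, (A.restrict S).adj k j * v k * v j := by
    rw [Finset.mul_sum]
    exact Finset.sum_congr rfl fun j _ => by ring
  rw [e, e2]
  ring

end AdjGraph

namespace Pattern

theorem bound_le_of_large_part {o u : ℝ} (hu : 0 ≤ u) (hou : o + u ≤ 1) (h : u < 1600 * o) :
    1 - (1 - u) ^ 3 - u ^ 3 / 8000 ^ 2 + ((1 - u) ^ 3 - o ^ 3) / 2 ≤ 1 - 1 / 8001 ^ 2 := by
  have ho : 0 < o := by linarith
  have ho3 : 0 < o ^ 3 := by positivity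
  have hu3 : 0 ≤ u ^ 3 := by positivity
  obtain ⟨w, rfl⟩ : ∃ w, u = 1 - w := ⟨1 - u, by ring⟩
  rw [sub_sub_cancel]
  by_cases hw : 1 / 2 ≤ w
  · have : (1 / 2 : ℝ) ^ 3 ≤ w ^ 3 := pow_le_pow_left₀ (by norm_num) hw 3
    linarith
  · have hw1 : 1 / 3200 < w := by linarith
    have hw2 : w / 3200 ^ 2 ≤ w ^ 3 := by
      have : (1 / 3200 : ℝ) ^ 2 ≤ w ^ 2 := pow_le_pow_left₀ (by norm_num) hw1.le 2
      nlinarith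
    have hw3 : 1 - 3 * w ≤ (1 - w) ^ 3 := by
      push Not at hw
      nlinarith [mul_nonneg (sq_nonneg w) (by linarith : 0 ≤ 3 - w)]
    linarith

theorem lt_of_bound_le {o u : ℝ} (ho : 0 ≤ o) (hou : o + u ≤ 1)
    (h : 1 - 1 / 8001 ^ 2 ≤
      1 - (1 - u) ^ 3 - u ^ 3 / 8000 ^ 2 + ((1 - u) ^ 3 - o ^ 3) / 2) :
    1 / 32004 ≤ 1 - u - u / 40000 := by
  have ho3 : 0 ≤ o ^ 3 := by positivity
  have hw3 : 0 ≤ (1 - u) ^ 3 := pow_nonneg (by linarith) 3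
  have hu : u ≤ 1 - 1 / 16002 := by
    by_contra! hlt
    have : (1 - 1 / 16002 : ℝ) ^ 3 < u ^ 3 := pow_lt_pow_left₀ hlt (by norm_num) (by norm_num)
    linarith
  linarith

theorem exists_gain {J : Type} [Fintype J] [DecidableEq J] [Nonempty J] (P : Pattern)
    (A : AdjGraph J) {D β x : ℝ} (hD : 0 < D) (hA : ∀ i, ∑ j, A.adj i j = D) (hβ : 0 < β)
    {ξ : P.ι → ℝ} (hξ : ξ ∈ stdSimplex ℝ P.ι) (hsl : β ≤ ξ P.o - P.link ξ / D)
    (hx : x < P.poly ξ + 3 * D * β ^ 3 / (8 * Fintype.card J)) :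
    ∃ ζ ∈ stdSimplex ℝ (P.ι ⊕ J), x < (P.ext A).poly ζ := by
  have hu := P.link_nonneg hξ
  have huD : 0 ≤ P.link ξ / D := by positivity
  obtain ⟨n, hn⟩ : ∃ n : ℝ, n = Fintype.card J := ⟨_, rfl⟩
  rw [← hn] at hx
  have hn0 : 0 < n := by
    rw [hn, Nat.cast_pos]
    exact Fintype.card_pos
  have hsum : ∑ _j : J, β / 2 / n = β / 2 := by
    rw [Finset.sum_const, Finset.card_univ, nsmul_eq_mul, ← hn]
    field_simp
  have hsq : ∑ _j : J, (β / 2 / n) ^ 2 = β ^ 2 / 4 / n := by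
    rw [Finset.sum_const, Finset.card_univ, nsmul_eq_mul, ← hn]
    field_simp
    norm_num
  have hq : A.quad (fun _ => β / 2 / n) = D * (β ^ 2 / 4 / n) := by
    rw [AdjGraph.quad]
    simp_rw [← Finset.sum_mul, hA]
    rw [Finset.sum_const, Finset.card_univ, nsmul_eq_mul, ← hn]
    field_simp
    norm_num
  refine ⟨P.split ξ fun _ => β / 2 / n, split_mem hξ (fun _ => by positivity) (by
    rw [hsum]; linarith), ?_⟩
  rw [poly_ext_split, hsum, hsq, hq]
  refine hx.trans_le ?_
  have h1 : (ξ P.o - β / 2) * (D * (β ^ 2 / 4 / n)) - P.link ξ * (β ^ 2 / 4 / n) =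
      (ξ P.o - β / 2 - P.link ξ / D) * (D * (β ^ 2 / 4 / n)) := by
    field_simp
  have h2 : β / 2 * (D * (β ^ 2 / 4 / n)) ≤
      (ξ P.o - β / 2 - P.link ξ / D) * (D * (β ^ 2 / 4 / n)) :=
    mul_le_mul_of_nonneg_right (by linarith) (by positivity)
  have h3 : 3 * D * β ^ 3 / (8 * n) = 3 * (β / 2 * (D * (β ^ 2 / 4 / n))) := by
    field_simp
    norm_num
  linarith

/-- If some extension of `P` along a graph with controlled quadratic form has Lagrangian exceeding
`x`, then some extension along an induced subgraph has Lagrangian at most, but close to, `x`. -/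
theorem exists_ext_close {J : Type} [Fintype J] [DecidableEq J] {P : Pattern} {m : ℕ}
    (hP : P.Good 8000 40000 m) {x : ℝ} (hx0 : 1 - 1 / 8001 ^ 2 ≤ x)
    (hPx : ∀ ξ ∈ stdSimplex ℝ P.ι, P.poly ξ ≤ x) (A : AdjGraph J)
    (hA : ∀ i, ∑ j, A.adj i j = 40000) {δ : ℝ} (hδ : 0 < δ)
    (hquad : ∀ z : J → ℝ, (∀ j, 0 ≤ z j) →
      A.quad z ≤ 800 * ∑ j, z j ^ 2 + δ * (∑ j, z j) ^ 2)
    (hex : ∃ ζ ∈ stdSimplex ℝ (P.ι ⊕ J), x < (P.ext A).poly ζ) :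
    ∃ P' : Pattern, P'.Good 8000 40000 (m + 1) ∧ (∀ ξ ∈ stdSimplex ℝ P'.ι, P'.poly ξ ≤ x) ∧
      ∃ ξ ∈ stdSimplex ℝ P'.ι, x - 240000 * δ ^ 2 ≤ P'.poly ξ ∧
        1 / 32004 / 3 ^ (m + 1) ≤ ξ P'.o - P'.link ξ / 40000 := by
  have hgood : ∀ S : Finset J, (P.ext (A.restrict S)).Good 8000 40000 (m + 1) := fun S =>
    hP.ext _ (by norm_num) (A.restrict_sum_le hA S)
  obtain ⟨S, hS, hmin⟩ := exists_minimal_of_wellFoundedLT (fun S : Finset J =>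
    ∃ ζ ∈ stdSimplex ℝ (P.ι ⊕ J), x < (P.ext (A.restrict S)).poly ζ) (by
      obtain ⟨ζ, hζ, hlt⟩ := hex
      refine ⟨Finset.univ, ζ, hζ, ?_⟩
      rw [poly_ext] at hlt ⊢
      simpa [A.quad_restrict] using hlt)
  obtain ⟨ζ, hζ, hζx⟩ := hS
  obtain ⟨ξ, hξ, hmax⟩ := (isCompact_stdSimplex ℝ (P.ι ⊕ J)).exists_isMaxOn ⟨ζ, hζ⟩
    (P.ext (A.restrict S)).continuous_poly.continuousOn
  have hξx : x < (P.ext (A.restrict S)).poly ξ := hζx.trans_le (hmax hζ)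
  have hmem := merge_mem hξ
  have hv : ∀ j, 0 ≤ ξ (.inr j) := fun j => hξ.1 _
  have ho0 : 0 ≤ ξ (.inl P.o) := hξ.1 _
  have hτ1 : ξ (.inl P.o) + ∑ j, ξ (.inr j) ≤ 1 := by
    have h1 := P.add_link_le_one hmem
    have h2 := P.link_nonneg hmem
    rw [merge_o] at h1
    linarith
  have hou : ξ (.inl P.o) + P.link (P.merge ξ) ≤ 1 := by
    rw [← link_ext (A.restrict S)]
    exact (P.ext (A.restrict S)).add_link_le_one hξ
  have hbound := (hgood S).poly_le ξ hξ
  rw [link_ext] at hbound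
  change _ ≤ 1 - (1 - P.link (P.merge ξ)) ^ 3 - P.link (P.merge ξ) ^ 3 / 8000 ^ 2 +
    ((1 - P.link (P.merge ξ)) ^ 3 - ξ (.inl P.o) ^ 3) / 2 at hbound
  have hu0 := P.link_nonneg hmem
  have hou' : 1600 * ξ (.inl P.o) ≤ P.link (P.merge ξ) := by
    by_contra! hlt
    have := bound_le_of_large_part hu0 hou hlt
    linarith
  have hbase := lt_of_bound_le ho0 hou (hx0.trans (hξx.le.trans hbound))
  have hXY : P.link (P.merge ξ) * ∑ j, ξ (.inr j) ^ 2 <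
      ξ (.inl P.o) * (A.restrict S).quad fun j => ξ (.inr j) := by
    have h1 := hPx _ hmem
    rw [poly_ext] at hξx
    linarith
  have hX0 := (A.restrict S).quad_nonneg hv
  have hY0 : 0 ≤ ∑ j, ξ (.inr j) ^ 2 := Finset.sum_nonneg fun j _ => sq_nonneg _
  have ho : 0 < ξ (.inl P.o) := by
    rcases ho0.eq_or_lt with h | h
    · rw [← h, zero_mul] at hXY
      exact absurd hXY (not_lt.mpr (mul_nonneg hu0 hY0))
    · exact h
  have hslack := (hgood S).slack ξ hξ (by rw [link_ext]; linarith) (by rw [link_ext]; linarith)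
    fun ζ hζ _ _ => hmax hζ
  rw [link_ext] at hslack
  change _ ≤ 3 ^ (m + 1) * (ξ (.inl P.o) - _) at hslack
  have hXY' : 1600 * ∑ j, ξ (.inr j) ^ 2 < (A.restrict S).quad fun j => ξ (.inr j) := by
    have := mul_le_mul_of_nonneg_right hou' hY0
    by_contra! h
    nlinarith
  obtain ⟨z, hz⟩ : ∃ z : J → ℝ, z = fun j => if j ∈ S then ξ (.inr j) else 0 := ⟨_, rfl⟩
  have hz0 : ∀ j, 0 ≤ z j := by
    intro j
    rw [hz]
    dsimp only
    split_ifs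
    · exact hv j
    · exact le_rfl
  have hzle : ∀ j, z j ≤ ξ (.inr j) := by
    intro j
    rw [hz]
    dsimp only
    split_ifs
    · exact le_rfl
    · exact hv j
  have hquadz : ((A.restrict S).quad fun j => ξ (.inr j)) = A.quad z := by
    rw [A.quad_restrict, hz]
  have hz2 : ∑ j, z j ^ 2 ≤ ∑ j, ξ (.inr j) ^ 2 :=
    Finset.sum_le_sum fun j _ => pow_le_pow_left₀ (hz0 j) (hzle j) 2
  have hzτ : ∑ j, z j ≤ 1 := (Finset.sum_le_sum fun j _ => hzle j).trans (by linarith)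
  have hzτ0 : 0 ≤ ∑ j, z j := Finset.sum_nonneg fun j _ => hz0 j
  have hzS : (∑ j, z j) ^ 2 ≤ S.card * ∑ j, z j ^ 2 := by
    have e : ∀ g : ℝ → ℝ, g 0 = 0 → ∑ j, g (z j) = ∑ j ∈ S, g (z j) := by
      intro g hg
      refine (Finset.sum_subset (Finset.subset_univ S) fun j _ hj => ?_).symm
      rw [hz]
      simp [hj, hg]
    have e1 : ∑ j, z j = ∑ j ∈ S, z j := e id rfl
    have e2 : ∑ j, z j ^ 2 = ∑ j ∈ S, z j ^ 2 := e (fun t => t ^ 2) (by simp)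
    rw [e1, e2]
    exact sq_sum_le_card_mul_sum_sq
  have hq1 := hquad z hz0
  have hq2 := A.quad_le_mul_sum_sq (fun i => (hA i).le) z
  rw [hquadz] at hXY'
  have hzY0 : 0 ≤ ∑ j, z j ^ 2 := Finset.sum_nonneg fun j _ => sq_nonneg _
  have hzY : 0 < ∑ j, z j ^ 2 := by linarith
  have hYδ : ∑ j, z j ^ 2 ≤ δ * (∑ j, z j) ^ 2 := by linarith
  have hcard : 1 ≤ δ * S.card := by
    have h1 := mul_le_mul_of_nonneg_left hzS hδ.le
    by_contra! h
    nlinarith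
  have hXδ : A.quad z ≤ 40000 * δ := by
    have : (∑ j, z j) ^ 2 ≤ 1 := pow_le_one₀ hzτ0 hzτ
    nlinarith
  have hS0 : (0 : ℝ) < S.card := by
    by_contra! h
    nlinarith
  obtain ⟨k, hk, hkle⟩ : ∃ k ∈ S, ξ (.inr k) * ∑ j, (A.restrict S).adj k j * ξ (.inr j) ≤
      40000 * δ ^ 2 := by
    by_contra! hcon
    have h1 := Finset.card_nsmul_le_sum S _ _ fun k hk => (hcon k hk).le
    have hne : S.Nonempty := by
      rw [← Finset.card_pos]
      exact_mod_cast hS0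
    have h2 := Finset.sum_lt_sum_of_nonempty hne hcon
    rw [← A.quad_eq_sum_restrict S fun j => ξ (.inr j), hquadz, Finset.sum_const,
      nsmul_eq_mul] at h2
    nlinarith
  refine ⟨P.ext (A.restrict (S.erase k)), hgood _, ?_, ξ, hξ, ?_, ?_⟩
  · intro η hη
    by_contra! hlt
    have := hmin ⟨η, hη, hlt⟩ (Finset.erase_subset k S)
    exact Finset.notMem_erase k S (this hk)
  · rw [poly_ext] at hξx ⊢
    rw [A.quad_restrict_erase S k fun j => ξ (.inr j)]
    have h1 : ξ (.inl P.o) ≤ 1 := by linarith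
    have h2 : ξ (.inl P.o) * (ξ (.inr k) * ∑ j, (A.restrict S).adj k j * ξ (.inr j)) ≤
        40000 * δ ^ 2 := (mul_le_mul_of_nonneg_left hkle ho0).trans
      (mul_le_of_le_one_left (by positivity) h1)
    linarith
  · rw [link_ext]
    change _ ≤ ξ (.inl P.o) - _
    rw [div_le_iff₀ (by positivity)]
    linarith

end Pattern

/-- The base patterns approximate the left end point of the interval. -/
theorem exists_initial_pattern {x E : ℝ} (hx : 1 - 1 / 8001 ^ 2 ≤ x)
    (hxE : x ≤ 1 - 1 / 8001 ^ 2 + E) :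
    ∃ P : Pattern, P.Good 8000 40000 0 ∧ (∀ ξ ∈ stdSimplex ℝ P.ι, P.poly ξ ≤ x) ∧
      ∃ ξ ∈ stdSimplex ℝ P.ι, x - E ≤ P.poly ξ ∧
        1 / 32004 ≤ ξ P.o - P.link ξ / 40000 := by
  have hξ : (fun _ => 1 / 8001 : Fin (8000 + 1) → ℝ) ∈ stdSimplex ℝ (Fin (8000 + 1)) :=
    ⟨fun _ => by norm_num, by simp⟩
  refine ⟨Pattern.base 8000, mod_cast Pattern.good_base (L := 8000) 40000, fun ξ hξ => ?_,
    _, hξ, ?_, ?_⟩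
  · have := Pattern.poly_base_le hξ
    norm_num at this hx ⊢
    linarith
  · rw [Pattern.poly_base hξ, Finset.sum_const, Finset.card_univ, Fintype.card_fin]
    norm_num at hxE ⊢
    linarith
  · rw [Pattern.link_base, Finset.sum_const, Finset.card_univ, Fintype.card_fin]
    norm_num

/-- The patterns approximating `x` can be improved by a constant factor. -/
theorem exists_improvement : ∃ E : ℝ, 0 < E ∧ ∀ x : ℝ, 1 - 1 / 8001 ^ 2 ≤ x → ∀ m : ℕ,
    (∃ P : Pattern, P.Good 8000 40000 m ∧ (∀ ξ ∈ stdSimplex ℝ P.ι, P.poly ξ ≤ x) ∧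
      ∃ ξ ∈ stdSimplex ℝ P.ι, x - E / 729 ^ m ≤ P.poly ξ ∧
        1 / 32004 / 3 ^ m ≤ ξ P.o - P.link ξ / 40000) →
    ∃ P : Pattern, P.Good 8000 40000 (m + 1) ∧ (∀ ξ ∈ stdSimplex ℝ P.ι, P.poly ξ ≤ x) ∧
      ∃ ξ ∈ stdSimplex ℝ P.ι, x - E / 729 ^ (m + 1) ≤ P.poly ξ ∧
        1 / 32004 / 3 ^ (m + 1) ≤ ξ P.o - P.link ξ / 40000 := by
  obtain ⟨C, hC, hgraph⟩ := exists_regular_graph_quadratic_le (c := 100) (by norm_num)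
    (D := 40000) (by norm_num)
  obtain ⟨a, ha⟩ : ∃ a : ℝ, a = 3 * 40000 / (8 * 40001) * (1 / 32004) ^ 3 := ⟨_, rfl⟩
  have ha0 : 0 < a := by rw [ha]; norm_num
  have hC0 : 0 < C := by linarith
  refine ⟨min (a ^ 2 / (729 * 960000 * C ^ 2)) (a / 2), by positivity, fun x hx m => ?_⟩
  obtain ⟨E, hE⟩ : ∃ E, E = min (a ^ 2 / (729 * 960000 * C ^ 2)) (a / 2) := ⟨_, rfl⟩
  have hE0 : 0 < E := by rw [hE]; positivity
  have hE1 : E * (729 * 960000 * C ^ 2) ≤ a ^ 2 := by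
    rw [← le_div_iff₀ (by positivity), hE]
    exact min_le_left _ _
  have hE2 : E ≤ a / 2 := hE ▸ min_le_right _ _
  rw [← hE]
  rintro ⟨P, hP, hPx, ξ, hξ, hclose, hsl⟩
  obtain ⟨N, hN0, hNlt, hNge⟩ : ∃ N : ℕ, 0 < N ∧ N * E < a * 27 ^ m ∧ a * 27 ^ m ≤ 2 * (N * E) := by
    have hK : 2 ≤ a * 27 ^ m / E := by
      rw [le_div_iff₀ hE0]
      have : (1 : ℝ) ≤ 27 ^ m := one_le_pow₀ (by norm_num)
      nlinarith
    have h1 := Nat.le_ceil (a * 27 ^ m / E)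
    have h2 : 2 ≤ ⌈a * 27 ^ m / E⌉₊ := by exact_mod_cast hK.trans h1
    have h3 : ((⌈a * 27 ^ m / E⌉₊ - 1 : ℕ) : ℝ) = ⌈a * 27 ^ m / E⌉₊ - 1 := by
      rw [Nat.cast_sub (by omega), Nat.cast_one]
    have h4 := Nat.ceil_lt_add_one (a := a * 27 ^ m / E) (by linarith)
    refine ⟨⌈a * 27 ^ m / E⌉₊ - 1, by omega, ?_, ?_⟩
    · rw [← lt_div_iff₀ hE0, h3]
      linarith
    · rw [← mul_assoc, ← div_le_iff₀ hE0, h3]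
      linarith
  have hN : (0 : ℝ) < N := Nat.cast_pos.mpr hN0
  obtain ⟨A, hA01, hAs, hA0, hAD, hAq⟩ := hgraph N hN0
  have : Nonempty (Fin (40000 + 1) × Fin N) := ⟨0, ⟨0, hN0⟩⟩
  let G : AdjGraph (Fin (40000 + 1) × Fin N) := ⟨A, hA01, hAs, hA0⟩
  have hGD : ∀ i, ∑ j, G.adj i j = 40000 := fun i => by simpa using hAD i
  have h27 : (27 : ℝ) ^ m = (3 ^ m) ^ 3 := by rw [← pow_mul, mul_comm, pow_mul]; norm_num
  have h729 : (729 : ℝ) ^ m = (3 ^ m) ^ 6 := by rw [← pow_mul, mul_comm, pow_mul]; norm_num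
  obtain ⟨t, ht⟩ : ∃ t : ℝ, t = 3 ^ m := ⟨_, rfl⟩
  have ht0 : 0 < t := by rw [ht]; positivity
  rw [h27, ← ht] at hNlt hNge
  rw [h729, ← ht] at hclose
  obtain ⟨P', hP', hP'x, ζ, hζ, hζx, hζs⟩ := Pattern.exists_ext_close hP hx hPx G hGD
    (δ := C / N) (by positivity) (fun z hz => by
      have := hAq z hz
      norm_num at this
      exact this)
    (Pattern.exists_gain P G (by norm_num) hGD (β := 1 / 32004 / 3 ^ m) (by positivity) hξ hsl (by
      rw [Fintype.card_prod, Fintype.card_fin, Fintype.card_fin, ← ht]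
      suffices E / t ^ 6 < 3 * 40000 * (1 / 32004 / t) ^ 3 / (8 * ((40000 + 1) * N)) by
        push_cast
        linarith
      have e : 3 * 40000 * (1 / 32004 / t) ^ 3 / (8 * ((40000 + 1) * N)) = a / (N * t ^ 3) := by
        rw [ha]
        field_simp
        norm_num
      rw [e, div_lt_div_iff₀ (by positivity) (by positivity)]
      have := mul_lt_mul_of_pos_right hNlt (by positivity : 0 < t ^ 3)
      linarith))
  refine ⟨P', hP', hP'x, ζ, hζ, le_trans ?_ hζx, hζs⟩
  rw [pow_succ, h729, ← ht]
  suffices 240000 * (C / N) ^ 2 ≤ E / (t ^ 6 * 729) by linarith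
  rw [div_pow, mul_div_assoc', div_le_div_iff₀ (by positivity) (by positivity)]
  have h1 : (a * t ^ 3) ^ 2 ≤ (2 * (N * E)) ^ 2 := pow_le_pow_left₀ (by positivity) hNge 2
  have h2 := mul_le_mul_of_nonneg_right hE1 (by positivity : 0 ≤ t ^ 6)
  refine le_of_mul_le_mul_left ?_ hE0
  linarith

/-- There exist reals `μ < ν₁` with `[μ, ν₁] ⊆ Π^{(3)}_∞`. -/
theorem interval_in_PiInf_three :
    ∃ μ ν₁ : ℝ, μ < ν₁ ∧ Set.Icc μ ν₁ ⊆ PiInf 3 := by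
  obtain ⟨E, hE, himp⟩ := exists_improvement
  refine ⟨1 - 1 / 8001 ^ 2, 1 - 1 / 8001 ^ 2 + E, by linarith, fun x hx => ?_⟩
  have h : ∀ m : ℕ, ∃ P : Pattern, P.Good 8000 40000 m ∧
      (∀ ξ ∈ stdSimplex ℝ P.ι, P.poly ξ ≤ x) ∧
      ∃ ξ ∈ stdSimplex ℝ P.ι, x - E / 729 ^ m ≤ P.poly ξ ∧
        1 / 32004 / 3 ^ m ≤ ξ P.o - P.link ξ / 40000 := by
    intro m
    induction m with
    | zero => simpa using exists_initial_pattern hx.1 hx.2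
    | succ m ih => exact himp x hx.1 m ih
  refine mem_PiInf_of_patterns fun ε hε => ?_
  obtain ⟨m, hm⟩ := exists_pow_lt_of_lt_one (div_pos hε hE) (by norm_num : (1 / 729 : ℝ) < 1)
  obtain ⟨P, -, hPx, ξ, hξ, hclose, -⟩ := h m
  refine ⟨P, hPx, ξ, hξ, le_trans ?_ hclose⟩
  rw [lt_div_iff₀ hE, one_div, inv_pow] at hm
  have : E / 729 ^ m = (729 ^ m)⁻¹ * E := by rw [div_eq_inv_mul]
  linarith
end

section
/- There exist a real number α and a sequence (P_i)_{i≥1} of finite 3-graphs such that λ(P_i) > α for every i, the sequence λ(P_i) is strictly decreasing with λ(P_i) → α as i → ∞, and (λ(P_i) − α)/(λ(P_{i+1}) − α) → 1 as i → ∞. -/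
open Filter

/-- The Lagrangian of a finite `r`-graph: the maximum of
`r!·Σ_{e∈G} Π_{v∈e} y_v` over probability vectors `y` on the vertex set. -/
noncomputable def lagrangian {r : ℕ} (G : HGraph r) : ℝ :=
  sSup { t : ℝ | ∃ y : Fin G.n → ℝ, (∀ v, 0 ≤ y v) ∧ (∑ v, y v) = 1 ∧
    t = (r.factorial : ℝ) * ∑ e ∈ G.edges, ∏ v ∈ e, y v }

/-- The Lagrangian polynomial of a family of triples. -/
noncomputable def lagPoly {V : Type*} (E : Finset (Finset V)) (y : V → ℝ) : ℝ :=
  6 * ∑ e ∈ E, ∏ v ∈ e, y v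

/-- The maximum of the Lagrangian polynomial over the simplex. -/
noncomputable def lagMax {V : Type*} [Fintype V] (E : Finset (Finset V)) : ℝ :=
  sSup (lagPoly E '' stdSimplex ℝ V)

lemma isGreatest_lagMax {V : Type*} [Fintype V] [Nonempty V] (E : Finset (Finset V)) :
    IsGreatest (lagPoly E '' stdSimplex ℝ V) (lagMax E) := by
  classical
  refine IsCompact.isGreatest_sSup ((isCompact_stdSimplex ℝ V).image ?_) ?_
  · unfold lagPoly
    fun_prop
  · exact Set.Nonempty.image _ ⟨_, single_mem_stdSimplex ℝ (Classical.arbitrary V)⟩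

lemma lagPoly_le_lagMax {V : Type*} [Fintype V] [Nonempty V] (E : Finset (Finset V))
    {y : V → ℝ} (hy : y ∈ stdSimplex ℝ V) : lagPoly E y ≤ lagMax E :=
  (isGreatest_lagMax E).2 ⟨y, hy, rfl⟩

lemma exists_lagPoly_eq_lagMax {V : Type*} [Fintype V] [Nonempty V] (E : Finset (Finset V)) :
    ∃ y ∈ stdSimplex ℝ V, lagPoly E y = lagMax E :=
  (isGreatest_lagMax E).1

lemma exists_lagrangian_eq_lagMax {V : Type*} [Fintype V] (E : Finset (Finset V))
    (hE : ∀ e ∈ E, e.card = 3) : ∃ G : HGraph 3, lagrangian G = lagMax E := by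
  classical
  let φ := Fintype.equivFin V
  refine ⟨⟨Fintype.card V, E.map (Finset.mapEmbedding φ.toEmbedding).toEmbedding, ?_⟩, ?_⟩
  · intro e he
    obtain ⟨d, hd, rfl⟩ := Finset.mem_map.1 he
    simpa using hE d hd
  · unfold lagrangian lagMax
    congr 1
    ext t
    simp only [Set.mem_ofPred_eq, Set.mem_image, stdSimplex, lagPoly, Finset.sum_map,
      RelEmbedding.coe_toEmbedding, Finset.mapEmbedding_apply, Finset.prod_map]
    constructor
    · rintro ⟨y, h0, h1, rfl⟩
      refine ⟨fun v => y (φ v), ⟨fun v => h0 _, ?_⟩, ?_⟩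
      · rw [← h1]; exact Equiv.sum_comp φ y
      · simp [Nat.factorial]
    · rintro ⟨y, ⟨h0, h1⟩, rfl⟩
      refine ⟨fun v => y (φ.symm v), fun v => h0 _, ?_, ?_⟩
      · rw [← h1]; exact Equiv.sum_comp φ.symm y
      · simp [Nat.factorial]

/-- Ordered triples of distinct vertices spanning a member of `E`. -/
def orderedTriples {V : Type*} [Fintype V] [DecidableEq V] (E : Finset (Finset V)) :
    Finset (V × V × V) :=
  {t | t.1 ≠ t.2.1 ∧ t.1 ≠ t.2.2 ∧ t.2.1 ≠ t.2.2 ∧ {t.1, t.2.1, t.2.2} ∈ E}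

lemma lagPoly_eq_sum_orderedTriples {V : Type*} [Fintype V] [DecidableEq V]
    (E : Finset (Finset V)) (hE : ∀ e ∈ E, e.card = 3) (y : V → ℝ) :
    lagPoly E y = ∑ t ∈ orderedTriples E, y t.1 * (y t.2.1 * y t.2.2) := by
  have hmap : ∀ t ∈ orderedTriples E, ({t.1, t.2.1, t.2.2} : Finset V) ∈ E := by
    intro t ht
    simp only [orderedTriples, Finset.mem_filter] at ht
    exact ht.2.2.2.2
  rw [← Finset.sum_fiberwise_of_maps_to hmap, lagPoly, Finset.mul_sum]
  refine Finset.sum_congr rfl fun e he => ?_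
  obtain ⟨a, b, c, hab, hac, hbc, rfl⟩ := Finset.card_eq_three.1 (hE e he)
  have hset : (orderedTriples E).filter (fun t => ({t.1, t.2.1, t.2.2} : Finset V) = {a, b, c}) =
      {(a, b, c), (a, c, b), (b, a, c), (b, c, a), (c, a, b), (c, b, a)} := by
    ext ⟨x, y, z⟩
    simp only [orderedTriples, Finset.mem_filter, Finset.mem_univ, true_and, Finset.mem_insert,
      Finset.mem_singleton, Prod.mk.injEq]
    constructor
    · rintro ⟨⟨h1, h2, h3, -⟩, h⟩
      have hx : x = a ∨ x = b ∨ x = c := by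
        have : x ∈ ({x, y, z} : Finset V) := by simp
        rw [h] at this
        simpa using this
      have hy : y = a ∨ y = b ∨ y = c := by
        have : y ∈ ({x, y, z} : Finset V) := by simp
        rw [h] at this
        simpa using this
      have hz : z = a ∨ z = b ∨ z = c := by
        have : z ∈ ({x, y, z} : Finset V) := by simp
        rw [h] at this
        simpa using this
      grind
    · intro h
      have key : ({x, y, z} : Finset V) = {a, b, c} := by
        ext v
        simp only [Finset.mem_insert, Finset.mem_singleton]
        grind
      refine ⟨⟨?_, ?_, ?_, ?_⟩, key⟩
      · grind
      · grind
      · grind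
      · rwa [key]
  rw [hset]
  rw [Finset.sum_insert, Finset.sum_insert, Finset.sum_insert, Finset.sum_insert,
    Finset.sum_insert, Finset.sum_singleton, Finset.prod_insert, Finset.prod_insert,
    Finset.prod_singleton]
  · ring
  all_goals simp; try grind

lemma lagPoly_powersetCard {V : Type*} [DecidableEq V] (s : Finset V) (y : V → ℝ) :
    lagPoly (s.powersetCard 3) y =
      (∑ v ∈ s, y v) ^ 3 - 3 * (∑ v ∈ s, y v) * (∑ v ∈ s, y v ^ 2) + 2 * ∑ v ∈ s, y v ^ 3 := by
  have h1 : ∀ s : Finset V, ∑ e ∈ s.powersetCard 1, ∏ v ∈ e, y v = ∑ v ∈ s, y v := by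
    intro s
    simp [Finset.powersetCard_one]
  have step : ∀ (k : ℕ) (a : V) (s : Finset V), a ∉ s →
      ∑ e ∈ (insert a s).powersetCard (k + 1), ∏ v ∈ e, y v =
      ∑ e ∈ s.powersetCard (k + 1), ∏ v ∈ e, y v +
        y a * ∑ e ∈ s.powersetCard k, ∏ v ∈ e, y v := by
    intro k a s ha
    have hna : ∀ e ∈ s.powersetCard k, a ∉ e := fun e he h =>
      ha ((Finset.mem_powersetCard.1 he).1 h)
    rw [Finset.powersetCard_succ_insert ha, Finset.sum_union, Finset.sum_image, Finset.mul_sum]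
    · congr 1
      exact Finset.sum_congr rfl fun e he => Finset.prod_insert (hna e he)
    · intro e he f hf hef
      rw [← Finset.erase_insert (hna e he), ← Finset.erase_insert (hna f hf), hef]
    · rw [Finset.disjoint_left]
      intro e he he'
      obtain ⟨f, -, rfl⟩ := Finset.mem_image.1 he'
      exact ha ((Finset.mem_powersetCard.1 he).1 (Finset.mem_insert_self a f))
  have h2 : ∀ s : Finset V, 2 * ∑ e ∈ s.powersetCard 2, ∏ v ∈ e, y v =
      (∑ v ∈ s, y v) ^ 2 - ∑ v ∈ s, y v ^ 2 := by
    intro s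
    induction s using Finset.induction_on with
    | empty => rw [Finset.powersetCard_eq_empty.2 (by simp)]; simp
    | insert a s ha ih =>
      rw [step 1 a s ha, mul_add, ih, h1, Finset.sum_insert ha, Finset.sum_insert ha]
      ring
  unfold lagPoly
  induction s using Finset.induction_on with
  | empty => rw [Finset.powersetCard_eq_empty.2 (by simp)]; simp
  | insert a s ha ih =>
    rw [step 2 a s ha, mul_add, ih, Finset.sum_insert ha, Finset.sum_insert ha,
      Finset.sum_insert ha]
    linear_combination 3 * y a * h2 s

/-- Triples of `A ⊕ W` meeting both parts, together with the triples of `H` placed inside `A`. -/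
def joinTriples {A W : Type*} [Fintype A] [Fintype W] [DecidableEq A] [DecidableEq W]
    (H : Finset (Finset A)) : Finset (Finset (A ⊕ W)) :=
  Finset.univ.powersetCard 3 \
    ((Finset.univ.powersetCard 3 \ H).map (Finset.mapEmbedding .inl).toEmbedding ∪
      (Finset.univ.powersetCard 3).map (Finset.mapEmbedding .inr).toEmbedding)

lemma card_of_mem_joinTriples {A W : Type*} [Fintype A] [Fintype W] [DecidableEq A] [DecidableEq W]
    {H : Finset (Finset A)} {e : Finset (A ⊕ W)} (he : e ∈ joinTriples H) : e.card = 3 :=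
  (Finset.mem_powersetCard.1 (Finset.mem_sdiff.1 he).1).2

lemma lagPoly_joinTriples {A W : Type*} [Fintype A] [Fintype W] [DecidableEq A] [DecidableEq W]
    {H : Finset (Finset A)} (hH : ∀ e ∈ H, e.card = 3) (y : A ⊕ W → ℝ) :
    lagPoly (joinTriples H) y =
      3 * (∑ x, y (.inl x)) * (∑ u, y (.inr u)) * (∑ x, y (.inl x) + ∑ u, y (.inr u))
      - 3 * (∑ u, y (.inr u)) * (∑ x, y (.inl x) ^ 2)
      - 3 * (∑ x, y (.inl x)) * (∑ u, y (.inr u) ^ 2)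
      + lagPoly H (fun x => y (.inl x)) := by
  have hHs : H ⊆ Finset.univ.powersetCard 3 := fun e he =>
    Finset.mem_powersetCard.2 ⟨Finset.subset_univ _, hH e he⟩
  have hV := lagPoly_powersetCard (Finset.univ : Finset (A ⊕ W)) y
  have hA := lagPoly_powersetCard (Finset.univ : Finset A) (fun x => y (.inl x))
  have hW := lagPoly_powersetCard (Finset.univ : Finset W) (fun x => y (.inr x))
  simp only [Fintype.sum_sum_type] at hV
  unfold lagPoly at *
  rw [← Finset.sum_sdiff hHs] at hA
  rw [← Finset.sum_sdiff (s₁ := (Finset.univ.powersetCard 3 \ H).map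
      (Finset.mapEmbedding .inl).toEmbedding ∪
      (Finset.univ.powersetCard 3).map (Finset.mapEmbedding .inr).toEmbedding),
    Finset.sum_union] at hV
  · simp only [Finset.sum_map, RelEmbedding.coe_toEmbedding, Finset.mapEmbedding_apply,
      Finset.prod_map, Function.Embedding.inl_apply, Function.Embedding.inr_apply] at hV
    unfold joinTriples
    linear_combination hV - hA - hW
  · rw [Finset.disjoint_left]
    intro e he he'
    obtain ⟨d, hd, rfl⟩ := Finset.mem_map.1 he
    obtain ⟨d', hd', h⟩ := Finset.mem_map.1 he'
    have hc := (Finset.mem_powersetCard.1 (Finset.mem_sdiff.1 hd).1).2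
    obtain ⟨v, hv⟩ := Finset.card_pos.1 (by omega : 0 < d.card)
    have : (Sum.inl v : A ⊕ W) ∈ Finset.map Function.Embedding.inl d :=
      Finset.mem_map.2 ⟨v, hv, rfl⟩
    simp only [RelEmbedding.coe_toEmbedding, Finset.mapEmbedding_apply] at h
    rw [← h] at this
    simp at this
  · intro e he
    rw [Finset.mem_powersetCard]
    refine ⟨Finset.subset_univ _, ?_⟩
    rcases Finset.mem_union.1 he with he | he
    · obtain ⟨d, hd, rfl⟩ := Finset.mem_map.1 he
      simpa using (Finset.mem_powersetCard.1 (Finset.mem_sdiff.1 hd).1).2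
    · obtain ⟨d, hd, rfl⟩ := Finset.mem_map.1 he
      simpa using (Finset.mem_powersetCard.1 hd).2

/-- The sum of `f x * f y * f z` over distinct `x, y, z` with `x + y + z = c`. -/
noncomputable def tripleSum {p : ℕ} [NeZero p] (f : ZMod p → ℝ) (c : ZMod p) : ℝ :=
  ∑ x, f x * ∑ y, if x ≠ y ∧ x ≠ c - x - y ∧ y ≠ c - x - y then f y * f (c - x - y) else 0

lemma sum_reflect {p : ℕ} [NeZero p] (F : ZMod p → ℝ) (c : ZMod p) :
    ∑ y, F (c - y) = ∑ y, F y :=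
  Equiv.sum_comp (Equiv.subLeft c) F

lemma inner_tripleSum_le {p : ℕ} [NeZero p] (f : ZMod p → ℝ) (c x : ZMod p) :
    (∑ y, if x ≠ y ∧ x ≠ c - x - y ∧ y ≠ c - x - y then f y * f (c - x - y) else 0) ≤
      ∑ y, f y ^ 2 - f x ^ 2 := by
  have hx : ∑ y, (if x ≠ y then f y ^ 2 else 0) = ∑ y, f y ^ 2 - f x ^ 2 := by
    rw [← Finset.add_sum_erase _ (fun y => f y ^ 2) (Finset.mem_univ x), ← Finset.sum_filter,
      Finset.filter_ne]
    ring
  have hr := sum_reflect (fun y => if x ≠ y then f y ^ 2 else 0) (c - x)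
  rw [hx] at hr
  calc _ ≤ ∑ y, ((if x ≠ y then f y ^ 2 else 0) / 2 +
        (if x ≠ c - x - y then f (c - x - y) ^ 2 else 0) / 2) := by
        refine Finset.sum_le_sum fun y _ => ?_
        have := sq_nonneg (f y - f (c - x - y))
        have := sq_nonneg (f y)
        have := sq_nonneg (f (c - x - y))
        split_ifs <;> first | nlinarith | (exfalso; tauto)
    _ = _ := by
        rw [Finset.sum_add_distrib, ← Finset.sum_div, ← Finset.sum_div, hx, hr]
        ring

lemma tripleSum_le {p : ℕ} [NeZero p] (f : ZMod p → ℝ) (hf : ∀ x, 0 ≤ f x) (c : ZMod p) :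
    tripleSum f c ≤ (∑ x, f x) * (∑ x, f x ^ 2) - ∑ x, f x ^ 3 := by
  unfold tripleSum
  rw [Finset.sum_mul, ← Finset.sum_sub_distrib]
  refine Finset.sum_le_sum fun x _ => ?_
  have := mul_le_mul_of_nonneg_left (inner_tripleSum_le f c x) (hf x)
  linarith

/-- A function with an atom carrying nine tenths of its mass has a small triple sum. -/
lemma tripleSum_le_of_atom {p : ℕ} [NeZero p] (f : ZMod p → ℝ) (hf : ∀ x, 0 ≤ f x) (c : ZMod p)
    (x₀ : ZMod p) (hx₀ : 9 / 10 * ∑ x, f x ≤ f x₀) :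
    tripleSum f c ≤ 1 / 5 * ((∑ x, f x) * ∑ x, f x ^ 2) := by
  set a := ∑ x, f x with ha
  set s := ∑ x, f x ^ 2 with hs
  have ha0 : 0 ≤ a := Finset.sum_nonneg fun x _ => hf x
  have hs0 : f x₀ ^ 2 ≤ s :=
    Finset.single_le_sum (f := fun x => f x ^ 2) (fun x _ => sq_nonneg _) (Finset.mem_univ x₀)
  have hsplit : f x₀ + ∑ x ∈ Finset.univ.erase x₀, f x = a :=
    Finset.add_sum_erase _ f (Finset.mem_univ x₀)
  have hsmall : ∀ y, y ≠ x₀ → f y ≤ a / 10 := by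
    intro y hy
    have := Finset.single_le_sum (f := f) (fun x _ => hf x)
      (Finset.mem_erase.2 ⟨hy, Finset.mem_univ y⟩)
    linarith
  have hin : (∑ y, if x₀ ≠ y ∧ x₀ ≠ c - x₀ - y ∧ y ≠ c - x₀ - y then f y * f (c - x₀ - y) else 0) ≤
      a / 10 * (a / 10) := by
    calc _ ≤ ∑ y, if x₀ ≠ y then f y * (a / 10) else 0 := by
          refine Finset.sum_le_sum fun y _ => ?_
          have := hf y
          split_ifs with h1 h2 h2
          · exact mul_le_mul_of_nonneg_left (hsmall _ (Ne.symm h1.2.1)) (hf y)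
          · tauto
          · positivity
          · exact le_rfl
      _ = (∑ y ∈ Finset.univ.erase x₀, f y) * (a / 10) := by
          rw [← Finset.sum_filter, Finset.filter_ne, Finset.sum_mul]
      _ ≤ _ := by
          apply mul_le_mul_of_nonneg_right _ (by positivity)
          linarith
  have hout : ∑ x ∈ Finset.univ.erase x₀, (f x *
      ∑ y, if x ≠ y ∧ x ≠ c - x - y ∧ y ≠ c - x - y then f y * f (c - x - y) else 0) ≤
      (a - f x₀) * s := by
    have : a - f x₀ = ∑ x ∈ Finset.univ.erase x₀, f x := by linarith
    rw [this, Finset.sum_mul]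
    refine Finset.sum_le_sum fun x _ => mul_le_mul_of_nonneg_left ?_ (hf x)
    have := inner_tripleSum_le f c x
    have := sq_nonneg (f x)
    linarith
  unfold tripleSum
  rw [← Finset.add_sum_erase _ _ (Finset.mem_univ x₀)]
  have h1 := mul_le_mul_of_nonneg_left hin (hf x₀)
  have h2 : f x₀ ≤ a := by
    have := Finset.sum_nonneg (s := Finset.univ.erase x₀) (f := f) (fun x _ => hf x)
    linarith
  have h3 : (9 / 10 * a) ^ 2 ≤ s := le_trans (by gcongr) hs0
  have h4 : f x₀ * (a / 10 * (a / 10)) ≤ a * (s / 81) :=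
    mul_le_mul h2 (by nlinarith) (by positivity) ha0
  have h5 : (a - f x₀) * s ≤ a / 10 * s :=
    mul_le_mul_of_nonneg_right (by linarith) (le_trans (sq_nonneg _) hs0)
  have h6 : 0 ≤ a * s := mul_nonneg ha0 (le_trans (sq_nonneg _) hs0)
  nlinarith

/-- The squared `ℓ²`-distance between `f` and its translate by `h`. -/
noncomputable def shiftDist {p : ℕ} [NeZero p] (f : ZMod p → ℝ) (h : ZMod p) : ℝ :=
  ∑ y, (f y - f (y + h)) ^ 2

lemma shiftDist_add_le {p : ℕ} [NeZero p] (f : ZMod p → ℝ) (h k : ZMod p) :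
    shiftDist f (h + k) ≤ 2 * shiftDist f h + 2 * shiftDist f k := by
  have hk : shiftDist f k = ∑ y, (f (y + h) - f (y + h + k)) ^ 2 :=
    (Equiv.sum_comp (Equiv.addRight h) (fun y => (f y - f (y + k)) ^ 2)).symm
  rw [hk]
  unfold shiftDist
  rw [Finset.mul_sum, Finset.mul_sum, ← Finset.sum_add_distrib]
  refine Finset.sum_le_sum fun y _ => ?_
  rw [← add_assoc]
  nlinarith [sq_nonneg ((f y - f (y + h)) - (f (y + h) - f (y + h + k)))]

lemma shiftDist_eq {p : ℕ} [NeZero p] (f : ZMod p → ℝ) (h : ZMod p) :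
    shiftDist f h = 2 * ∑ y, f y ^ 2 - 2 * ∑ y, f y * f (y + h) := by
  have hk : ∑ y, f (y + h) ^ 2 = ∑ y, f y ^ 2 :=
    Equiv.sum_comp (Equiv.addRight h) (fun y => f y ^ 2)
  have : shiftDist f h = ∑ y, f y ^ 2 + ∑ y, f (y + h) ^ 2 - 2 * ∑ y, f y * f (y + h) := by
    unfold shiftDist
    rw [Finset.mul_sum, ← Finset.sum_add_distrib, ← Finset.sum_sub_distrib]
    exact Finset.sum_congr rfl fun y _ => by ring
  rw [this, hk]
  ring

open scoped Pointwise in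
/-- If `f` is nearly invariant under a set `S` of translations which carries most of its mass,
then `S` is trivial or `f` is spread out. -/
lemma card_le_one_or_sum_sq_le {p : ℕ} [Fact p.Prime] (f : ZMod p → ℝ) (hf : ∀ x, 0 ≤ f x)
    (x₀ : ZMod p) (S : Finset (ZMod p)) (hS : S.Nonempty) (hpos : 0 < ∑ x, f x)
    (hshift : ∀ h ∈ S, shiftDist f h ≤ 1 / 20 * ∑ x, f x ^ 2)
    (hmass : 9 / 10 * ∑ x, f x ≤ ∑ h ∈ S, f (x₀ + h)) :
    S.card ≤ 1 ∨ 9 / 10 * p * ∑ x, f x ^ 2 ≤ (∑ x, f x) ^ 2 := by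
  classical
  set a := ∑ x, f x with ha
  set s := ∑ x, f x ^ 2 with hs
  have hCS : (9 / 10 * a) ^ 2 ≤ S.card * s := by
    calc (9 / 10 * a) ^ 2 ≤ (∑ h ∈ S, f (x₀ + h)) ^ 2 := by gcongr
      _ ≤ S.card * ∑ h ∈ S, f (x₀ + h) ^ 2 := sq_sum_le_card_mul_sum_sq
      _ ≤ S.card * s := by
        gcongr
        calc ∑ h ∈ S, f (x₀ + h) ^ 2 ≤ ∑ h, f (x₀ + h) ^ 2 :=
              Finset.sum_le_sum_of_subset_of_nonneg (Finset.subset_univ _)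
                fun _ _ _ => sq_nonneg _
          _ = s := Equiv.sum_comp (Equiv.addLeft x₀) (fun y => f y ^ 2)
  have hdouble : 9 / 10 * (S + S).card * s ≤ a ^ 2 := by
    have h1 : ∀ h ∈ S + S, 9 / 10 * s ≤ ∑ y, f y * f (y + h) := by
      intro h hh
      obtain ⟨u, hu, v, hv, rfl⟩ := Finset.mem_add.1 hh
      have := shiftDist_add_le f u v
      rw [shiftDist_eq f (u + v)] at this
      have := hshift u hu
      have := hshift v hv
      linarith
    have h2 : ∑ h ∈ S + S, ∑ y, f y * f (y + h) ≤ a ^ 2 := by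
      calc _ ≤ ∑ h, ∑ y, f y * f (y + h) :=
            Finset.sum_le_sum_of_subset_of_nonneg (Finset.subset_univ _)
              fun h _ _ => Finset.sum_nonneg fun y _ => mul_nonneg (hf _) (hf _)
        _ = ∑ y, f y * a := by
            rw [Finset.sum_comm]
            refine Finset.sum_congr rfl fun y _ => ?_
            rw [← Finset.mul_sum]
            congr 1
            exact Equiv.sum_comp (Equiv.addLeft y) f
        _ = a ^ 2 := by rw [← Finset.sum_mul]; ring
    have h3 := Finset.card_nsmul_le_sum _ _ _ h1
    rw [nsmul_eq_mul] at h3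
    linarith
  have hCD := ZMod.cauchy_davenport (Fact.out : p.Prime) hS hS
  have hs0 : 0 ≤ s := Finset.sum_nonneg fun _ _ => sq_nonneg _
  rcases min_le_iff.1 hCD with h | h
  · right
    have h' : (p : ℝ) ≤ (S + S).card := by exact_mod_cast h
    nlinarith [mul_le_mul_of_nonneg_right h' hs0]
  · left
    have h' : (2 * S.card - 1 : ℝ) ≤ (S + S).card := by
      have : 2 * S.card ≤ (S + S).card + 1 := by omega
      have : (2 * S.card : ℝ) ≤ (S + S).card + 1 := by exact_mod_cast this
      linarith
    by_contra! hc
    have hc' : (2 : ℝ) ≤ S.card := by exact_mod_cast hc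
    have hsp : 0 < s := by
      by_contra! hs'
      have : s = 0 := le_antisymm hs' hs0
      rw [this] at hCS
      nlinarith
    nlinarith [mul_le_mul_of_nonneg_right h' hs0, mul_le_mul_of_nonneg_right hc' hs0]

/-- The triple sum falls short of its trivial bound unless `f` is spread out. -/
lemma tripleSum_le_of_prime {p : ℕ} [Fact p.Prime] (f : ZMod p → ℝ) (hf : ∀ x, 0 ≤ f x)
    (c : ZMod p) :
    tripleSum f c ≤ 999 / 1000 * ((∑ x, f x) * ∑ x, f x ^ 2) + (∑ x, f x) ^ 3 / p := by
  classical
  set a := ∑ x, f x with ha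
  set s := ∑ x, f x ^ 2 with hs
  have hp0 : (0 : ℝ) < p := by exact_mod_cast (Fact.out : p.Prime).pos
  have ha0 : 0 ≤ a := Finset.sum_nonneg fun x _ => hf x
  have hs0 : 0 ≤ s := Finset.sum_nonneg fun _ _ => sq_nonneg _
  have hdiv : 0 ≤ a ^ 3 / p := by positivity
  have has : 0 ≤ a * s := mul_nonneg ha0 hs0
  have htriv : tripleSum f c ≤ a * s := by
    have := tripleSum_le f hf c
    have : 0 ≤ ∑ x, f x ^ 3 := Finset.sum_nonneg fun x _ => pow_nonneg (hf x) 3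
    linarith
  by_contra! hlt
  have hasp : 0 < a * s := by nlinarith
  have hap : 0 < a := by
    rcases ha0.eq_or_lt with h | h
    · rw [← h] at hasp; simp at hasp
    · exact h
  have hsp : 0 < s := by
    rcases hs0.eq_or_lt with h | h
    · rw [← h] at hasp; simp at hasp
    · exact h
  let d : ZMod p → ℝ := fun x => ∑ y, (f y - f (c - x - y)) ^ 2
  have hd0 : ∀ x, 0 ≤ d x := fun x => Finset.sum_nonneg fun _ _ => sq_nonneg _
  have hd : ∀ x, d x = 2 * s - 2 * ∑ y, f y * f (c - x - y) := by
    intro x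
    have hk := sum_reflect (fun y => f y ^ 2) (c - x)
    have : d x = ∑ y, f y ^ 2 + ∑ y, f (c - x - y) ^ 2 - 2 * ∑ y, f y * f (c - x - y) := by
      simp only [d]
      rw [Finset.mul_sum, ← Finset.sum_add_distrib, ← Finset.sum_sub_distrib]
      exact Finset.sum_congr rfl fun y _ => by ring
    rw [this, hk]
    ring
  have hfd : ∑ x, f x * d x < 2 / 1000 * (a * s) := by
    have h1 : tripleSum f c ≤ ∑ x, f x * ∑ y, f y * f (c - x - y) := by
      refine Finset.sum_le_sum fun x _ => mul_le_mul_of_nonneg_left ?_ (hf x)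
      refine Finset.sum_le_sum fun y _ => ?_
      split_ifs
      · exact le_rfl
      · exact mul_nonneg (hf _) (hf _)
    have h2 : ∑ x, f x * d x = 2 * (a * s) - 2 * ∑ x, f x * ∑ y, f y * f (c - x - y) := by
      rw [ha, Finset.sum_mul, Finset.mul_sum, Finset.mul_sum, ← Finset.sum_sub_distrib]
      refine Finset.sum_congr rfl fun x _ => ?_
      rw [hd]
      ring
    linarith
  obtain ⟨x₀, hx₀⟩ : ∃ x₀, d x₀ < 2 / 1000 * s := by
    by_contra! hall
    have : ∑ x, f x * (2 / 1000 * s) ≤ ∑ x, f x * d x :=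
      Finset.sum_le_sum fun x _ => mul_le_mul_of_nonneg_left (hall x) (hf x)
    rw [← Finset.sum_mul] at this
    linarith
  have hshift : ∀ h, shiftDist f h ≤ 2 * d (x₀ + h) + 2 * d x₀ := by
    intro h
    have h1 : shiftDist f h = ∑ y, (f (c - (x₀ + h) - y) - f (c - x₀ - y)) ^ 2 := by
      rw [← sum_reflect (fun y => (f (c - (x₀ + h) - y) - f (c - x₀ - y)) ^ 2) (c - (x₀ + h))]
      unfold shiftDist
      refine Finset.sum_congr rfl fun y _ => ?_
      congr 3 <;> ring
    rw [h1]
    simp only [d]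
    rw [Finset.mul_sum, Finset.mul_sum, ← Finset.sum_add_distrib]
    refine Finset.sum_le_sum fun y _ => ?_
    nlinarith [sq_nonneg ((f y - f (c - (x₀ + h) - y)) + (f y - f (c - x₀ - y)))]
  let S : Finset (ZMod p) := {h | shiftDist f h ≤ 1 / 20 * s}
  have hS0 : (0 : ZMod p) ∈ S := by
    have : shiftDist f 0 = 0 := by simp [shiftDist]
    simp only [S, Finset.mem_filter, Finset.mem_univ, true_and, this]
    positivity
  have hmass : 9 / 10 * a ≤ ∑ h ∈ S, f (x₀ + h) := by
    have h1 : ∑ h, f (x₀ + h) = a := Equiv.sum_comp (Equiv.addLeft x₀) f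
    have h2 : ∑ h, f (x₀ + h) * d (x₀ + h) = ∑ x, f x * d x :=
      Equiv.sum_comp (Equiv.addLeft x₀) (fun x => f x * d x)
    have h3 : (∑ h ∈ Sᶜ, f (x₀ + h)) * (23 / 1000 * s) ≤ ∑ h, f (x₀ + h) * d (x₀ + h) := by
      calc _ ≤ ∑ h ∈ Sᶜ, f (x₀ + h) * d (x₀ + h) := by
            rw [Finset.sum_mul]
            refine Finset.sum_le_sum fun h hh => mul_le_mul_of_nonneg_left ?_ (hf _)
            have hh' : 1 / 20 * s < shiftDist f h := by
              simpa [S] using hh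
            have := hshift h
            linarith
        _ ≤ _ := Finset.sum_le_sum_of_subset_of_nonneg (Finset.subset_univ _)
            fun h _ _ => mul_nonneg (hf _) (hd0 _)
    have h4 := Finset.sum_add_sum_compl S (fun h => f (x₀ + h))
    have h5 : (∑ h ∈ Sᶜ, f (x₀ + h)) * (23 / 1000) ≤ 2 / 1000 * a := by
      refine le_of_mul_le_mul_right ?_ hsp
      linarith
    linarith
  rcases card_le_one_or_sum_sq_le f hf x₀ S ⟨0, hS0⟩ hap
    (fun h hh => (Finset.mem_filter.1 hh).2) hmass with h | h
  · have hS : S = {0} := by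
      refine Finset.eq_singleton_iff_unique_mem.2 ⟨hS0, fun x hx => ?_⟩
      exact Finset.card_le_one.1 h x hx 0 hS0
    rw [hS] at hmass
    simp only [Finset.sum_singleton, add_zero] at hmass
    have := tripleSum_le_of_atom f hf c x₀ hmass
    linarith
  · have h1 : 9 / 10 * (a * s) ≤ a ^ 3 / p := by
      rw [le_div_iff₀ hp0]
      nlinarith
    linarith

lemma lagPoly_mono {V : Type*} {E F : Finset (Finset V)} (h : E ⊆ F) {y : V → ℝ}
    (hy : ∀ v, 0 ≤ y v) : lagPoly E y ≤ lagPoly F y := by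
  unfold lagPoly
  gcongr
  exact fun _ _ _ => Finset.prod_nonneg fun v _ => hy v

/-- Triples of residues whose sum is `0`, `1` or `2`. -/
def sumTriples (p : ℕ) [NeZero p] : Finset (Finset (ZMod p)) :=
  {e ∈ Finset.univ.powersetCard 3 | ∑ v ∈ e, v ∈ ({0, 1, 2} : Finset (ZMod p))}

lemma card_of_mem_sumTriples {p : ℕ} [NeZero p] {e : Finset (ZMod p)} (he : e ∈ sumTriples p) :
    e.card = 3 :=
  (Finset.mem_powersetCard.1 (Finset.mem_filter.1 he).1).2

lemma lagPoly_sumTriples {p : ℕ} [NeZero p] (f : ZMod p → ℝ) :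
    lagPoly (sumTriples p) f = ∑ c ∈ ({0, 1, 2} : Finset (ZMod p)), tripleSum f c := by
  rw [lagPoly_eq_sum_orderedTriples _ (fun e he => card_of_mem_sumTriples he)]
  unfold orderedTriples tripleSum
  rw [Finset.sum_filter, Fintype.sum_prod_type,
    Finset.sum_comm (s := ({0, 1, 2} : Finset (ZMod p)))]
  refine Finset.sum_congr rfl fun x _ => ?_
  rw [Fintype.sum_prod_type, ← Finset.mul_sum,
    Finset.sum_comm (s := ({0, 1, 2} : Finset (ZMod p))), Finset.mul_sum]
  refine Finset.sum_congr rfl fun y _ => ?_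
  let G : ZMod p → ℝ := fun c => if c ∈ ({0, 1, 2} : Finset (ZMod p)) then
    f x * (if x ≠ y ∧ x ≠ c - x - y ∧ y ≠ c - x - y then f y * f (c - x - y) else 0) else 0
  have hG : ∑ c, G c = f x * ∑ c ∈ ({0, 1, 2} : Finset (ZMod p)),
      (if x ≠ y ∧ x ≠ c - x - y ∧ y ≠ c - x - y then f y * f (c - x - y) else 0) := by
    rw [Finset.mul_sum, ← Finset.sum_filter, Finset.filter_univ_mem]
  rw [← hG, ← Equiv.sum_comp (Equiv.addLeft (x + y)) G]
  refine Finset.sum_congr rfl fun z _ => ?_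
  have hz : x + y + z - x - y = z := by ring
  simp only [G, Equiv.coe_addLeft, hz]
  by_cases hD : x ≠ y ∧ x ≠ z ∧ y ≠ z
  · have h_mem : ({x, y, z} : Finset (ZMod p)) ∈ sumTriples p ↔
        x + y + z ∈ ({0, 1, 2} : Finset (ZMod p)) := by
      have hc : ({x, y, z} : Finset (ZMod p)).card = 3 :=
        Finset.card_eq_three.2 ⟨x, y, z, hD.1, hD.2.1, hD.2.2, rfl⟩
      have hs : ∑ v ∈ ({x, y, z} : Finset (ZMod p)), v = x + y + z := by
        rw [Finset.sum_insert (by simp [hD.1, hD.2.1]), Finset.sum_insert (by simp [hD.2.2]),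
          Finset.sum_singleton, add_assoc]
      unfold sumTriples
      rw [Finset.mem_filter, hs, Finset.mem_powersetCard]
      simp only [hc, Finset.subset_univ, true_and]
    rw [if_pos hD]
    simp only [h_mem, ne_eq, hD.1, hD.2.1, hD.2.2, not_false_eq_true, true_and]
  · rw [if_neg hD, if_neg (by tauto)]
    simp

lemma le_tripleSum_const {p : ℕ} [NeZero p] (t : ℝ) (ht : 0 ≤ t) (c : ZMod p) :
    t ^ 3 * (p ^ 2 - 3 * p) ≤ tripleSum (fun _ => t) c := by
  have h1 : ∀ x : ZMod p, ∑ y, (if x = y then (1 : ℝ) else 0) = 1 := fun x => by simp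
  have h2 : ∀ x : ZMod p, ∑ y, (if x = c - x - y then (1 : ℝ) else 0) = 1 := fun x => by
    have : ∀ y, x = c - x - y ↔ c - x - x = y := fun y => by
      constructor <;> intro h
      · linear_combination -h
      · linear_combination -h
    simp [this]
  have h3 : ∑ x : ZMod p, ∑ y : ZMod p, (if y = c - x - y then (1 : ℝ) else 0) = p := by
    rw [Finset.sum_comm]
    have : ∀ y x : ZMod p, y = c - x - y ↔ c - y - y = x := fun y x => by
      constructor <;> intro h
      · linear_combination -h
      · linear_combination -h
    simp [this]
  have hcard : ∑ _x : ZMod p, (1 : ℝ) = p := by simp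
  calc t ^ 3 * (p ^ 2 - 3 * p) = ∑ x : ZMod p, ∑ y : ZMod p, t ^ 3 * (1 -
        (if x = y then (1 : ℝ) else 0) - (if x = c - x - y then (1 : ℝ) else 0) -
        (if y = c - x - y then (1 : ℝ) else 0)) := by
        have hcard' : ∑ _x : ZMod p, (p : ℝ) = p * p := by simp
        simp only [← Finset.mul_sum, Finset.sum_sub_distrib, h1, h2, h3, hcard, hcard']
        ring
    _ ≤ _ := by
        unfold tripleSum
        refine Finset.sum_le_sum fun x _ => ?_
        rw [Finset.mul_sum]
        refine Finset.sum_le_sum fun y _ => ?_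
        have : 0 ≤ t ^ 3 := by positivity
        split_ifs <;> first | nlinarith | (exfalso; tauto)

lemma le_lagPoly_sumTriples_const {p : ℕ} [NeZero p] (hp : 2 < p) (t : ℝ) (ht : 0 ≤ t) :
    3 * (t ^ 3 * (p ^ 2 - 3 * p)) ≤ lagPoly (sumTriples p) (fun _ => t) := by
  have : Fact (1 < p) := ⟨by omega⟩
  have : Fact (2 < p) := ⟨hp⟩
  have h01 : (0 : ZMod p) ≠ 1 := zero_ne_one
  have h12 : (1 : ZMod p) ≠ 2 := fun h => h01 (by linear_combination h)
  have h02 : (0 : ZMod p) ≠ 2 := fun h => by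
    have h2 : ((2 : ℕ) : ZMod p) = 0 := by push_cast; exact h.symm
    exact absurd (Nat.le_of_dvd (by norm_num) ((ZMod.natCast_eq_zero_iff _ _).1 h2)) (by omega)
  rw [lagPoly_sumTriples, Finset.sum_insert (by simp [h01, h02]), Finset.sum_insert (by simp [h12]),
    Finset.sum_singleton]
  linarith [le_tripleSum_const t ht (0 : ZMod p), le_tripleSum_const t ht (1 : ZMod p),
    le_tripleSum_const t ht (2 : ZMod p)]

lemma lagPoly_le_of_tripleSum_le {p : ℕ} [NeZero p] {H : Finset (Finset (ZMod p))}
    (hH : H ⊆ sumTriples p) {f : ZMod p → ℝ} (hf : ∀ x, 0 ≤ f x) {B : ℝ}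
    (hB : ∀ c, tripleSum f c ≤ B) : lagPoly H f ≤ 3 * B := by
  have hB0 : 0 ≤ B := by
    refine le_trans ?_ (hB 0)
    refine Finset.sum_nonneg fun x _ => mul_nonneg (hf x) (Finset.sum_nonneg fun y _ => ?_)
    split_ifs
    · exact mul_nonneg (hf _) (hf _)
    · exact le_rfl
  refine (lagPoly_mono hH hf).trans ?_
  rw [lagPoly_sumTriples]
  refine (Finset.sum_le_card_nsmul _ _ B fun c _ => hB c).trans ?_
  rw [nsmul_eq_mul]
  gcongr
  exact_mod_cast Finset.card_le_three

lemma lagPoly_le_of_subset_sumTriples {p : ℕ} [Fact p.Prime] {H : Finset (Finset (ZMod p))}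
    (hH : H ⊆ sumTriples p) {f : ZMod p → ℝ} (hf : ∀ x, 0 ≤ f x) :
    lagPoly H f ≤ 3 * (999 / 1000 * ((∑ x, f x) * ∑ x, f x ^ 2) + (∑ x, f x) ^ 3 / p) ∧
    lagPoly H f ≤ 3 * ((∑ x, f x) * (∑ x, f x ^ 2) - ∑ x, f x ^ 3) ∧
    lagPoly H f ≤ (∑ x, f x) ^ 3 - 3 * (∑ x, f x) * (∑ x, f x ^ 2) + 2 * ∑ x, f x ^ 3 := by
  refine ⟨lagPoly_le_of_tripleSum_le hH hf (tripleSum_le_of_prime f hf),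
    lagPoly_le_of_tripleSum_le hH hf (tripleSum_le f hf), ?_⟩
  rw [← lagPoly_powersetCard]
  exact lagPoly_mono (hH.trans (Finset.filter_subset _ _)) hf

/-- The Lagrangian polynomial of the limit of `joinTriples ∅`, with mass `a` on the first part. -/
noncomputable def baseValue (ν a : ℝ) : ℝ := 3 * a * (1 - a) * (1 - (1 - a) * ν)

lemma exists_isMaxOn_baseValue {ν : ℝ} (h0 : 0 < ν) (h1 : ν < 1) :
    ∃ a, 1 / 2 < a ∧ a ≤ 1 ∧ ∀ b ∈ Set.Icc (0 : ℝ) 1, baseValue ν b ≤ baseValue ν a := by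
  obtain ⟨a, ha, hmax⟩ := isCompact_Icc.exists_isMaxOn (Set.nonempty_Icc.2 zero_le_one)
    (f := baseValue ν) (by unfold baseValue; fun_prop)
  refine ⟨a, ?_, ha.2, fun b hb => hmax hb⟩
  by_contra! hle
  have hb := hmax (show 1 / 2 + ν / 8 ∈ Set.Icc (0 : ℝ) 1 by constructor <;> linarith)
  have hc : baseValue ν a ≤ baseValue ν (1 / 2) := by
    unfold baseValue
    have := ha.1
    have h2 : 0 ≤ (1 / 2 - a) ^ 2 * (1 - (1 - a) * ν) := by
      have : (1 - a) * ν ≤ 1 := by nlinarith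
      have : 0 ≤ 1 - (1 - a) * ν := by linarith
      positivity
    have h3 : 0 ≤ (1 / 2 - a) * ν := by
      have : 0 ≤ 1 / 2 - a := by linarith
      positivity
    nlinarith
  have hd : baseValue ν (1 / 2) < baseValue ν (1 / 2 + ν / 8) := by
    unfold baseValue
    have : baseValue ν (1 / 2 + ν / 8) - baseValue ν (1 / 2) =
        3 / 4 * (ν ^ 2 / 8 - ν ^ 2 / 16 * (1 - ν / 2 + ν ^ 2 / 8)) := by
      unfold baseValue
      ring
    unfold baseValue at this
    have : 0 < ν ^ 2 := by positivity
    have : ν ^ 2 / 8 ≤ ν / 2 := by nlinarith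
    nlinarith
  exact absurd (hb.trans hc) (not_le.2 hd)

lemma baseValue_half (ν : ℝ) : baseValue ν (1 / 2) = 3 / 4 - 3 / 8 * ν := by
  unfold baseValue
  ring

/-- If the polynomial of the join is at least the maximum of `baseValue`, then its weights inside
the first part are spread out. -/
lemma sum_sq_le_of_baseValue_le {ν a w s t q L p α : ℝ} (hν0 : 0 < ν) (hν : ν ≤ 1 / 160000000)
    (ha : 0 ≤ a) (hw : 0 ≤ w) (haw : a + w = 1) (hs : 0 ≤ s) (ht : 0 ≤ t) (hst : s ^ 2 ≤ a * t)
    (hq : ν * w ^ 2 ≤ q) (hp : 0 < p)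
    (hL1 : L ≤ 3 * (999 / 1000 * (a * s) + a ^ 3 / p)) (hL2 : L ≤ 3 * (a * s - t))
    (hL3 : L ≤ a ^ 3 - 3 * a * s + 2 * t) (hα1 : baseValue ν a ≤ α)
    (hα2 : baseValue ν (1 / 2) ≤ α) (hP : α ≤ 3 * a * w - 3 * w * s - 3 * a * q + L) :
    s * p ≤ 4000 := by
  rw [baseValue_half] at hα2
  have hq0 : 0 ≤ q := le_trans (by positivity) hq
  have haq : 0 ≤ a * q := by positivity
  have hws : 0 ≤ w * s := by positivity
  have ha1 : a ≤ 1 := by linarith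
  have hw1 : w ≤ 1 := by linarith
  have haw' : a * w ≤ w := by nlinarith
  have ha3 : a ^ 3 ≤ 1 := pow_le_one₀ ha ha1
  have hA : 3 / 4 - 3 / 8 * ν ≤ 3 * (a * w) + a ^ 3 / 2 := by linarith
  have hw20 : 1 / 20 ≤ w := by linarith
  have ha0 : 0 < a := by
    rcases ha.eq_or_lt with h | h
    · rw [← h] at hA
      norm_num at hA
      linarith
    · exact h
  set g := a - w with hg
  have haw4 : a * w = (1 - g ^ 2) / 4 := by
    have : (a + w) ^ 2 = 1 := by rw [haw]; norm_num
    rw [hg]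
    linarith
  have hB : 3 * (g * s) - 3 * t ≤ 3 / 4 * (a * g ^ 2) := by
    refine le_of_mul_le_mul_left ?_ ha0
    nlinarith [sq_nonneg (s - a * g / 2)]
  have hB' : w * g ^ 2 ≤ ν / 2 := by
    have h1 : a * g ^ 2 = g ^ 2 - w * g ^ 2 := by
      have : a = 1 - w := by linarith
      rw [this]
      ring
    have h2 : g * s = a * s - w * s := by rw [hg]; ring
    nlinarith
  have hg1 : g ≤ 1 / 4000 := by
    have h1 : g ^ 2 ≤ 10 * ν := by nlinarith [sq_nonneg g]
    exact abs_le_of_sq_le_sq' (by linarith : g ^ 2 ≤ (1 / 4000) ^ 2) (by norm_num) |>.2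
  have hC : 999 / 1000 * a - w ≤ -(1 / 4000) := by
    have : a = (1 + g) / 2 := by rw [hg]; linarith
    have : w = (1 - g) / 2 := by rw [hg]; linarith
    linarith
  have hbase : baseValue ν a = 3 * (a * w) - 3 * (a * (ν * w ^ 2)) := by
    unfold baseValue
    have : w = 1 - a := by linarith
    rw [this]
    ring
  have haq' : a * (ν * w ^ 2) ≤ a * q := mul_le_mul_of_nonneg_left hq ha
  have hCs := mul_le_mul_of_nonneg_right hC hs
  have hfin : s / 4000 ≤ a ^ 3 / p := by linarith
  have hfin' : s / 4000 ≤ 1 / p := hfin.trans (by gcongr)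
  rw [le_div_iff₀ hp] at hfin'
  linarith

lemma exists_subset_erase_le_lt {X : Type*} [DecidableEq X] (L : Finset X → ℝ) {b : ℝ}
    {M : Finset X} (h0 : L ∅ ≤ b) (hM : b < L M) :
    ∃ H ⊆ M, ∃ e ∈ H, b < L H ∧ L (H.erase e) ≤ b := by
  induction M using Finset.induction_on with
  | empty => exact absurd hM (not_lt.2 h0)
  | insert x M hx ih =>
    by_cases h : b < L M
    · obtain ⟨H, hH, e, he, h⟩ := ih h
      exact ⟨H, hH.trans (Finset.subset_insert _ _), e, he, h⟩
    · refine ⟨insert x M, subset_rfl, x, Finset.mem_insert_self _ _, hM, ?_⟩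
      rw [Finset.erase_insert hx]
      exact not_lt.1 h

lemma sum_sq_mul_le_of_le_lagPoly {p n : ℕ} [Fact p.Prime] (hn : 160000000 ≤ n)
    {H : Finset (Finset (ZMod p))} (hH : H ⊆ sumTriples p) {α : ℝ}
    (hα : ∀ b ∈ Set.Icc (0 : ℝ) 1, baseValue (1 / n) b ≤ α) {y : ZMod p ⊕ Fin n → ℝ}
    (hy : y ∈ stdSimplex ℝ (ZMod p ⊕ Fin n)) (hP : α ≤ lagPoly (joinTriples H) y) :
    (∑ x, y (.inl x) ^ 2) * p ≤ 4000 := by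
  have hn' : (160000000 : ℝ) ≤ n := by exact_mod_cast hn
  have hn0 : (0 : ℝ) < n := by linarith
  have hsum : ∑ x, y (.inl x) + ∑ u, y (.inr u) = 1 := by
    rw [← Fintype.sum_sum_type]
    exact hy.2
  have ha : 0 ≤ ∑ x, y (.inl x) := Finset.sum_nonneg fun x _ => hy.1 _
  have hw : 0 ≤ ∑ u, y (.inr u) := Finset.sum_nonneg fun x _ => hy.1 _
  obtain ⟨hL1, hL2, hL3⟩ := lagPoly_le_of_subset_sumTriples hH (f := fun x => y (.inl x))
    (fun x => hy.1 _)
  refine sum_sq_le_of_baseValue_le (ν := 1 / n) (q := ∑ u, y (.inr u) ^ 2) (by positivity) ?_ ha hw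
    hsum (Finset.sum_nonneg fun x _ => sq_nonneg _)
    (Finset.sum_nonneg fun x _ => pow_nonneg (hy.1 (.inl x)) 3) ?_ ?_
    (by exact_mod_cast (Fact.out : p.Prime).pos) hL1 hL2 hL3 (hα _ ⟨ha, by linarith⟩)
    (hα _ ⟨by norm_num, by norm_num⟩) ?_
  · exact one_div_le_one_div_of_le (by norm_num) hn'
  · exact Finset.sum_sq_le_sum_mul_sum_of_sq_le_mul _ (fun x _ => hy.1 _)
      (fun x _ => pow_nonneg (hy.1 _) 3) fun x _ => le_of_eq (by ring)
  · have := sq_sum_le_card_mul_sum_sq (s := Finset.univ) (f := fun u => y (.inr u : ZMod p ⊕ Fin n))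
    rw [Finset.card_univ, Fintype.card_fin] at this
    rw [one_div, inv_mul_le_iff₀ hn0]
    exact this
  · rw [lagPoly_joinTriples (fun e he => card_of_mem_sumTriples (hH he)), hsum, mul_one] at hP
    exact hP

lemma lagMax_joinTriples_empty_le {A : Type*} [Fintype A] [DecidableEq A] {n : ℕ} (hn : 0 < n)
    {α : ℝ} (hα : ∀ b ∈ Set.Icc (0 : ℝ) 1, baseValue (1 / n) b ≤ α) :
    lagMax (joinTriples (∅ : Finset (Finset A)) : Finset (Finset (A ⊕ Fin n))) ≤ α := by
  have hn0 : (0 : ℝ) < n := by exact_mod_cast hn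
  have : Nonempty (A ⊕ Fin n) := ⟨.inr ⟨0, hn⟩⟩
  obtain ⟨y, hy, hmax⟩ := exists_lagPoly_eq_lagMax
    (joinTriples (∅ : Finset (Finset A)) : Finset (Finset (A ⊕ Fin n)))
  rw [← hmax, lagPoly_joinTriples (by simp)]
  have hsum : ∑ x, y (.inl x) + ∑ u, y (.inr u) = 1 := by
    rw [← Fintype.sum_sum_type]
    exact hy.2
  have ha : 0 ≤ ∑ x, y (.inl x) := Finset.sum_nonneg fun x _ => hy.1 _
  have hw : 0 ≤ ∑ u, y (.inr u) := Finset.sum_nonneg fun x _ => hy.1 _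
  have hs : 0 ≤ ∑ x, y (.inl x) ^ 2 := Finset.sum_nonneg fun x _ => sq_nonneg _
  have hq := sq_sum_le_card_mul_sum_sq (s := Finset.univ) (f := fun u => y (.inr u : A ⊕ Fin n))
  rw [Finset.card_univ, Fintype.card_fin, ← inv_mul_le_iff₀ hn0, ← one_div] at hq
  refine le_trans ?_ (hα _ ⟨ha, by linarith⟩)
  rw [hsum]
  generalize ∑ x, y (.inl x) = a at *
  generalize ∑ u, y (.inr u) = w at *
  obtain rfl : w = 1 - a := by linarith
  have h1 := mul_le_mul_of_nonneg_left hq ha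
  have h2 := mul_nonneg hw hs
  unfold baseValue
  simp only [lagPoly, Finset.sum_empty]
  linarith

lemma le_lagMax_joinTriples_sumTriples {p n : ℕ} [NeZero p] (hn : 0 < n) (hp : 2 < p) {a : ℝ}
    (ha : 1 / 2 < a) (ha1 : a ≤ 1) (hpa : 9 / (2 * a - 1) ≤ p) :
    baseValue (1 / n) a + (2 * a - 1) / 2 / p ≤
      lagMax (joinTriples (sumTriples p) : Finset (Finset (ZMod p ⊕ Fin n))) := by
  have hn0 : (0 : ℝ) < n := by exact_mod_cast hn
  have hp0 : (0 : ℝ) < p := by exact_mod_cast (by omega : 0 < p)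
  have : Nonempty (ZMod p ⊕ Fin n) := ⟨.inr ⟨0, hn⟩⟩
  let y : ZMod p ⊕ Fin n → ℝ := Sum.elim (fun _ => a / p) (fun _ => (1 - a) / n)
  have hsA : ∑ x : ZMod p, y (.inl x) = a := by simp [y]; field_simp
  have hsW : ∑ u : Fin n, y (.inr u) = 1 - a := by simp [y]; field_simp
  have hsA2 : ∑ x : ZMod p, y (.inl x) ^ 2 = a ^ 2 / p := by simp [y]; field_simp
  have hsW2 : ∑ u : Fin n, y (.inr u) ^ 2 = (1 - a) ^ 2 / n := by simp [y]; field_simp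
  have hy : y ∈ stdSimplex ℝ (ZMod p ⊕ Fin n) := by
    refine ⟨?_, ?_⟩
    · rintro (x | u)
      · exact div_nonneg (by linarith) hp0.le
      · exact div_nonneg (by linarith) hn0.le
    · rw [Fintype.sum_sum_type, hsA, hsW]
      ring
  refine le_trans ?_ (lagPoly_le_lagMax _ hy)
  rw [lagPoly_joinTriples (fun e he => card_of_mem_sumTriples he), hsA, hsW, hsA2, hsW2]
  have hL := le_lagPoly_sumTriples_const hp (a / p) (div_nonneg (by linarith) hp0.le)
  have hL' : 3 * ((a / p) ^ 3 * ((p : ℝ) ^ 2 - 3 * p)) = 3 * a ^ 3 / p - 9 * a ^ 3 / p / p := by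
    field_simp
    ring
  rw [hL'] at hL
  have hy' : (fun x => y (.inl x)) = fun _ : ZMod p => a / p := rfl
  rw [hy']
  have hbase : baseValue (1 / n) a = 3 * a * (1 - a) - 3 * a * ((1 - a) ^ 2 / n) := by
    unfold baseValue
    field_simp
  have h9 : 9 / (p : ℝ) ≤ 2 * a - 1 := by
    rw [div_le_iff₀ (by linarith)] at hpa
    rw [div_le_iff₀ hp0]
    linarith
  have hkey : (2 * a - 1) / 2 / p ≤ 3 * a ^ 3 / p - 9 * a ^ 3 / p / p - 3 * (1 - a) * (a ^ 2 / p) := by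
    have h1 : 3 * a ^ 3 / p - 9 * a ^ 3 / p / p - 3 * (1 - a) * (a ^ 2 / p) =
        (3 * a ^ 2 * (2 * a - 1) - a ^ 3 * (9 / p)) / p := by
      field_simp
      ring
    rw [h1]
    gcongr
    have h2 : a ^ 3 * (9 / p) ≤ a ^ 2 * (2 * a - 1) := by
      have : a ^ 3 ≤ a ^ 2 := pow_le_pow_of_le_one (by linarith) ha1 (by norm_num)
      gcongr
    have h3 : 1 / 4 ≤ a ^ 2 := by nlinarith
    nlinarith
  rw [hbase, add_sub_cancel, mul_one]
  linarith

/-- Deleting one triple inside the first part changes the maximum by little. -/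
lemma lagMax_joinTriples_le_erase {A : Type*} [Fintype A] [DecidableEq A] {n : ℕ} (hn : 0 < n)
    {H : Finset (Finset A)} (hH : ∀ e ∈ H, e.card = 3) {e : Finset A} (he : e ∈ H) {B : ℝ}
    (hB : 0 ≤ B) (hspread : ∀ y ∈ stdSimplex ℝ (A ⊕ Fin n),
      lagPoly (joinTriples H) y = lagMax (joinTriples H : Finset (Finset (A ⊕ Fin n))) →
      ∑ x, y (.inl x) ^ 2 ≤ B ^ 2) :
    lagMax (joinTriples H : Finset (Finset (A ⊕ Fin n))) ≤
      lagMax (joinTriples (H.erase e) : Finset (Finset (A ⊕ Fin n))) + 6 * B ^ 3 := by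
  have : Nonempty (A ⊕ Fin n) := ⟨.inr ⟨0, hn⟩⟩
  obtain ⟨y, hy, hmax⟩ := exists_lagPoly_eq_lagMax
    (joinTriples H : Finset (Finset (A ⊕ Fin n)))
  have hsq := hspread y hy hmax
  have hle : ∀ x, y (.inl x) ≤ B := fun x => by
    refine abs_le_of_sq_le_sq' (le_trans ?_ hsq) hB |>.2
    exact Finset.single_le_sum (f := fun x => y (.inl x) ^ 2) (fun x _ => sq_nonneg _)
      (Finset.mem_univ x)
  have hprod : ∏ v ∈ e, y (.inl v) ≤ B ^ 3 := by
    rw [← hH e he, ← Finset.prod_const]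
    exact Finset.prod_le_prod (fun x _ => hy.1 _) fun x _ => hle x
  have herase := lagPoly_le_lagMax (joinTriples (H.erase e)) hy
  rw [lagPoly_joinTriples fun d hd => hH d (Finset.mem_of_mem_erase hd)] at herase
  rw [← hmax, lagPoly_joinTriples hH]
  have hsplit : lagPoly H (fun x => y (.inl x)) =
      lagPoly (H.erase e) (fun x => y (.inl x)) + 6 * ∏ v ∈ e, y (.inl v) := by
    unfold lagPoly
    rw [← Finset.add_sum_erase H _ he]
    ring
  rw [hsplit]
  linarith

/-- There are Lagrangians just above every number slightly larger than `α`. -/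
lemma exists_lagrangian_near : ∃ α K s₀ : ℝ, 0 < K ∧ 0 < s₀ ∧ ∀ s, 0 < s → s < s₀ →
    ∃ G : HGraph 3, α + s ^ 2 < lagrangian G ∧ lagrangian G ≤ α + s ^ 2 + K * s ^ 3 := by
  obtain ⟨n, hn⟩ : ∃ n : ℕ, 160000000 ≤ n := ⟨160000000, le_rfl⟩
  have hn0 : 0 < n := by omega
  have hn' : (160000000 : ℝ) ≤ n := by exact_mod_cast hn
  obtain ⟨a, ha, ha1, hmax⟩ := exists_isMaxOn_baseValue (ν := 1 / n) (by positivity)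
    (by rw [div_lt_one (by linarith)]; linarith)
  set c := (2 * a - 1) / 2 with hc
  have hc0 : 0 < c := by linarith
  have hc1 : c ≤ 1 / 2 := by linarith
  refine ⟨baseValue (1 / n) a, 6 * √(32000 / c) ^ 3, c / 10, by positivity, by positivity,
    fun s hs hs0 => ?_⟩
  have hs2 : s ^ 2 < c ^ 2 / 100 := by nlinarith
  set q := ⌊c / (4 * s ^ 2)⌋₊ with hq
  have hq1 : (q : ℝ) ≤ c / (4 * s ^ 2) := Nat.floor_le (by positivity)
  have hq2 : c / (4 * s ^ 2) < q + 1 := Nat.lt_floor_add_one _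
  have hbig : 25 / c < c / (4 * s ^ 2) := by
    rw [div_lt_div_iff₀ hc0 (by positivity)]
    nlinarith
  have h50 : 50 ≤ 25 / c := by
    rw [le_div_iff₀ hc0]
    linarith
  have hq0 : q ≠ 0 := by
    intro h
    rw [h] at hq2
    norm_num at hq2
    linarith
  obtain ⟨p, hp, hqp, hp2⟩ := Nat.exists_prime_lt_and_le_two_mul q hq0
  have : Fact p.Prime := ⟨hp⟩
  have hp0 : (0 : ℝ) < p := by exact_mod_cast hp.pos
  have hqp' : (q : ℝ) + 1 ≤ p := by exact_mod_cast hqp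
  have hp2' : (p : ℝ) ≤ 2 * q := by exact_mod_cast hp2
  have hplow : c / (4 * s ^ 2) < p := by linarith
  have hphigh : (p : ℝ) * s ^ 2 ≤ c / 2 := by
    have : (p : ℝ) ≤ c / (2 * s ^ 2) := by
      have : c / (2 * s ^ 2) = 2 * (c / (4 * s ^ 2)) := by
        field_simp
        norm_num
      linarith
    rw [le_div_iff₀ (by positivity)] at this
    linarith
  have hpc : s ^ 2 < c / p := by
    rw [lt_div_iff₀ hp0]
    linarith
  have hpgt : 2 < p := by
    have : (2 : ℝ) < p := by linarith
    exact_mod_cast this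
  have htop := le_lagMax_joinTriples_sumTriples hn0 hpgt ha ha1 (by
    have : 2 * a - 1 = 2 * c := by rw [hc]; ring
    rw [this]
    have : 9 / (2 * c) ≤ 25 / c := by
      rw [div_le_div_iff₀ (by positivity) hc0]
      linarith
    linarith)
  obtain ⟨H, hH, e, he, hlt, hle⟩ := exists_subset_erase_le_lt
    (fun H => lagMax (joinTriples H : Finset (Finset (ZMod p ⊕ Fin n))))
    (b := baseValue (1 / n) a + s ^ 2) (M := sumTriples p)
    ((lagMax_joinTriples_empty_le hn0 hmax).trans (by nlinarith)) (by linarith)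
  obtain ⟨G, hG⟩ := exists_lagrangian_eq_lagMax
    (joinTriples H : Finset (Finset (ZMod p ⊕ Fin n))) fun e he => card_of_mem_joinTriples he
  refine ⟨G, by rw [hG]; exact hlt, ?_⟩
  have hstep := lagMax_joinTriples_le_erase hn0
    (fun e he => card_of_mem_sumTriples (hH he)) he (B := √(32000 / c) * s) (by positivity) (by
      intro y hy hy'
      have h1 := sum_sq_mul_le_of_le_lagPoly hn hH hmax hy (by rw [hy']; nlinarith)
      rw [mul_pow, Real.sq_sqrt (by positivity)]
      have h2 : c < 4 * s ^ 2 * p := by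
        rw [div_lt_iff₀ (by positivity)] at hplow
        linarith
      rw [← le_div_iff₀ hp0] at h1
      refine h1.trans ?_
      rw [div_le_iff₀ hp0, div_mul_eq_mul_div, div_mul_eq_mul_div, le_div_iff₀ hc0]
      linarith)
  rw [hG]
  rw [mul_pow] at hstep
  linarith

lemma exists_seq_of_near {X : Type*} (f : X → ℝ) {α K s₀ : ℝ} (hK : 0 < K) (hs₀ : 0 < s₀)
    (h : ∀ s, 0 < s → s < s₀ → ∃ x, α + s ^ 2 < f x ∧ f x ≤ α + s ^ 2 + K * s ^ 3) :
    ∃ P : ℕ → X, (∀ i, α < f (P i)) ∧ (StrictAnti fun i => f (P i)) ∧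
      Tendsto (fun i => f (P i)) atTop (nhds α) ∧
      Tendsto (fun i => (f (P i) - α) / (f (P (i + 1)) - α)) atTop (nhds 1) := by
  obtain ⟨M, hM⟩ := exists_nat_gt (max 1 (max K (1 / s₀)))
  have hM1 : (1 : ℝ) < M := (le_max_left _ _).trans_lt hM
  have hMK : K < M := ((le_max_left _ _).trans (le_max_right _ _)).trans_lt hM
  have hMs : 1 / s₀ < M := ((le_max_right _ _).trans (le_max_right _ _)).trans_lt hM
  let m : ℕ → ℝ := fun i => i + M
  have hmM : ∀ i, (M : ℝ) ≤ m i := fun i => le_add_of_nonneg_left (Nat.cast_nonneg i)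
  have hm0 : ∀ i, 0 < m i := fun i => by linarith [hmM i]
  have hm_succ : ∀ i, m (i + 1) = m i + 1 := fun i => by
    simp only [m]
    push_cast
    ring
  have hm_top : Tendsto m atTop atTop :=
    tendsto_atTop_add_const_right _ _ tendsto_natCast_atTop_atTop
  have hm_inv : Tendsto (fun i => (m i)⁻¹) atTop (nhds 0) := tendsto_inv_atTop_zero.comp hm_top
  have hex : ∀ i, ∃ x, α + ((m i)⁻¹ ^ 2) ^ 2 < f x ∧
      f x ≤ α + ((m i)⁻¹ ^ 2) ^ 2 + K * ((m i)⁻¹ ^ 2) ^ 3 := fun i => by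
    have hmi := hm0 i
    refine h _ (by positivity) ?_
    have h1 : (m i)⁻¹ < s₀ := by
      rw [inv_lt_comm₀ hmi hs₀, ← one_div]
      exact hMs.trans_le (hmM i)
    have h2 : (m i)⁻¹ ≤ 1 := inv_le_one_of_one_le₀ (hM1.le.trans (hmM i))
    have h3 : 0 < (m i)⁻¹ := inv_pos.2 hmi
    nlinarith
  choose P hlow hhigh using hex
  have hpos : ∀ i, α < f (P i) := fun i => by
    have hmi := hm0 i
    have : 0 < ((m i)⁻¹ ^ 2) ^ 2 := by positivity
    linarith [hlow i]
  refine ⟨P, hpos, strictAnti_nat_of_succ_lt fun i => ?_, ?_, ?_⟩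
  · have hmi := hm0 i
    have hKm : K ≤ m i := hMK.le.trans (hmM i)
    refine (hhigh (i + 1)).trans_lt (lt_of_le_of_lt ?_ (hlow i))
    rw [hm_succ, add_assoc]
    gcongr
    have h1 : ((m i + 1)⁻¹ ^ 2) ^ 2 + K * ((m i + 1)⁻¹ ^ 2) ^ 3 =
        ((m i + 1) ^ 2 + K) / (m i + 1) ^ 6 := by
      field_simp
    have h2 : ((m i)⁻¹ ^ 2) ^ 2 = 1 / m i ^ 4 := by
      field_simp
    rw [h1, h2, div_le_div_iff₀ (by positivity) (by positivity)]
    generalize m i = t at *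
    have h3 : K * t ^ 4 ≤ t * t ^ 4 := by gcongr
    have h4 : 0 ≤ 1 * (t + 1) ^ 6 - ((t + 1) ^ 2 + t) * t ^ 4 := by
      ring_nf
      positivity
    linarith
  · refine tendsto_of_tendsto_of_tendsto_of_le_of_le tendsto_const_nhds ?_ (fun i => (hpos i).le)
      hhigh
    simpa using ((hm_inv.pow 2).pow 2).const_add α |>.add (((hm_inv.pow 2).pow 3).const_mul K)
  · have hu : Tendsto (fun i => (f (P i) - α) * m i ^ 4) atTop (nhds 1) := by
      refine tendsto_of_tendsto_of_tendsto_of_le_of_le tendsto_const_nhds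
        (h := fun i => 1 + K * (m i)⁻¹ ^ 2) ?_ (fun i => ?_) fun i => ?_
      · simpa using ((hm_inv.pow 2).const_mul K).const_add 1
      · have hmi := hm0 i
        calc (1 : ℝ) = ((m i)⁻¹ ^ 2) ^ 2 * m i ^ 4 := by field_simp
          _ ≤ (f (P i) - α) * m i ^ 4 := by
            gcongr
            linarith [hlow i]
      · have hmi := hm0 i
        calc (f (P i) - α) * m i ^ 4
            ≤ (((m i)⁻¹ ^ 2) ^ 2 + K * ((m i)⁻¹ ^ 2) ^ 3) * m i ^ 4 := by
              gcongr
              linarith [hhigh i]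
          _ = 1 + K * (m i)⁻¹ ^ 2 := by field_simp
    have hr : Tendsto (fun i => (1 + (m i)⁻¹) ^ 4) atTop (nhds 1) := by
      simpa using (hm_inv.const_add 1).pow 4
    have := (hu.div (hu.comp (tendsto_add_atTop_nat 1)) one_ne_zero).mul hr
    rw [div_one, one_mul] at this
    refine this.congr fun i => ?_
    have hmi := hm0 i
    have h1 : f (P (i + 1)) - α ≠ 0 := (sub_pos.2 (hpos (i + 1))).ne'
    simp only [Function.comp_apply, Pi.div_apply, hm_succ]
    field_simp

/-- There are a real `α` and finite `3`-graphs `P_i` with `λ(P_i) > α`,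
`λ(P_i)` strictly decreasing to `α`, and `(λ(P_i) − α)/(λ(P_{i+1}) − α) → 1`. -/
theorem smooth_decreasing_sequence :
    ∃ (α : ℝ) (P : ℕ → HGraph 3),
      (∀ i, α < lagrangian (P i)) ∧
      (StrictAnti fun i => lagrangian (P i)) ∧
      Tendsto (fun i => lagrangian (P i)) atTop (nhds α) ∧
      Tendsto (fun i => (lagrangian (P i) - α) / (lagrangian (P (i + 1)) - α))
        atTop (nhds 1) := by
  obtain ⟨α, K, s₀, hK, hs₀, h⟩ := exists_lagrangian_near
  exact ⟨α, exists_seq_of_near lagrangian hK hs₀ h⟩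
end

section
/- Let p ≡ 1 (mod 4) be a prime. Then there is a strictly increasing sequence of primes q₁ < q₂ < q₃ < ⋯ such that for every j ≥ 1: q_j ≡ 1 (mod 4), p is a quadratic residue modulo q_j (i.e., the Legendre symbol (p/q_j) = 1), q_j → ∞, and q_{j+1}/q_j → 1 as j → ∞. -/
open Filter

section

open MeasureTheory FourierTransform Complex

/-- Integrating a Dirichlet series on a vertical line against a kernel evaluates the Fourier
transform of the kernel at logarithms. -/
lemma hasSum_term_mul_fourier {w : ℕ → ℂ} {k : ℝ → ℂ} (hk : Integrable k) {σ : ℝ}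
    (hw : LSeriesSummable w σ) (θ y : ℝ) :
    HasSum (fun n => LSeries.term w σ n * 𝓕 k (θ * (Real.log n - y)))
      (∫ t, k t * exp (2 * Real.pi * θ * t * y * I) * LSeries w (σ + 2 * Real.pi * θ * t * I)) := by
  let G (n : ℕ) (t : ℝ) : ℂ := exp ((-2 * Real.pi * t * (θ * (Real.log n - y)) : ℝ) * I) • k t
  have hterm (n : ℕ) (t : ℝ) : k t * exp (2 * Real.pi * θ * t * y * I) *
      LSeries.term w (σ + 2 * Real.pi * θ * t * I) n = LSeries.term w σ n * G n t := by
    rcases eq_or_ne n 0 with rfl | hn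
    · simp
    have hn' : (n : ℂ) ≠ 0 := by exact_mod_cast hn
    rw [LSeries.term_of_ne_zero hn, LSeries.term_of_ne_zero hn, cpow_add _ _ hn',
      div_mul_eq_div_div, div_eq_mul_inv _ ((n : ℂ) ^ (2 * Real.pi * θ * t * I)),
      cpow_def_of_ne_zero hn' (2 * Real.pi * θ * t * I), ← exp_neg, ← natCast_log]
    simp only [G, smul_eq_mul]
    rw [show ((-2 * Real.pi * t * (θ * (Real.log n - y)) : ℝ) * I : ℂ) =
      2 * Real.pi * θ * t * y * I + -(Real.log n * (2 * Real.pi * θ * t * I)) by push_cast; ring,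
      exp_add]
    ring
  have hnorm (n : ℕ) (t : ℝ) : ‖LSeries.term w σ n * G n t‖ = ‖LSeries.term w σ n‖ * ‖k t‖ := by
    simp only [G, smul_eq_mul, norm_mul, norm_exp_ofReal_mul_I, one_mul]
  have hG (n : ℕ) : Integrable (G n) := by
    refine hk.bdd_mul (c := 1) (Continuous.aestronglyMeasurable (by fun_prop))
      (.of_forall fun t => (norm_exp_ofReal_mul_I _).le)
  have := hasSum_integral_of_summable_integral_norm (F := fun n t => LSeries.term w σ n * G n t)
    (fun n => (hG n).const_mul _) (by
      simp only [hnorm, integral_const_mul]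
      exact hw.norm.mul_right _)
  convert! this using 1
  · ext n
    rw [integral_const_mul, Real.fourier_real_eq_integral_exp_smul]
  · refine integral_congr_ae (.of_forall fun t => ?_)
    simp only [LSeries, ← hterm, tsum_mul_left]

/-- Integrating the principal part of a simple pole on a vertical line against a kernel. -/
lemma integral_kernel_div {k : ℝ → ℂ} (hk : Integrable k) {a : ℝ} (ha : 0 < a) (θ y : ℝ) :
    ∫ t, k t * exp (2 * Real.pi * θ * t * y * I) * (1 / (a + 2 * Real.pi * θ * t * I)) =
      ∫ u in Set.Ioi (0 : ℝ), (Real.exp (-a * u) : ℂ) * 𝓕 k (θ * (u - y)) := by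
  have hinner (t : ℝ) : 1 / (a + 2 * Real.pi * θ * t * I) =
      ∫ u in Set.Ioi (0 : ℝ), exp (-(a + 2 * Real.pi * θ * t * I) * u) := by
    rw [integral_exp_mul_complex_Ioi (by simpa using ha), ofReal_zero, mul_zero, exp_zero, div_neg,
      neg_div, neg_neg]
  simp_rw [hinner, ← integral_const_mul]
  have hexp : IntegrableOn (fun u : ℝ => (Real.exp (-a * u) : ℂ)) (Set.Ioi 0) :=
    (integrableOn_exp_mul_Ioi (neg_neg_of_pos ha) 0).ofReal
  rw [integral_integral_swap]
  · refine integral_congr_ae (.of_forall fun u => ?_)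
    simp only
    rw [Real.fourier_real_eq_integral_exp_smul, ← integral_const_mul]
    refine integral_congr_ae (.of_forall fun t => ?_)
    simp only [smul_eq_mul]
    rw [mul_assoc, ← exp_add, ofReal_exp, ← mul_assoc, ← exp_add, mul_comm]
    congr 2
    push_cast
    ring
  · refine (hk.mul_prod hexp).mono ?_ (.of_forall fun z => le_of_eq ?_)
    · refine (hk.1.comp_fst.mul ?_).mul ?_ <;>
      exact Continuous.aestronglyMeasurable (by fun_prop)
    · simp [Function.uncurry, norm_exp]

/-- The Fourier transform of a real even function is real valued. -/
lemma fourier_im_eq_zero_of_even {f : ℝ → ℝ} (hf : ∀ x, f (-x) = f x) (v : ℝ) :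
    (𝓕 (fun x => (f x : ℂ)) v).im = 0 := by
  rw [← conj_eq_iff_im, Real.fourier_real_eq_integral_exp_smul, ← integral_conj,
    ← integral_neg_eq_self]
  refine integral_congr_ae (.of_forall fun x => ?_)
  simp only [smul_eq_mul, map_mul, conj_ofReal, ← exp_conj, conj_I, hf]
  congr 2
  push_cast
  ring

/-- There is a Schwartz function with compact support whose Fourier transform is real, non-positive
outside of a bounded interval, and has positive integral. -/
lemma exists_compactSupport_fourier_nonpos :
    ∃ (k : SchwartzMap ℝ ℂ) (R : ℝ), HasCompactSupport k ∧ 0 < R ∧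
      (∀ v, R ≤ |v| → (𝓕 k v).re ≤ 0) ∧ 0 < ∫ v, (𝓕 k v).re := by
  let b : ContDiffBump (0 : ℝ) := ⟨1, 2, one_pos, one_lt_two⟩
  have hb : HasCompactSupport fun x => (b x : ℂ) := b.hasCompactSupport.comp_left ofReal_zero
  let φ : SchwartzMap ℝ ℂ := hb.toSchwartzMap (ofRealCLM.contDiff.comp b.contDiff)
  have hφ : ⇑φ = fun x => (b x : ℂ) := rfl
  let φ' : SchwartzMap ℝ ℂ := SchwartzMap.derivCLM ℂ ℂ φ
  have hφ' : ⇑φ' = deriv φ := rfl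
  have hφ's : HasCompactSupport φ' := hb.deriv
  let B := ContinuousLinearMap.mul ℂ ℂ
  let k₀ := SchwartzMap.convolution B φ φ
  let k₁ := SchwartzMap.convolution B φ' φ'
  have hk₀s : HasCompactSupport k₀ := by
    have : ⇑k₀ = _ := funext (SchwartzMap.convolution_apply B φ φ)
    rw [this]; exact hb.convolution _ hb
  have hk₁s : HasCompactSupport k₁ := by
    have : ⇑k₁ = _ := funext (SchwartzMap.convolution_apply B φ' φ')
    rw [this]; exact hφ's.convolution _ hφ's
  let g : ℝ → ℝ := fun v => (𝓕 φ v).re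
  have hg (v) : 𝓕 φ v = g v := by
    apply Complex.ext
    · simp [g]
    · exact fourier_im_eq_zero_of_even b.neg v
  have hF₀ (v) : 𝓕 k₀ v = ((g v ^ 2 : ℝ) : ℂ) := by
    rw [SchwartzMap.fourier_convolution]
    simp only [SchwartzMap.pairing_apply_apply, B, ContinuousLinearMap.mul_apply', hg]
    push_cast; ring
  have hF' (v) : 𝓕 φ' v = 2 * Real.pi * I * v * g v := by
    rw [SchwartzMap.fourier_coe, hφ', Real.fourier_deriv φ.integrable φ.differentiable
      φ'.integrable, ← hg]
    simp [SchwartzMap.fourier_coe]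
  have hF₁ (v) : 𝓕 k₁ v = ((- (4 * Real.pi ^ 2 * v ^ 2 * g v ^ 2) : ℝ) : ℂ) := by
    rw [SchwartzMap.fourier_convolution]
    simp only [SchwartzMap.pairing_apply_apply, B, ContinuousLinearMap.mul_apply', hF']
    push_cast
    linear_combination (4 * Real.pi ^ 2 * v ^ 2 * g v ^ 2 : ℂ) * I_sq
  have hi₀ : Integrable fun v => (𝓕 k₀ v).re := (𝓕 k₀).integrable.re
  have hi₁ : Integrable fun v => (𝓕 k₁ v).re := (𝓕 k₁).integrable.re
  have hg0 : g 0 ≠ 0 := by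
    have : (𝓕 φ 0) = ((∫ x, b x : ℝ) : ℂ) := by
      rw [SchwartzMap.fourier_coe, Real.fourier_real_eq_integral_exp_smul, ← integral_complex_ofReal]
      simp [hφ]
    have h0 : g 0 = ∫ x, b x := by exact_mod_cast (hg 0).symm.trans this
    rw [h0]
    exact b.integral_pos.ne'
  have hA : 0 < ∫ v, (𝓕 k₀ v).re := by
    have hnn (v) : 0 ≤ (𝓕 k₀ v).re := by rw [hF₀, ofReal_re]; exact sq_nonneg (g v)
    rw [integral_pos_iff_support_of_nonneg hnn hi₀]
    refine IsOpen.measure_pos _ (Continuous.isOpen_support ?_) ⟨0, ?_⟩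
    · exact continuous_re.comp (𝓕 k₀).continuous
    · rw [Function.mem_support, hF₀, ofReal_re]; exact pow_ne_zero 2 hg0
  set A := ∫ v, (𝓕 k₀ v).re
  set D := ∫ v, (𝓕 k₁ v).re with hD
  obtain ⟨C, hC, hCA⟩ : ∃ C : ℝ, 0 < C ∧ 0 < A + C * D := by
    have hlim : Tendsto (fun C : ℝ => A + C * D) (nhdsWithin 0 (Set.Ioi 0)) (nhds (A + 0 * D)) :=
      (Continuous.tendsto (by fun_prop) _).mono_left nhdsWithin_le_nhds
    obtain ⟨C, h1, h2⟩ := ((hlim.eventually_const_lt (by simpa using hA)).and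
      self_mem_nhdsWithin).exists
    exact ⟨C, h2, h1⟩
  have hF (v) : 𝓕 (k₀ + (C : ℂ) • k₁) v
      = (((1 - C * (4 * Real.pi ^ 2) * v ^ 2) * g v ^ 2 : ℝ) : ℂ) := by
    rw [FourierTransform.fourier_add, FourierTransform.fourier_smul, add_apply,
      smul_apply, hF₀, hF₁]
    push_cast [smul_eq_mul]
    ring
  refine ⟨k₀ + (C : ℂ) • k₁, max 1 (1 / (C * (4 * Real.pi ^ 2))), ?_, by positivity,
    fun v hv => ?_, ?_⟩
  · exact hk₀s.add (hk₁s.smul_left (f := fun _ => (C : ℂ)))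
  · rw [hF, ofReal_re]
    have h1 : 1 ≤ |v| := (le_max_left _ _).trans hv
    have h2 : 1 / (C * (4 * Real.pi ^ 2)) ≤ |v| ^ 2 :=
      ((le_max_right _ _).trans hv).trans (by nlinarith)
    rw [sq_abs, div_le_iff₀' (by positivity)] at h2
    exact mul_nonpos_of_nonpos_of_nonneg (by linarith) (sq_nonneg _)
  · refine hCA.trans_eq ?_
    rw [hD, ← integral_const_mul, ← integral_add hi₀ (hi₁.const_mul _)]
    refine integral_congr_ae (.of_forall fun v => ?_)
    simp only [hF, hF₀, hF₁, ofReal_re]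
    ring

lemma tendsto_integral_exp_neg_mul {f : ℝ → ℂ} (hf : Integrable f) :
    Tendsto (fun a : ℝ => ∫ u in Set.Ioi (0 : ℝ), (Real.exp (-a * u) : ℂ) * f u)
      (nhdsWithin 0 (Set.Ioi 0)) (nhds (∫ u in Set.Ioi (0 : ℝ), f u)) := by
  refine tendsto_integral_filter_of_dominated_convergence (fun u => ‖f u‖) ?_ ?_
    hf.norm.integrableOn (.of_forall fun u => ?_)
  · refine .of_forall fun a => .mul (Continuous.aestronglyMeasurable (by fun_prop)) hf.1.restrict
  · filter_upwards [self_mem_nhdsWithin] with a ha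
    filter_upwards [ae_restrict_mem measurableSet_Ioi] with u hu
    rw [norm_mul, norm_real, Real.norm_eq_abs, Real.abs_exp]
    refine mul_le_of_le_one_left (norm_nonneg _) (Real.exp_le_one_iff.mpr ?_)
    have := mul_pos (Set.mem_Ioi.mp ha) (Set.mem_Ioi.mp hu)
    linarith
  · have : Continuous fun a : ℝ => (Real.exp (-a * u) : ℂ) * f u := by fun_prop
    simpa using (this.tendsto 0).mono_left nhdsWithin_le_nhds

lemma tendsto_setIntegral_comp_sub {f : ℝ → ℂ} (hf : Integrable f) :
    Tendsto (fun y : ℝ => ∫ u in Set.Ioi (0 : ℝ), f (u - y)) atTop (nhds (∫ u, f u)) := by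
  have h (y : ℝ) : ∫ u in Set.Ioi (0 : ℝ), f (u - y) = ∫ u in Set.Ioi (-y), f u := by
    rw [← (measurePreserving_sub_right volume y).setIntegral_preimage_emb
      (measurableEmbedding_subRight y) f]
    simp
  simp_rw [h]
  exact (aecover_Ioi tendsto_neg_atTop_atBot).integral_tendsto_of_countably_generated hf

/-- If a Dirichlet series with non-negative coefficients extends continuously to `1 ≤ re s` up to
a simple pole at `s = 1` with positive residue, then the logarithms of its support have gaps
tending to zero. -/
theorem eventually_exists_abs_log_sub_lt {w : ℕ → ℝ} (hw : ∀ n, 0 ≤ w n)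
    (hsum : ∀ s : ℂ, 1 < s.re → LSeriesSummable (fun n => (w n : ℂ)) s) {F : ℂ → ℂ}
    (hF : ContinuousOn F {s | 1 ≤ s.re}) {c : ℝ} (hc : 0 < c)
    (hFeq : ∀ s : ℂ, 1 < s.re → F s = LSeries (fun n => (w n : ℂ)) s - c / (s - 1))
    {δ : ℝ} (hδ : 0 < δ) :
    ∀ᶠ y : ℝ in atTop, ∃ n, n ≠ 0 ∧ w n ≠ 0 ∧ |Real.log n - y| < δ := by
  obtain ⟨k, R, hks, hR, hkneg, hkpos⟩ := exists_compactSupport_fourier_nonpos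
  set θ := R / δ with hθ
  have hθ0 : 0 < θ := by positivity
  set M : ℝ → ℂ := 𝓕 (k : ℝ → ℂ) with hM
  have hMi : Integrable fun u => M (θ * u) := (𝓕 k).integrable.comp_mul_left' hθ0.ne'
  let e (y t : ℝ) : ℂ := exp (2 * Real.pi * θ * t * y * I)
  let J (y : ℝ) : ℂ := (∫ t, k t * e y t * F (1 + 2 * Real.pi * θ * t * I)) +
    c * ∫ u in Set.Ioi (0 : ℝ), M (θ * (u - y))
  have hRL : Tendsto (fun y => ∫ t, k t * e y t * F (1 + 2 * Real.pi * θ * t * I)) atTop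
      (nhds 0) := by
    have h1 : Tendsto (fun y : ℝ => -(θ * y)) atTop (cocompact ℝ) :=
      (tendsto_neg_atTop_atBot.comp (tendsto_id.const_mul_atTop hθ0)).mono_right
        atBot_le_cocompact
    refine ((Real.zero_at_infty_fourier
      fun t => k t * F (1 + 2 * Real.pi * θ * t * I)).comp h1).congr fun y => ?_
    simp only [Function.comp_apply, Real.fourier_real_eq_integral_exp_smul]
    refine integral_congr_ae (.of_forall fun t => ?_)
    simp only [e, smul_eq_mul]
    rw [← mul_assoc, mul_comm (k t)]
    congr 3
    push_cast
    ring
  have hJlim : Tendsto (fun y => (J y).re) atTop (nhds (c * (θ⁻¹ * ∫ v, (M v).re))) := by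
    have h1 := hRL.add ((tendsto_setIntegral_comp_sub hMi).const_mul (c : ℂ))
    have h2 := (continuous_re.tendsto _).comp h1
    convert! h2 using 2
    rw [zero_add, re_ofReal_mul, Measure.integral_comp_mul_left M, abs_of_pos (inv_pos.mpr hθ0),
      smul_re, smul_eq_mul]
    congr 2
    exact integral_re (𝕜 := ℂ) (𝓕 k).integrable
  have hJpos : ∀ᶠ y in atTop, 0 < (J y).re :=
    hJlim.eventually_const_lt (mul_pos hc (mul_pos (inv_pos.mpr hθ0) hkpos))
  filter_upwards [hJpos] with y hy
  by_contra! hgap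
  refine hy.not_ge ?_
  have hcontJ : Tendsto (fun a : ℝ => ((∫ t, k t * e y t * F (1 + a + 2 * Real.pi * θ * t * I)) +
      c * ∫ u in Set.Ioi (0 : ℝ), (Real.exp (-a * u) : ℂ) * M (θ * (u - y))).re)
      (nhdsWithin 0 (Set.Ioi 0)) (nhds (J y).re) := by
    refine (continuous_re.tendsto _).comp (.add ?_ (.const_mul _ ?_))
    · have : ContinuousOn (fun a : ℝ => ∫ t, k t * e y t * F (1 + a + 2 * Real.pi * θ * t * I))
          (Set.Ici 0) := by
        refine continuousOn_integral_of_compact_support hks.isCompact ?_ fun a t _ ht => ?_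
        · refine .mul (Continuous.continuousOn (by fun_prop))
            (hF.comp (Continuous.continuousOn (by fun_prop)) fun z hz => ?_)
          simpa using hz.1
        · simp [image_eq_zero_of_notMem_tsupport ht]
      have h0 := this 0 Set.self_mem_Ici
      simp only [ContinuousWithinAt, ofReal_zero, add_zero] at h0
      exact h0.mono_left (nhdsWithin_mono _ Set.Ioi_subset_Ici_self)
    · exact tendsto_integral_exp_neg_mul (hMi.comp_sub_right y)
  refine le_of_tendsto hcontJ ?_
  filter_upwards [self_mem_nhdsWithin] with a ha
  replace ha : 0 < a := ha
  have hs : LSeriesSummable (fun n => (w n : ℂ)) ((1 + a : ℝ) : ℂ) :=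
    hsum _ (by rw [ofReal_re]; linarith)
  have hsm := hasSum_term_mul_fourier k.integrable hs θ y
  have hFe : ((∫ t, k t * e y t * F (1 + a + 2 * Real.pi * θ * t * I)) +
      c * ∫ u in Set.Ioi (0 : ℝ), (Real.exp (-a * u) : ℂ) * M (θ * (u - y))) =
      ∫ t, k t * e y t * LSeries (fun n => (w n : ℂ)) ((1 + a : ℝ) + 2 * Real.pi * θ * t * I) := by
    rw [hM, ← integral_kernel_div k.integrable ha, ← integral_const_mul, ← integral_add]
    · refine integral_congr_ae (.of_forall fun t => ?_)
      simp only
      rw [hFeq _ (by simpa using ha)]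
      push_cast
      rw [show (1 : ℂ) + a + 2 * Real.pi * θ * t * I - 1 = a + 2 * Real.pi * θ * t * I by ring]
      simp only [e]
      ring
    · refine Continuous.integrable_of_hasCompactSupport (.mul (by fun_prop)
        (hF.comp_continuous (by fun_prop) fun t => ?_)) (hks.mul_right.mul_right)
      simpa using ha.le
    · refine (Continuous.integrable_of_hasCompactSupport (.mul (by fun_prop)
        (.div continuous_const (by fun_prop) fun t h => ha.ne' ?_))
        (hks.mul_right.mul_right)).const_mul _
      simpa using congrArg re h
  rw [hFe]
  refine (hasSum_re hsm).nonpos fun n => ?_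
  rcases eq_or_ne n 0 with rfl | hn
  · simp
  rcases eq_or_ne (w n) 0 with hwn | hwn
  · simp [LSeries.term_of_ne_zero hn, hwn]
  have hterm : LSeries.term (fun n => (w n : ℂ)) ((1 + a : ℝ) : ℂ) n =
      ((w n / (n : ℝ) ^ (1 + a) : ℝ) : ℂ) := by
    rw [LSeries.term_of_ne_zero hn]
    push_cast [ofReal_cpow (Nat.cast_nonneg n)]
    rfl
  rw [hterm, re_ofReal_mul]
  refine mul_nonpos_of_nonneg_of_nonpos (div_nonneg (hw n) (by positivity)) (hkneg _ ?_)
  rw [abs_mul, abs_of_pos hθ0, hθ, div_mul_eq_mul_div, le_div_iff₀ hδ]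
  gcongr
  exact hgap n hn hwn

/-- A Dirichlet series with non-negative coefficients that converges at `s = 1` is continuous on
`1 ≤ re s`. -/
lemma continuousOn_LSeries_of_summable_div {v : ℕ → ℝ} (hv : ∀ n, 0 ≤ v n)
    (hsum : Summable fun n => v n / n) :
    ContinuousOn (LSeries fun n => (v n : ℂ)) {s | 1 ≤ s.re} := by
  refine continuousOn_tsum (fun n => ?_) hsum fun n s hs => ?_
  · rcases eq_or_ne n 0 with rfl | hn
    · simpa using continuousOn_const
    · have hn' : (n : ℂ) ≠ 0 := by exact_mod_cast hn
      simp_rw [LSeries.term_of_ne_zero hn]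
      refine Continuous.continuousOn (.div continuous_const ?_ fun s => ?_)
      · exact continuous_const.cpow continuous_id fun _ => natCast_mem_slitPlane.mpr hn
      · simp [cpow_eq_zero_iff, hn']
  · rcases eq_or_ne n 0 with rfl | hn
    · simp
    · refine (LSeries.norm_term_le_of_re_le_re _ (s := 1) (by simpa using hs) n).trans_eq ?_
      simp [LSeries.term_of_ne_zero hn, abs_of_nonneg (hv n)]

open ArithmeticFunction.vonMangoldt in
/-- Every short logarithmic interval far enough out contains the logarithm of a prime in a given
invertible residue class. -/
theorem eventually_exists_prime_abs_log_sub_lt {N : ℕ} [NeZero N] {a : ZMod N} (ha : IsUnit a)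
    {δ : ℝ} (hδ : 0 < δ) :
    ∀ᶠ y : ℝ in atTop, ∃ n : ℕ, (n.Prime ∧ (n : ZMod N) = a) ∧ |Real.log n - y| < δ := by
  let w (n : ℕ) : ℝ := if n.Prime then residueClass a n else 0
  let v (n : ℕ) : ℝ := if n.Prime then 0 else residueClass a n
  have hw (n) : 0 ≤ w n := by
    simp only [w]; split_ifs; exacts [residueClass_nonneg a n, le_rfl]
  have hv (n) : 0 ≤ v n := by
    simp only [v]; split_ifs; exacts [le_rfl, residueClass_nonneg a n]
  have hwv (n) : w n + v n = residueClass a n := by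
    simp only [w, v]; split_ifs <;> simp
  have hres {s : ℂ} (hs : 1 < s.re) : LSeriesSummable (fun n => (residueClass a n : ℂ)) s :=
    LSeriesSummable_of_abscissaOfAbsConv_lt_re <|
      (abscissaOfAbsConv_residueClass_le_one a).trans_lt (by exact_mod_cast hs)
  have hle {u : ℕ → ℝ} (hu : ∀ n, 0 ≤ u n) (hur : ∀ n, u n ≤ residueClass a n) (s : ℂ)
      (hs : 1 < s.re) : LSeriesSummable (fun n => (u n : ℂ)) s := by
    refine .of_norm_bounded (hres hs).norm fun n => LSeries.norm_term_le s ?_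
    simpa [abs_of_nonneg (hu n), abs_of_nonneg (residueClass_nonneg a n)] using hur n
  have hws := hle hw fun n => by linarith [hwv n, hv n]
  have hvs := hle hv fun n => by linarith [hwv n, hw n]
  have hFeq (s : ℂ) (hs : 1 < s.re) :
      LFunctionResidueClassAux a s - LSeries (fun n => (v n : ℂ)) s =
        LSeries (fun n => (w n : ℂ)) s - ((N.totient : ℝ)⁻¹ : ℝ) / (s - 1) := by
    have h := LSeries_add (hws s hs) (hvs s hs)
    have h2 : (fun n => (w n : ℂ)) + (fun n => (v n : ℂ)) =
        fun n => (residueClass a n : ℂ) := by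
      ext n
      simp [← hwv]
    rw [h2] at h
    rw [eqOn_LFunctionResidueClassAux ha hs]
    simp only [h]
    push_cast
    ring
  filter_upwards [eventually_exists_abs_log_sub_lt hw hws
    ((continuousOn_LFunctionResidueClassAux a).sub
      (continuousOn_LSeries_of_summable_div hv (summable_residueClass_non_primes_div a)))
    (inv_pos.mpr (Nat.cast_pos.mpr (Nat.totient_pos.mpr (NeZero.pos N)))) hFeq hδ]
    with y ⟨n, _, hwn, hny⟩
  have hnp : n.Prime := by_contra fun h => hwn (by simp [w, h])
  refine ⟨n, ⟨hnp, by_contra fun h => hwn ?_⟩, hny⟩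
  simp [w, h]

/-- If every short logarithmic interval far enough out meets the set of logarithms of a set of
natural numbers, then the ratios of consecutive elements of this set tend to `1`. -/
lemma tendsto_nth_succ_div_nth {P : ℕ → Prop} (hinf : (Set.ofPred P).Infinite)
    (hP : ∀ δ : ℝ, 0 < δ → ∀ᶠ y : ℝ in atTop, ∃ n : ℕ, P n ∧ |Real.log n - y| < δ) :
    Tendsto (fun j => (Nat.nth P (j + 1) : ℝ) / Nat.nth P j) atTop (nhds 1) := by
  classical
  have hmono := Nat.nth_strictMono hinf
  have hlog : Tendsto (fun j => Real.log (Nat.nth P j)) atTop atTop :=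
    Real.tendsto_log_atTop.comp (tendsto_natCast_atTop_atTop.comp hmono.tendsto_atTop)
  have hpos : ∀ᶠ j in atTop, 0 < Nat.nth P j := hmono.tendsto_atTop.eventually_gt_atTop 0
  have hdiff : Tendsto (fun j => Real.log (Nat.nth P (j + 1)) - Real.log (Nat.nth P j)) atTop
      (nhds 0) := by
    refine Metric.tendsto_nhds.mpr fun ε hε => ?_
    have hev := (tendsto_atTop_add_const_right _ (ε / 2) hlog).eventually (hP (ε / 2) (half_pos hε))
    filter_upwards [hev, hpos] with j ⟨n, hn, hnj⟩ hj
    rw [abs_lt] at hnj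
    have hj' : (0 : ℝ) < Nat.nth P j := by exact_mod_cast hj
    have hn0 : (0 : ℝ) < n := by
      rcases Nat.eq_zero_or_pos n with rfl | h
      · rw [Nat.cast_zero, Real.log_zero] at hnj
        linarith [Real.log_natCast_nonneg (Nat.nth P j)]
      · exact_mod_cast h
    have hjn : Nat.nth P j < n := by
      exact_mod_cast (Real.log_lt_log_iff hj' hn0).mp (by linarith)
    have hsucc : Nat.nth P (j + 1) ≤ n := by
      rw [← Nat.nth_count hn] at hjn ⊢
      exact hmono.monotone (hmono.lt_iff_lt.mp hjn)
    have h1 : Nat.nth P j < Nat.nth P (j + 1) := hmono j.lt_succ_self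
    have h2 := Real.log_le_log hj' (Nat.cast_le.mpr h1.le)
    have h3 := Real.log_le_log (hj'.trans (Nat.cast_lt.mpr h1)) (Nat.cast_le.mpr hsucc)
    rw [Real.dist_eq, sub_zero, abs_of_nonneg (by linarith)]
    linarith
  have hexp := (Real.continuous_exp.tendsto 0).comp hdiff
  rw [Real.exp_zero] at hexp
  refine hexp.congr' ?_
  filter_upwards [hpos] with j hj
  have hj' : 0 < Nat.nth P (j + 1) := hj.trans (hmono j.lt_succ_self)
  rw [Function.comp_apply, Real.exp_sub, Real.exp_log (Nat.cast_pos.mpr hj'),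
    Real.exp_log (Nat.cast_pos.mpr hj)]

end

/-- For a prime `p ≡ 1 (mod 4)` there is a strictly increasing sequence of primes
`q_j ≡ 1 (mod 4)` such that `p` is a nonzero quadratic residue modulo each `q_j`
(Legendre symbol `(p/q_j) = 1`), `q_j → ∞`, and `q_{j+1}/q_j → 1`. -/
theorem choice_of_primes (p : ℕ) (hp : p.Prime) (hp4 : p % 4 = 1) :
    ∃ q : ℕ → ℕ, StrictMono q ∧
      (∀ j, (q j).Prime) ∧
      (∀ j, q j % 4 = 1) ∧
      (∀ j, (p : ZMod (q j)) ≠ 0 ∧ IsSquare (p : ZMod (q j))) ∧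
      Tendsto q atTop atTop ∧
      Tendsto (fun j => (q (j + 1) : ℝ) / (q j : ℝ)) atTop (nhds 1) := by
  have : NeZero (4 * p) := ⟨by have := hp.pos; lia⟩
  have : Fact p.Prime := ⟨hp⟩
  let P (n : ℕ) : Prop := n.Prime ∧ (n : ZMod (4 * p)) = 1
  have hinf : (Set.ofPred P).Infinite := Nat.infinite_setOfPred_prime_and_eq_mod isUnit_one
  have hmono := Nat.nth_strictMono hinf
  have hmem (j) : P (Nat.nth P j) := Nat.nth_mem_of_infinite hinf j
  have hmod {d n : ℕ} (hd : d ∣ 4 * p) (hn : P n) : n ≡ 1 [MOD d] := by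
    refine Nat.ModEq.of_dvd hd ((ZMod.natCast_eq_natCast_iff n 1 (4 * p)).mp ?_)
    rw [hn.2, Nat.cast_one]
  have hmod4 (j) : Nat.nth P j % 4 = 1 := hmod (dvd_mul_right 4 p) (hmem j)
  refine ⟨Nat.nth P, hmono, fun j => (hmem j).1, hmod4, fun j => ?_, hmono.tendsto_atTop,
    tendsto_nth_succ_div_nth hinf fun δ hδ => eventually_exists_prime_abs_log_sub_lt isUnit_one hδ⟩
  have hq := hmod (dvd_mul_left p 4) (hmem j)
  have : Fact (Nat.nth P j).Prime := ⟨(hmem j).1⟩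
  have hodd : Nat.nth P j ≠ 2 := fun h => by simpa [h] using hmod4 j
  constructor
  · rw [Ne, ZMod.natCast_eq_zero_iff, Nat.prime_dvd_prime_iff_eq (hmem j).1 hp]
    intro h
    rw [h] at hq
    exact hp.one_lt.ne' (by simpa [Nat.ModEq, Nat.mod_eq_of_lt hp.one_lt] using hq.symm)
  · refine (ZMod.exists_sq_eq_prime_iff_of_mod_four_eq_one hp4 hodd).mp ?_
    rw [(ZMod.natCast_eq_natCast_iff _ 1 p).mpr hq, Nat.cast_one]
    exact IsSquare.one
end
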